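/- arXiv:2003.02233 — 2 statements merged into one kernel-verified Lean document; each statement's English description precedes it below -/
import Mathlib

section
/- Let d, m ≥ 1, let (Ω,μ) be a σ-finite measure space, let r⃗ ∈ (0,∞)^m and t⃗ ∈ (0,∞]^m with r_j < t_j for all j, set 1/r := ∑_{j=1}^m 1/r_j and 1/t := ∑_{j=1}^m 1/t_j, assume t < ∞, and let q ∈ [r, t]. Then there is a constant C depending only on d, m, q, r⃗, t⃗ such that for every finite collection 𝒟 of cubes, all jointly measurable f_j : ℝ^d × Ω → ℂ with f_j(·,ω) locally r_j-integrable and ‖f_j(x,·)‖_{L^{t_j}(Ω)} locally r_j-integrable in x, and every measurable g : ℝ^d → ℂ with |g|^q locally integrable: ‖ ‖M̃^𝒟_{r⃗}(f_1,…,f_m)(x,·)‖_{L^t(Ω)} · g(x) ‖_{L^q(ℝ^d, dx)} ≤ C ‖M_{(r_1,…,r_m,q)}(‖f_1(·,·)‖_{L^{t_1}(Ω)},…,‖f_m(·,·)‖_{L^{t_m}(Ω)}, g)‖_{L^q(ℝ^d)}. -/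
open MeasureTheory ENNReal

noncomputable section

structure Cube (d : ℕ) where
  corner : Fin d → ℝ
  side : ℝ
  side_pos : 0 < side

namespace Cube
def set {d : ℕ} (Q : Cube d) : Set (Fin d → ℝ) :=
  {x | ∀ i, Q.corner i ≤ x i ∧ x i < Q.corner i + Q.side}
def vol {d : ℕ} (Q : Cube d) : ℝ≥0∞ := volume Q.set
def IsDyadic {d : ℕ} (Q : Cube d) : Prop :=
  ∃ (k : ℤ) (n : Fin d → ℤ), Q.side = (2:ℝ) ^ (-k) ∧ ∀ i, Q.corner i = (2:ℝ) ^ (-k) * (n i : ℝ)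
end Cube

def IsSparse {d : ℕ} (S : Set (Cube d)) : Prop :=
  ∃ E : Cube d → Set (Fin d → ℝ),
    (∀ Q ∈ S, MeasurableSet (E Q) ∧ E Q ⊆ Q.set ∧ Q.vol ≤ 2 * volume (E Q)) ∧
    S.PairwiseDisjoint E

def eNorm {α : Type*} [MeasurableSpace α] (p : ℝ≥0∞) (μ : Measure α) (F : α → ℝ≥0∞) : ℝ≥0∞ :=
  if p = ∞ then essSup F μ else (∫⁻ x, F x ^ p.toReal ∂μ) ^ (1 / p.toReal)

def nn {α : Type*} (f : α → ℂ) : α → ℝ≥0∞ := fun x => (‖f x‖₊ : ℝ≥0∞)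

def avg {d : ℕ} (r : ℝ≥0∞) (F : (Fin d → ℝ) → ℝ≥0∞) (Q : Cube d) : ℝ≥0∞ :=
  if r = ∞ then essSup F (volume.restrict Q.set)
  else ((∫⁻ x in Q.set, F x ^ r.toReal) / Q.vol) ^ (1 / r.toReal)

def maximal {d k : ℕ} (r : Fin k → ℝ≥0∞) (F : Fin k → (Fin d → ℝ) → ℝ≥0∞)
    (x : Fin d → ℝ) : ℝ≥0∞ :=
  ⨆ (Q : Cube d) (_ : x ∈ Q.set), ∏ j, avg (r j) (F j) Q

def maximalX {d k : ℕ} (r : Fin k → ℝ≥0∞) (ρ : ℝ≥0∞) (F : Fin k → (Fin d → ℝ) → ℝ≥0∞)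
    (G : (Fin d → ℝ) → ℝ≥0∞) (x : Fin d → ℝ) : ℝ≥0∞ :=
  ⨆ (Q : Cube d) (_ : x ∈ Q.set), (∏ j, avg (r j) (F j) Q) * avg ρ G Q

def wNorm {d : ℕ} (p : ℝ≥0∞) (w : (Fin d → ℝ) → ℝ) (F : (Fin d → ℝ) → ℝ≥0∞) : ℝ≥0∞ :=
  eNorm p volume (fun x => F x * ENNReal.ofReal (w x))

def aConst {d m : ℕ} (p r : Fin m → ℝ≥0∞) (s : ℝ≥0∞)
    (w : Fin m → (Fin d → ℝ) → ℝ) : ℝ≥0∞ :=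
  ⨆ Q : Cube d,
    (∏ j, avg ((r j)⁻¹ - (p j)⁻¹)⁻¹ (fun x => ENNReal.ofReal (w j x)⁻¹) Q) *
      avg ((∑ j, (p j)⁻¹) - s⁻¹)⁻¹ (fun x => ENNReal.ofReal (∏ j, w j x)) Q

def latAvg {d : ℕ} {Ω : Type*} (r : ℝ≥0∞) (f : (Fin d → ℝ) → Ω → ℂ) (Q : Cube d) (ω : Ω) : ℝ≥0∞ :=
  ((∫⁻ y in Q.set, (‖f y ω‖₊ : ℝ≥0∞) ^ r.toReal) / Q.vol) ^ (1 / r.toReal)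

def latMax {d m : ℕ} {Ω : Type*} (r : Fin m → ℝ≥0∞) (D : Finset (Cube d))
    (f : Fin m → (Fin d → ℝ) → Ω → ℂ) (x : Fin d → ℝ) (ω : Ω) : ℝ≥0∞ :=
  ⨆ Q ∈ D, ⨆ (_ : x ∈ Cube.set Q), ∏ j, latAvg (r j) (f j) Q ω

def latMaxX {d m : ℕ} {Ω : Type*} (r : Fin m → ℝ≥0∞) (ρ : ℝ≥0∞) (D : Finset (Cube d))
    (f : Fin m → (Fin d → ℝ) → Ω → ℂ) (g : (Fin d → ℝ) → Ω → ℂ)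
    (x : Fin d → ℝ) (ω : Ω) : ℝ≥0∞ :=
  ⨆ Q ∈ D, ⨆ (_ : x ∈ Cube.set Q), (∏ j, latAvg (r j) (f j) Q ω) * latAvg ρ g Q ω

def MemLinftyC {d : ℕ} (f : (Fin d → ℝ) → ℂ) : Prop :=
  Measurable f ∧ (∃ M : ℝ, ∀ x, ‖f x‖ ≤ M) ∧ Bornology.IsBounded (Function.support f)

def SimpleLinftyC {d : ℕ} (f : (Fin d → ℝ) → ℂ) : Prop :=
  Measurable f ∧ (Set.range f).Finite ∧ Bornology.IsBounded (Function.support f)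

def PairSimple {d : ℕ} {Ω : Type*} [MeasurableSpace Ω] (f : (Fin d → ℝ) → Ω → ℂ) : Prop :=
  Measurable (Function.uncurry f) ∧ (Set.range (Function.uncurry f)).Finite ∧
    ∃ B : Set (Fin d → ℝ), Bornology.IsBounded B ∧ ∀ x ∉ B, ∀ ω, f x ω = 0

def VecSimple {d : ℕ} {Ω : Type*} [MeasurableSpace Ω] (f : (Fin d → ℝ) → Ω → ℂ) : Prop :=
  ∃ (N : ℕ) (A : Fin N → Set (Fin d → ℝ)) (ξ : Fin N → Ω → ℂ),
    (∀ i, MeasurableSet (A i)) ∧ (∀ i, Bornology.IsBounded (A i)) ∧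
    (∀ i, Measurable (ξ i)) ∧ (∃ M : ℝ, ∀ i ω, ‖ξ i ω‖ ≤ M) ∧
    ∀ x ω, f x ω = ∑ i, (A i).indicator (fun _ => ξ i ω) x


/-- An abstract dyadic system: level `l` cells are the fibres of `c l`. -/
structure DSys {X : Type*} [MeasurableSpace X] (ν : Measure X) (ι : Type*) (K : ℝ≥0∞) where
  c : ℕ → X → ι
  meas : ∀ l n, MeasurableSet (c l ⁻¹' {n})
  nest : ∀ l x y, c l x = c l y → c (l+1) x = c (l+1) y
  pos : ∀ l x, ν (c l ⁻¹' {c l x}) ≠ 0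
  fin : ∀ l x, ν (c l ⁻¹' {c l x}) ≠ ∞
  doub : ∀ l x, ν (c (l+1) ⁻¹' {c (l+1) x}) ≤ K * ν (c l ⁻¹' {c l x})

set_option linter.unusedSectionVars false

namespace DSys
variable {X : Type*} [MeasurableSpace X] {ν : Measure X} {ι : Type*} {K : ℝ≥0∞}
  (S : DSys ν ι K)

def cell (l : ℕ) (x : X) : Set X := S.c l ⁻¹' {S.c l x}

def E (l : ℕ) (h : X → ℝ≥0∞) (x : X) : ℝ≥0∞ := (∫⁻ y in S.cell l x, h y ∂ν) / ν (S.cell l x)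

def Inv {β : Type*} (l : ℕ) (φ : X → β) : Prop := ∀ x y, S.c l x = S.c l y → φ x = φ y

def InvS (l : ℕ) (A : Set X) : Prop := ∀ x y, S.c l x = S.c l y → x ∈ A → y ∈ A

lemma mem_cell (l : ℕ) (x : X) : x ∈ S.cell l x := by simp [cell]

lemma mem_cell_iff (l : ℕ) (x y : X) : y ∈ S.cell l x ↔ S.c l y = S.c l x := by simp [cell]

lemma cell_congr {l : ℕ} {x y : X} (h : S.c l x = S.c l y) : S.cell l x = S.cell l y := by
  simp [cell, h]

lemma meas_cell (l : ℕ) (x : X) : MeasurableSet (S.cell l x) := S.meas _ _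

lemma cell_ne_zero (l : ℕ) (x : X) : ν (S.cell l x) ≠ 0 := S.pos l x
lemma cell_ne_top (l : ℕ) (x : X) : ν (S.cell l x) ≠ ∞ := S.fin l x

lemma nest_le {l k : ℕ} (hlk : l ≤ k) {x y : X} (h : S.c l x = S.c l y) : S.c k x = S.c k y := by
  induction k, hlk using Nat.le_induction with
  | base => exact h
  | succ k _ ih => exact S.nest k x y ih

lemma Inv.mono {β : Type*} {l k : ℕ} (hlk : l ≤ k) {φ : X → β} (h : S.Inv k φ) : S.Inv l φ :=
  fun x y hxy => h x y (S.nest_le hlk hxy)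

lemma InvS.mono {l k : ℕ} (hlk : l ≤ k) {A : Set X} (h : S.InvS k A) : S.InvS l A :=
  fun x y hxy => h x y (S.nest_le hlk hxy)

lemma InvS.inter {l : ℕ} {A B : Set X} (hA : S.InvS l A) (hB : S.InvS l B) : S.InvS l (A ∩ B) :=
  fun x y hxy h => ⟨hA x y hxy h.1, hB x y hxy h.2⟩

lemma invS_cell (l : ℕ) (x : X) : S.InvS l (S.cell l x) := by
  intro y z hyz hy
  rw [mem_cell_iff] at *
  rw [← hyz, hy]

lemma cell_subset {l : ℕ} {A : Set X} (hA : S.InvS l A) {x : X} (hx : x ∈ A) :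
    S.cell l x ⊆ A := by
  intro y hy
  rw [mem_cell_iff] at hy
  exact hA x y hy.symm hx

lemma inv_E (l : ℕ) (h : X → ℝ≥0∞) : S.Inv l (S.E l h) := by
  intro x y hxy
  simp only [E, S.cell_congr hxy]

lemma Inv.setOf {β : Type*} {l : ℕ} {φ : X → β} (h : S.Inv l φ) (P : β → Prop) :
    S.InvS l {x | P (φ x)} := by
  intro x y hxy hx
  simpa [← h x y hxy] using hx

variable [Countable ι]

lemma eq_iUnion {l : ℕ} {A : Set X} : A = ⋃ n : ι, (A ∩ S.c l ⁻¹' {n}) := by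
  ext x; simp

lemma measurable_c [MeasurableSpace ι] [DiscreteMeasurableSpace ι] (l : ℕ) :
    Measurable (S.c l) := measurable_to_countable' (fun n => S.meas l n)

lemma InvS.measurableSet {l : ℕ} {A : Set X} (h : S.InvS l A) : MeasurableSet A := by
  rw [S.eq_iUnion (l := l) (A := A)]
  refine MeasurableSet.iUnion fun n => ?_
  by_cases hn : ∃ x ∈ A, S.c l x = n
  · obtain ⟨x, hx, rfl⟩ := hn
    rw [show A ∩ S.c l ⁻¹' {S.c l x} = S.cell l x from
      Set.inter_eq_self_of_subset_right (S.cell_subset h hx)]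
    exact S.meas _ _
  · convert! MeasurableSet.empty
    ext x; simp; intro hx hxn; exact hn ⟨x, hx, hxn⟩

lemma Inv.measurable {β : Type*} [MeasurableSpace β] {l : ℕ} {φ : X → β} (h : S.Inv l φ) :
    Measurable φ := by
  intro s _
  exact InvS.measurableSet S (Inv.setOf S h (· ∈ s))

lemma cells_le {l : ℕ} {A : Set X} (h : S.InvS l A) {φ ψ : X → ℝ≥0∞}
    (hc : ∀ x ∈ A, ∫⁻ y in S.cell l x, φ y ∂ν ≤ ∫⁻ y in S.cell l x, ψ y ∂ν) :
    ∫⁻ y in A, φ y ∂ν ≤ ∫⁻ y in A, ψ y ∂ν := by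
  have hd : Pairwise (Function.onFun Disjoint fun n : ι => A ∩ S.c l ⁻¹' {n}) := by
    intro a b hab
    rw [Function.onFun, Set.disjoint_left]
    rintro x ⟨_, hx⟩ ⟨_, hx'⟩
    simp at hx hx'
    exact hab (hx.symm.trans hx')
  have hm : ∀ n : ι, MeasurableSet (A ∩ S.c l ⁻¹' {n}) := fun n =>
    (InvS.measurableSet S h).inter (S.meas _ _)
  rw [S.eq_iUnion (l := l) (A := A), lintegral_iUnion hm hd, lintegral_iUnion hm hd]
  refine ENNReal.tsum_le_tsum fun n => ?_
  by_cases hn : ∃ x ∈ A, S.c l x = n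
  · obtain ⟨x, hx, rfl⟩ := hn
    rw [show A ∩ S.c l ⁻¹' {S.c l x} = S.cell l x from
      Set.inter_eq_self_of_subset_right (S.cell_subset h hx)]
    exact hc x hx
  · have : A ∩ S.c l ⁻¹' {n} = ∅ := by
      ext x; simp; intro hx hxn; exact hn ⟨x, hx, hxn⟩
    simp [this]

lemma lintegral_cell_E (l : ℕ) (h : X → ℝ≥0∞) (x : X) :
    ∫⁻ y in S.cell l x, S.E l h y ∂ν = ∫⁻ y in S.cell l x, h y ∂ν := by
  have : ∫⁻ y in S.cell l x, S.E l h y ∂ν = ∫⁻ y in S.cell l x, S.E l h x ∂ν := by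
    refine setLIntegral_congr_fun (S.meas_cell l x) fun y hy => ?_
    exact S.inv_E l h y x ((S.mem_cell_iff _ _ _).1 hy)
  rw [this, setLIntegral_const, E, ENNReal.div_mul_cancel (S.cell_ne_zero l x) (S.cell_ne_top l x)]

lemma lintegral_E {l : ℕ} {A : Set X} (hA : S.InvS l A) (h : X → ℝ≥0∞) :
    ∫⁻ y in A, S.E l h y ∂ν = ∫⁻ y in A, h y ∂ν :=
  le_antisymm (S.cells_le hA fun x _ => (S.lintegral_cell_E l h x).le)
    (S.cells_le hA fun x _ => (S.lintegral_cell_E l h x).ge)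

/-- maximal function over levels `≤ N`. -/
def Mx (N : ℕ) (h : X → ℝ≥0∞) (x : X) : ℝ≥0∞ := (Finset.range (N+1)).sup fun l => S.E l h x

lemma measurable_Mx (N : ℕ) (h : X → ℝ≥0∞) : Measurable (S.Mx N h) := by
  have : S.Inv 0 (S.Mx N h) := fun x y hxy => by
    refine Finset.sup_congr rfl fun l _ => ?_
    exact S.inv_E l h x y (S.nest_le (Nat.zero_le l) hxy)
  exact Inv.measurable S this

lemma Mx_succ (N : ℕ) (h : X → ℝ≥0∞) (x : X) :
    S.Mx (N+1) h x = S.E (N+1) h x ⊔ S.Mx N h x := by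
  simp [Mx, Finset.range_add_one (n := N+1)]

lemma weak (h : X → ℝ≥0∞) (lam : ℝ≥0∞) (N : ℕ) : ∀ (A : Set X), S.InvS N A →
    lam * ν (A ∩ {x | lam < S.Mx N h x}) ≤ ∫⁻ y in A, h y ∂ν := by
  have key : ∀ (N : ℕ) (A : Set X), S.InvS N A → (∀ x ∈ A, lam < S.E N h x) →
      lam * ν A ≤ ∫⁻ y in A, h y ∂ν := by
    intro N A hA hl
    rw [← S.lintegral_E hA, ← setLIntegral_const]
    exact setLIntegral_mono (Inv.measurable S (S.inv_E N h)) fun x hx => (hl x hx).le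
  induction N with
  | zero =>
    intro A hA
    have h0 : S.InvS 0 (A ∩ {x | lam < S.Mx 0 h x}) :=
      InvS.inter S hA (by
        have := Inv.setOf S (S.inv_E 0 h) (lam < ·)
        simpa [Mx] using this)
    refine (key 0 _ h0 ?_).trans (lintegral_mono_set Set.inter_subset_left)
    rintro x ⟨_, hx⟩
    simpa [Mx] using hx
  | succ N ih =>
    intro A hA
    have h1 : S.InvS (N+1) (A ∩ {x | lam < S.E (N+1) h x}) :=
      InvS.inter S hA (Inv.setOf S (S.inv_E (N+1) h) (lam < ·))
    have h2 : S.InvS (N+1) (A ∩ {x | ¬ lam < S.E (N+1) h x}) :=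
      InvS.inter S hA (Inv.setOf S (S.inv_E (N+1) h) (¬ lam < ·))
    have k1 := key (N+1) _ h1 (fun x hx => hx.2)
    have k2 := ih _ (InvS.mono S (Nat.le_succ N) h2)
    have hsub : A ∩ {x | lam < S.Mx (N+1) h x} ⊆ (A ∩ {x | lam < S.E (N+1) h x}) ∪
        (A ∩ {x | ¬ lam < S.E (N+1) h x}) ∩ {x | lam < S.Mx N h x} := by
      rintro x ⟨hx, hx'⟩
      simp only [Set.mem_ofPred_eq, Mx_succ, lt_sup_iff] at hx'
      by_cases hc : lam < S.E (N+1) h x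
      · left; exact ⟨hx, hc⟩
      · right; exact ⟨⟨hx, hc⟩, hx'.resolve_left hc⟩
    calc lam * ν (A ∩ {x | lam < S.Mx (N+1) h x})
        ≤ lam * (ν (A ∩ {x | lam < S.E (N+1) h x}) +
          ν ((A ∩ {x | ¬ lam < S.E (N+1) h x}) ∩ {x | lam < S.Mx N h x})) := by
          gcongr; exact (measure_mono hsub).trans (measure_union_le _ _)
      _ ≤ (∫⁻ y in A ∩ {x | lam < S.E (N+1) h x}, h y ∂ν) +
          ∫⁻ y in A ∩ {x | ¬ lam < S.E (N+1) h x}, h y ∂ν := by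
          rw [mul_add]; gcongr
      _ = ∫⁻ y in A, h y ∂ν := by
          have hm : MeasurableSet {x | lam < S.E (N+1) h x} :=
            InvS.measurableSet S (Inv.setOf S (S.inv_E (N+1) h) (lam < ·))
          exact lintegral_inter_add_sdiff h A hm

end DSys

set_option linter.unusedSectionVars false

lemma lc_fin {s : ℝ} (hs : 0 < s) {a : ℝ} (ha : 0 ≤ a) :
    ∫⁻ u in Set.Ioi (0:ℝ), (if ENNReal.ofReal u < ENNReal.ofReal a then
      ENNReal.ofReal (s * u ^ (s-1)) else 0) = (ENNReal.ofReal a) ^ s := by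
  have h1 : ∫⁻ u in Set.Ioi (0:ℝ), (if ENNReal.ofReal u < ENNReal.ofReal a then
      ENNReal.ofReal (s * u ^ (s-1)) else 0) =
      ∫⁻ u in Set.Ioo (0:ℝ) a, ENNReal.ofReal (s * u ^ (s-1)) := by
    rw [← lintegral_indicator measurableSet_Ioi, ← lintegral_indicator measurableSet_Ioo]
    congr 1; ext u
    by_cases hu : 0 < u
    · by_cases hua : u < a
      · simp [Set.indicator, hu, hua, ENNReal.ofReal_lt_ofReal_iff (hu.trans hua)]
      · simp only [Set.indicator, Set.mem_Ioi, hu, if_true, Set.mem_Ioo, hua, and_false, if_false]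
        rw [if_neg]
        exact not_lt.2 (ENNReal.ofReal_le_ofReal (not_lt.1 hua))
    · simp [Set.indicator, hu]
  have hbnd : IntervalIntegrable (fun u : ℝ => s * u ^ (s-1)) volume 0 a :=
    (intervalIntegral.intervalIntegrable_rpow' (by linarith)).const_mul s
  rw [h1, setLIntegral_congr Ioo_ae_eq_Ioc, ← ofReal_integral_eq_lintegral_ofReal,
    ← intervalIntegral.integral_of_le ha, intervalIntegral.integral_const_mul,
    integral_rpow (Or.inl (by linarith)), ENNReal.ofReal_rpow_of_nonneg ha hs.le]
  · congr 1
    rw [sub_add_cancel, Real.zero_rpow hs.ne']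
    field_simp; simp
  · exact (intervalIntegrable_iff_integrableOn_Ioc_of_le ha).1 hbnd
  · refine (ae_restrict_iff' measurableSet_Ioc).2 (Filter.Eventually.of_forall fun u hu => ?_)
    have := hu.1
    positivity

lemma lc_le {s : ℝ} (hs : 0 < s) (x : ℝ≥0∞) :
    x ^ s ≤ ∫⁻ u in Set.Ioi (0:ℝ), (if ENNReal.ofReal u < x then
      ENNReal.ofReal (s * u ^ (s-1)) else 0) := by
  by_cases hx : x = ∞
  · subst hx
    have hn : ∀ n : ℕ, (n : ℝ≥0∞) ^ s ≤ ∫⁻ u in Set.Ioi (0:ℝ), (if ENNReal.ofReal u < ∞ then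
      ENNReal.ofReal (s * u ^ (s-1)) else 0) := by
      intro n
      have := lc_fin hs (a := n) n.cast_nonneg
      rw [ENNReal.ofReal_natCast] at this
      rw [← this]
      refine lintegral_mono fun u => ?_
      dsimp only
      split_ifs with h1 h2 h2
      · rfl
      · exact absurd ENNReal.ofReal_lt_top h2
      · simp
      · simp
    have ht : Filter.Tendsto (fun n : ℕ => (n : ℝ≥0∞) ^ s) Filter.atTop (nhds (∞ ^ s)) :=
      ENNReal.continuous_rpow_const.continuousAt.tendsto.comp ENNReal.tendsto_nat_nhds_top
    exact le_of_tendsto' ht hn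
  · have := lc_fin hs (a := x.toReal) ENNReal.toReal_nonneg
    rw [ENNReal.ofReal_toReal hx] at this
    exact this.ge

lemma lc_ge {s : ℝ} (hs : 0 < s) (x : ℝ≥0∞) :
    ∫⁻ u in Set.Ioi (0:ℝ), (if ENNReal.ofReal u < x then
      ENNReal.ofReal (s * u ^ (s-1)) else 0) ≤ x ^ s := by
  by_cases hx : x = ∞
  · subst hx; simp [hs]
  · have := lc_fin hs (a := x.toReal) ENNReal.toReal_nonneg
    rw [ENNReal.ofReal_toReal hx] at this
    exact this.le

namespace DSys
variable {X : Type*} [MeasurableSpace X] {ν : Measure X} {ι : Type*} {K : ℝ≥0∞}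
  (S : DSys ν ι K) [Countable ι]

lemma E_mono (l : ℕ) {h h' : X → ℝ≥0∞} (hh : ∀ x, h x ≤ h' x) (x : X) :
    S.E l h x ≤ S.E l h' x := by
  unfold E; gcongr; exact hh _

lemma E_add_const (l : ℕ) (h : X → ℝ≥0∞) (a : ℝ≥0∞) (x : X) :
    S.E l (fun y => a + h y) x = a + S.E l h x := by
  unfold E
  rw [lintegral_add_left measurable_const, setLIntegral_const, ENNReal.add_div,
    ENNReal.mul_div_cancel_right (S.cell_ne_zero l x) (S.cell_ne_top l x)]

lemma weak2 (h : X → ℝ≥0∞) (lam : ℝ≥0∞) (N : ℕ) (A : Set X) (hA : S.InvS N A) :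
    lam * ν (A ∩ {x | 2 * lam < S.Mx N h x}) ≤
      ∫⁻ y in A, (if lam < h y then h y else 0) ∂ν := by
  refine le_trans ?_ (S.weak (fun y => if lam < h y then h y else 0) lam N A hA)
  refine mul_le_mul_right (measure_mono (Set.inter_subset_inter_right _ ?_)) _
  intro x hx
  simp only [Set.mem_ofPred_eq, Mx, Finset.lt_sup_iff] at hx ⊢
  obtain ⟨l, hl, hx⟩ := hx
  refine ⟨l, hl, ?_⟩
  have h1 : S.E l h x ≤ lam + S.E l (fun y => if lam < h y then h y else 0) x := by
    rw [← E_add_const]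
    refine S.E_mono l (fun y => ?_) x
    split_ifs with hc
    · exact le_add_self
    · simpa using hc
  by_contra hcon
  have := hx.trans_le (h1.trans (add_le_add_right (not_lt.1 hcon) lam))
  rw [two_mul] at this
  exact lt_irrefl _ this

/-- Doob maximal inequality. -/
lemma doob [SFinite ν] {s : ℝ} (hs : 1 < s) (h : X → ℝ≥0∞) (hh : Measurable h) (N : ℕ)
    (A : Set X) (hA : S.InvS N A) :
    ∫⁻ x in A, S.Mx N h x ^ s ∂ν ≤
      ENNReal.ofReal (2 * s / (s-1)) * 2 ^ (s-1) * ∫⁻ x in A, h x ^ s ∂ν := by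
  have hAm : MeasurableSet A := InvS.measurableSet S hA
  have hs1 : 0 < s - 1 := by linarith
  have hMm := S.measurable_Mx N h
  calc ∫⁻ x in A, S.Mx N h x ^ s ∂ν
      ≤ ∫⁻ x in A, (∫⁻ u in Set.Ioi (0:ℝ), (if ENNReal.ofReal u < S.Mx N h x then
      ENNReal.ofReal (s * u ^ (s-1)) else 0)) ∂ν := lintegral_mono fun x => lc_le (by linarith) _
    _ = ∫⁻ u in Set.Ioi (0:ℝ), (∫⁻ x in A, (if ENNReal.ofReal u < S.Mx N h x then
      ENNReal.ofReal (s * u ^ (s-1)) else 0) ∂ν) := by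
        refine lintegral_lintegral_swap (Measurable.aemeasurable ?_)
        refine Measurable.ite ?_ (by fun_prop) measurable_const
        exact measurableSet_lt (by fun_prop) (by fun_prop)
    _ ≤ ∫⁻ u in Set.Ioi (0:ℝ), (∫⁻ x in A, h x * (if ENNReal.ofReal u < 2 * h x then
      2 * ENNReal.ofReal (s * u ^ (s-1-1)) else 0) ∂ν) := by
        refine setLIntegral_mono' measurableSet_Ioi fun u hu => ?_
        have hu : 0 < u := hu
        have e1 : ∫⁻ x in A, (if ENNReal.ofReal u < S.Mx N h x then
            ENNReal.ofReal (s * u ^ (s-1)) else 0) ∂ν =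
            ENNReal.ofReal (s * u ^ (s-1)) * ν (A ∩ {x | ENNReal.ofReal u < S.Mx N h x}) := by
          have hms : MeasurableSet {x | ENNReal.ofReal u < S.Mx N h x} :=
            measurableSet_lt measurable_const hMm
          have : ∀ x, (if ENNReal.ofReal u < S.Mx N h x then
            ENNReal.ofReal (s * u ^ (s-1)) else 0) = Set.indicator
              {x | ENNReal.ofReal u < S.Mx N h x} (fun _ => ENNReal.ofReal (s * u ^ (s-1))) x := by
            intro x; simp [Set.indicator]
          simp_rw [this]
          rw [lintegral_indicator hms, setLIntegral_const, Measure.restrict_apply hms,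
            Set.inter_comm]
        have e2 := S.weak2 h (ENNReal.ofReal (u/2)) N A hA
        have e3 : 2 * ENNReal.ofReal (u/2) = ENNReal.ofReal u := by
          rw [show (2:ℝ≥0∞) = ENNReal.ofReal 2 by simp, ← ENNReal.ofReal_mul (by norm_num)]
          congr 1; ring
        rw [e3] at e2
        have e4 : ENNReal.ofReal (s * u ^ (s-1)) =
            2 * ENNReal.ofReal (s * u ^ (s-1-1)) * ENNReal.ofReal (u/2) := by
          rw [mul_right_comm, e3, ← ENNReal.ofReal_mul hu.le]
          congr 1
          rw [Real.rpow_sub_one hu.ne' (s-1)]; field_simp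
        rw [e1, e4, mul_assoc]
        refine (mul_le_mul_right e2 _).trans ?_
        rw [← lintegral_const_mul']
        · refine lintegral_mono fun x => ?_
          have : ENNReal.ofReal (u/2) < h x ↔ ENNReal.ofReal u < 2 * h x := by
            rw [← e3, ENNReal.mul_lt_mul_iff_right (by simp) (by simp)]
          simp only [this]
          split_ifs
          · rw [mul_comm]
          · simp
        · exact ENNReal.mul_ne_top (by simp) (by simp)
    _ = ∫⁻ x in A, (∫⁻ u in Set.Ioi (0:ℝ), h x * (if ENNReal.ofReal u < 2 * h x then
      2 * ENNReal.ofReal (s * u ^ (s-1-1)) else 0)) ∂ν := by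
        refine lintegral_lintegral_swap (Measurable.aemeasurable ?_)
        refine Measurable.mul (by fun_prop) (Measurable.ite ?_ (by fun_prop) measurable_const)
        exact measurableSet_lt (by fun_prop) (by fun_prop)
    _ ≤ ∫⁻ x in A, ENNReal.ofReal (2 * s / (s-1)) * 2 ^ (s-1) * h x ^ s ∂ν := by
        refine lintegral_mono fun x => ?_
        dsimp only
        rw [lintegral_const_mul]
        · have e : ∀ u : ℝ, (if ENNReal.ofReal u < 2 * h x then
              2 * ENNReal.ofReal (s * u ^ (s-1-1)) else 0) = ENNReal.ofReal (2 * s / (s-1)) *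
              (if ENNReal.ofReal u < 2 * h x then ENNReal.ofReal ((s-1) * u ^ (s-1-1)) else 0) := by
            intro u
            split_ifs
            · rw [← ENNReal.ofReal_mul (by positivity), show (2:ℝ≥0∞) = ENNReal.ofReal 2 by simp,
                ← ENNReal.ofReal_mul (by norm_num)]
              congr 1; field_simp
            · simp
          simp_rw [e]
          rw [lintegral_const_mul']
          · calc h x * (ENNReal.ofReal (2 * s / (s-1)) * ∫⁻ u in Set.Ioi (0:ℝ),
                (if ENNReal.ofReal u < 2 * h x then ENNReal.ofReal ((s-1) * u ^ (s-1-1)) else 0))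
                ≤ h x * (ENNReal.ofReal (2 * s / (s-1)) * (2 * h x) ^ (s-1)) := by
                  gcongr; exact lc_ge hs1 _
              _ = _ := by
                  rw [ENNReal.mul_rpow_of_nonneg _ _ hs1.le]
                  have : h x ^ s = h x * h x ^ (s-1) := by
                    conv_rhs => rw [← ENNReal.rpow_one (h x), ← ENNReal.rpow_mul, one_mul]
                    rw [← ENNReal.rpow_add_of_nonneg _ _ zero_le_one hs1.le]; congr 1; ring
                  rw [this]; ring
          · simp
        · refine Measurable.ite ?_ (by fun_prop) measurable_const
          exact measurableSet_lt (by fun_prop) (by fun_prop)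
    _ = _ := by
        rw [lintegral_const_mul]; fun_prop

end DSys

set_option linter.unusedSectionVars false

section
variable {α : Type*} [MeasurableSpace α] {μ : Measure α}

lemma eNorm_top (F : α → ℝ≥0∞) : eNorm ∞ μ F = essSup F μ := by simp [eNorm]

lemma eNorm_fin {p : ℝ≥0∞} (hp : p ≠ ∞) (F : α → ℝ≥0∞) :
    eNorm p μ F = (∫⁻ x, F x ^ p.toReal ∂μ) ^ (1 / p.toReal) := by simp [eNorm, hp]

lemma eNorm_mono_ae (p : ℝ≥0∞) {F G : α → ℝ≥0∞} (h : ∀ᵐ x ∂μ, F x ≤ G x) :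
    eNorm p μ F ≤ eNorm p μ G := by
  unfold eNorm
  split_ifs
  · exact essSup_mono_ae h
  · refine ENNReal.rpow_le_rpow (lintegral_mono_ae ?_) (by positivity)
    filter_upwards [h] with x hx
    exact ENNReal.rpow_le_rpow hx (by positivity)

lemma eNorm_mono (p : ℝ≥0∞) {F G : α → ℝ≥0∞} (h : ∀ x, F x ≤ G x) :
    eNorm p μ F ≤ eNorm p μ G := eNorm_mono_ae p (Filter.Eventually.of_forall h)

lemma eNorm_pow {p : ℝ≥0∞} (hp0 : p ≠ 0) (hp : p ≠ ∞) (F : α → ℝ≥0∞) :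
    eNorm p μ F ^ p.toReal = ∫⁻ x, F x ^ p.toReal ∂μ := by
  rw [eNorm_fin hp, ← ENNReal.rpow_mul, one_div, inv_mul_cancel₀, ENNReal.rpow_one]
  exact (ENNReal.toReal_pos hp0 hp).ne'

lemma essSup_rpow {ρ : ℝ} (hρ : 0 < ρ) (F : α → ℝ≥0∞) :
    essSup (fun x => F x ^ ρ) μ = essSup F μ ^ ρ := by
  have := OrderIso.essSup_apply (μ := μ) F (ENNReal.orderIsoRpow ρ hρ)
  simpa using this.symm

lemma eNorm_rpow {p : ℝ≥0∞} (hp : p ≠ 0) {ρ : ℝ} (hρ : 0 < ρ) (F : α → ℝ≥0∞) :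
    eNorm p μ (fun x => F x ^ ρ) = eNorm (p * ENNReal.ofReal ρ) μ F ^ ρ := by
  by_cases hpt : p = ∞
  · subst hpt
    rw [ENNReal.top_mul (by simpa using hρ), eNorm_top, eNorm_top, essSup_rpow hρ]
  · rw [eNorm_fin hpt, eNorm_fin (ENNReal.mul_ne_top hpt (by simp)), ← ENNReal.rpow_mul,
      ENNReal.toReal_mul, ENNReal.toReal_ofReal hρ.le]
    simp_rw [← ENNReal.rpow_mul]
    congr 1
    · simp_rw [mul_comm]
    · field_simp

lemma measurable_essSup {X : Type*} [MeasurableSpace X] [SFinite μ] {f : X → α → ℝ≥0∞}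
    (hf : Measurable (Function.uncurry f)) : Measurable (fun x => essSup (f x) μ) := by
  refine measurable_of_Ioi fun a => ?_
  have : (fun x => essSup (f x) μ) ⁻¹' Set.Ioi a = {x | 0 < μ {ω | a < f x ω}} := by
    ext x
    simp only [Set.mem_preimage, Set.mem_Ioi, Set.mem_ofPred_eq]
    rw [← not_iff_not, not_lt, not_lt, nonpos_iff_eq_zero]
    constructor
    · intro h
      have := ENNReal.ae_le_essSup (μ := μ) (f x)
      refine measure_mono_null (fun ω hω => ?_) (ae_iff.1 this)
      have hω : a < f x ω := hω
      simpa using h.trans_lt hω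
    · intro h
      refine essSup_le_of_ae_le a ?_
      refine ae_iff.2 ?_
      simpa using h
  rw [this]
  refine measurableSet_lt measurable_const ?_
  have hs : MeasurableSet {p : X × α | a < Function.uncurry f p} :=
    measurableSet_lt measurable_const hf
  exact measurable_measure_prodMk_left hs

lemma measurable_eNorm {X : Type*} [MeasurableSpace X] [SFinite μ] (p : ℝ≥0∞) {f : X → α → ℝ≥0∞}
    (hf : Measurable (Function.uncurry f)) : Measurable (fun x => eNorm p μ (f x)) := by
  unfold eNorm
  split_ifs
  · exact measurable_essSup hf
  · refine Measurable.pow_const ?_ _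
    refine Measurable.lintegral_prod_right' (f := fun z : X × α => f z.1 z.2 ^ p.toReal) ?_
    exact hf.pow_const _

lemma minkowski_fin {X : Type*} [MeasurableSpace X] [SFinite μ] {ρ : Measure X} [IsFiniteMeasure ρ]
    {s : ℝ} (hs : 1 < s) {f : X → α → ℝ≥0∞} (hf : Measurable (Function.uncurry f)) :
    (∫⁻ ω, (∫⁻ x, f x ω ∂ρ) ^ s ∂μ) ^ (1/s) ≤ ∫⁻ x, (∫⁻ ω, f x ω ^ s ∂μ) ^ (1/s) ∂ρ := by
  have hs0 : 0 < s := by linarith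
  set F : X → ℝ≥0∞ := fun x => (∫⁻ ω, f x ω ^ s ∂μ) ^ (1/s) with hF
  have hFm : Measurable F := by
    refine Measurable.pow_const ?_ _
    refine Measurable.lintegral_prod_right' (f := fun z : X × α => f z.1 z.2 ^ s) ?_
    exact hf.pow_const _
  have hFs : ∀ x, ∫⁻ ω, f x ω ^ s ∂μ = F x ^ s := by
    intro x
    rw [hF]; dsimp only
    rw [← ENNReal.rpow_mul, one_div, inv_mul_cancel₀ hs0.ne', ENNReal.rpow_one]
  have key : ∀ e : ℝ≥0∞, e ≠ 0 → e ≠ ∞ → ∫⁻ x, F x ∂ρ < ∞ →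
      (∫⁻ ω, (∫⁻ x, f x ω ∂ρ) ^ s ∂μ) ^ (1/s) ≤ ∫⁻ x, F x ∂ρ + e * ρ Set.univ := by
    intro e he0 het hfin
    set w : X → ℝ≥0∞ := fun x => F x + e with hw
    have hwm : Measurable w := hFm.add_const e
    have hw0 : ∀ x, w x ≠ 0 := fun x => by simp [hw, he0]
    have hI : ∫⁻ x, w x ∂ρ = ∫⁻ x, F x ∂ρ + e * ρ Set.univ := by
      rw [hw, lintegral_add_left hFm, lintegral_const]
    have hIt : ∫⁻ x, w x ∂ρ < ∞ := by
      rw [hI]; exact ENNReal.add_lt_top.2 ⟨hfin, ENNReal.mul_lt_top het.lt_top (measure_lt_top _ _)⟩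
    have hwt : ∀ᵐ x ∂ρ, w x < ∞ := ae_lt_top hwm hIt.ne
    have hconj : s.HolderConjugate (s / (s-1)) := Real.HolderConjugate.conjExponent hs
    rw [← hI]
    have hpt : ∀ ω, (∫⁻ x, f x ω ∂ρ) ^ s ≤
        (∫⁻ x, f x ω ^ s * w x ^ (1 - s) ∂ρ) * (∫⁻ x, w x ∂ρ) ^ (s-1) := by
      intro ω
      have h1 : ∫⁻ x, f x ω ∂ρ = ∫⁻ x, ((fun x => f x ω * w x ^ (-((s-1)/s))) *
          (fun x => w x ^ ((s-1)/s))) x ∂ρ := by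
        refine lintegral_congr_ae ?_
        filter_upwards [hwt] with x hx
        simp only [Pi.mul_apply]
        rw [mul_assoc, ← ENNReal.rpow_add _ _ (hw0 x) hx.ne]
        simp
      have hfm : Measurable (fun x => f x ω) := hf.comp (measurable_id.prodMk measurable_const)
      have h2 := ENNReal.lintegral_mul_le_Lp_mul_Lq ρ hconj
        (f := fun x => f x ω * w x ^ (-((s-1)/s))) (g := fun x => w x ^ ((s-1)/s))
        (by fun_prop) (by fun_prop)
      rw [← h1] at h2
      refine (ENNReal.rpow_le_rpow h2 hs0.le).trans_eq ?_
      have hs1 : 0 < s - 1 := by linarith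
      rw [ENNReal.mul_rpow_of_nonneg _ _ hs0.le, ← ENNReal.rpow_mul, ← ENNReal.rpow_mul]
      congr 1
      · rw [one_div, inv_mul_cancel₀ hs0.ne', ENNReal.rpow_one]
        refine lintegral_congr fun x => ?_
        rw [ENNReal.mul_rpow_of_nonneg _ _ hs0.le, ← ENNReal.rpow_mul]
        congr 2; field_simp; ring
      · congr 1
        · refine lintegral_congr fun x => ?_
          rw [← ENNReal.rpow_mul]
          rw [show (s-1)/s * (s/(s-1)) = 1 by field_simp, ENNReal.rpow_one]
        · field_simp
    have hmain : ∫⁻ ω, (∫⁻ x, f x ω ∂ρ) ^ s ∂μ ≤ (∫⁻ x, w x ∂ρ) ^ s := by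
      calc ∫⁻ ω, (∫⁻ x, f x ω ∂ρ) ^ s ∂μ
          ≤ ∫⁻ ω, (∫⁻ x, f x ω ^ s * w x ^ (1 - s) ∂ρ) * (∫⁻ x, w x ∂ρ) ^ (s-1) ∂μ :=
            lintegral_mono hpt
        _ = (∫⁻ ω, (∫⁻ x, f x ω ^ s * w x ^ (1 - s) ∂ρ) ∂μ) * (∫⁻ x, w x ∂ρ) ^ (s-1) := by
            rw [lintegral_mul_const']
            exact ENNReal.rpow_ne_top_of_nonneg (by linarith) hIt.ne
        _ = (∫⁻ x, (∫⁻ ω, f x ω ^ s * w x ^ (1 - s) ∂μ) ∂ρ) * (∫⁻ x, w x ∂ρ) ^ (s-1) := by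
            rw [lintegral_lintegral_swap]
            refine Measurable.aemeasurable ?_
            have hf' : Measurable (fun z : α × X => f z.2 z.1) := hf.comp measurable_swap
            have : Measurable (fun z : α × X => f z.2 z.1 ^ s * w z.2 ^ (1-s)) := by fun_prop
            exact this
        _ ≤ (∫⁻ x, w x ∂ρ) * (∫⁻ x, w x ∂ρ) ^ (s-1) := by
            gcongr with x
            have hfx : Measurable (fun ω => f x ω) := hf.comp (measurable_const.prodMk measurable_id)
            rw [lintegral_mul_const _ (by fun_prop), hFs]
            by_cases hx : w x = ∞
            · rw [hx, ENNReal.top_rpow_of_neg (by linarith)]; simp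
            · calc F x ^ s * w x ^ (1-s) ≤ w x ^ s * w x ^ (1-s) := by
                    gcongr; exact le_self_add
                _ = w x := by
                    rw [← ENNReal.rpow_add _ _ (hw0 x) hx]; simp
        _ = (∫⁻ x, w x ∂ρ) ^ s := by
            conv_lhs => enter [1]; rw [← ENNReal.rpow_one (∫⁻ x, w x ∂ρ)]
            rw [← ENNReal.rpow_add_of_nonneg _ _ zero_le_one (by linarith)]; congr 1; ring
    calc (∫⁻ ω, (∫⁻ x, f x ω ∂ρ) ^ s ∂μ) ^ (1/s) ≤ ((∫⁻ x, w x ∂ρ) ^ s) ^ (1/s) := by gcongr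
      _ = _ := by rw [← ENNReal.rpow_mul, mul_one_div_cancel hs0.ne', ENNReal.rpow_one]
  refine ENNReal.le_of_forall_pos_le_add fun ε hε hfin => ?_
  have hR : 1 + ρ Set.univ ≠ ∞ := by simp
  have hR0 : 1 + ρ Set.univ ≠ 0 := by simp
  refine (key (ε / (1 + ρ Set.univ)) ?_ ?_ hfin).trans ?_
  · exact (ENNReal.div_pos (by exact_mod_cast hε.ne') hR).ne'
  · exact ENNReal.div_ne_top (by simp) hR0
  · gcongr
    calc (ε:ℝ≥0∞) / (1 + ρ Set.univ) * ρ Set.univ ≤ ε / (1 + ρ Set.univ) * (1 + ρ Set.univ) := by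
          gcongr; exact le_add_self
      _ = ε := ENNReal.div_mul_cancel hR0 hR

lemma minkowski {X : Type*} [MeasurableSpace X] [SFinite μ] {ρ : Measure X} [IsFiniteMeasure ρ]
    {s : ℝ≥0∞} (hs : 1 < s) {f : X → α → ℝ≥0∞} (hf : Measurable (Function.uncurry f)) :
    eNorm s μ (fun ω => ∫⁻ x, f x ω ∂ρ) ≤ ∫⁻ x, eNorm s μ (f x) ∂ρ := by
  by_cases hst : s = ∞
  · subst hst
    simp_rw [eNorm_top]
    refine essSup_le_of_ae_le _ ?_
    have h1 : ∀ᵐ x ∂ρ, ∀ᵐ ω ∂μ, f x ω ≤ essSup (f x) μ :=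
      Filter.Eventually.of_forall fun x => ENNReal.ae_le_essSup _
    have hm : Measurable (fun x => essSup (f x) μ) := measurable_essSup hf
    have hms : MeasurableSet {z : X × α | f z.1 z.2 ≤ essSup (f z.1) μ} :=
      measurableSet_le hf (hm.comp measurable_fst)
    have h2 := (Measure.ae_ae_comm (p := fun x ω => f x ω ≤ essSup (f x) μ) hms).1 h1
    filter_upwards [h2] with ω hω
    exact lintegral_mono_ae hω
  · have e : ∀ F : α → ℝ≥0∞, eNorm s μ F = _ := fun F => eNorm_fin hst F
    simp only [e]
    refine minkowski_fin ?_ hf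
    rw [← ENNReal.toReal_one]
    exact (ENNReal.toReal_lt_toReal (by simp) hst).2 hs

lemma holder {m : ℕ} {t : Fin m → ℝ≥0∞} (ht : ∀ j, t j ≠ 0) (htf : (∑ j, (t j)⁻¹)⁻¹ ≠ ∞)
    {h : Fin m → α → ℝ≥0∞} (hh : ∀ j, Measurable (h j)) :
    eNorm (∑ j, (t j)⁻¹)⁻¹ μ (fun ω => ∏ j, h j ω) ≤ ∏ j, eNorm (t j) μ (h j) := by
  set τ := (∑ j, (t j)⁻¹)⁻¹ with hτ
  have hτ0 : τ ≠ 0 := by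
    rw [hτ]; simp [ENNReal.sum_eq_top, ht]
  have hp : 0 < τ.toReal := ENNReal.toReal_pos hτ0 htf
  classical
  set J := Finset.univ.filter (fun j => t j ≠ ∞) with hJ
  have hsum : ∑ j ∈ J, τ.toReal / (t j).toReal = 1 := by
    have h1 : τ⁻¹ = ∑ j ∈ J, (t j)⁻¹ := by
      rw [hτ, inv_inv, hJ, Finset.sum_filter]
      refine Finset.sum_congr rfl fun j _ => ?_
      by_cases hj : t j = ∞ <;> simp [hj]
    have h2 : τ.toReal⁻¹ = ∑ j ∈ J, (t j).toReal⁻¹ := by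
      rw [← ENNReal.toReal_inv, h1, ENNReal.toReal_sum (fun j _ => by simp [ht])]
      simp
    simp_rw [div_eq_mul_inv]
    rw [← Finset.mul_sum, ← h2, mul_inv_cancel₀ hp.ne']
  have hsplit : ∀ φ : Fin m → ℝ≥0∞, ∏ j, φ j = (∏ j ∈ J, φ j) * ∏ j ∈ Finset.univ.filter (fun j => ¬ t j ≠ ∞), φ j :=
    fun φ => (Finset.prod_filter_mul_prod_filter_not _ _ _).symm
  set T := ∏ j ∈ Finset.univ.filter (fun j => ¬ t j ≠ ∞), eNorm (t j) μ (h j) with hT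
  have hae : ∀ᵐ ω ∂μ, ∏ j, h j ω ≤ (∏ j ∈ J, h j ω) * T := by
    have : ∀ᵐ ω ∂μ, ∀ j, h j ω ≤ essSup (h j) μ := ae_all_iff.2 fun j => ENNReal.ae_le_essSup _
    filter_upwards [this] with ω hω
    rw [hsplit]
    refine mul_le_mul_right (Finset.prod_le_prod' fun j hj => ?_) _
    simp only [Finset.mem_filter, not_not] at hj
    rw [hj.2, eNorm_top]; exact hω j
  refine (eNorm_mono_ae _ hae).trans ?_
  rw [hsplit, eNorm_fin htf]
  simp_rw [ENNReal.mul_rpow_of_nonneg _ _ hp.le]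
  rw [lintegral_mul_const _ (by fun_prop), ENNReal.mul_rpow_of_nonneg _ _ (by positivity),
    ← ENNReal.rpow_mul, mul_one_div_cancel hp.ne', ENNReal.rpow_one]
  refine mul_le_mul_left ?_ _
  have h3 := ENNReal.lintegral_prod_norm_pow_le (μ := μ) J (f := fun j ω => h j ω ^ (t j).toReal)
    (fun j _ => by fun_prop) hsum (fun j _ => by positivity)
  have htj : ∀ j ∈ J, 0 < (t j).toReal := fun j hj => by
    simp only [hJ, Finset.mem_filter] at hj
    exact ENNReal.toReal_pos (ht j) hj.2
  calc (∫⁻ ω, (∏ j ∈ J, h j ω) ^ τ.toReal ∂μ) ^ (1/τ.toReal)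
      ≤ (∏ j ∈ J, (∫⁻ ω, h j ω ^ (t j).toReal ∂μ) ^ (τ.toReal / (t j).toReal)) ^ (1/τ.toReal) := by
        refine ENNReal.rpow_le_rpow (le_trans (le_of_eq ?_) h3) (by positivity)
        refine lintegral_congr fun ω => ?_
        rw [← ENNReal.prod_rpow_of_nonneg hp.le]
        refine Finset.prod_congr rfl fun j hj => ?_
        rw [← ENNReal.rpow_mul, mul_div_cancel₀ _ (htj j hj).ne']
    _ = ∏ j ∈ J, eNorm (t j) μ (h j) := by
        rw [← ENNReal.prod_rpow_of_nonneg (by positivity)]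
        refine Finset.prod_congr rfl fun j hj => ?_
        rw [eNorm_fin (by simpa [hJ] using hj), ← ENNReal.rpow_mul]
        congr 1
        have := htj j hj
        field_simp

lemma eNorm_sup_le {p : ℝ≥0∞} (hp0 : p ≠ 0) (hp : p ≠ ∞) {q : ℝ} (hq : 0 ≤ q) (hqp : q ≤ p.toReal)
    {a b c : α → ℝ≥0∞} (ha : Measurable a) (h : ∀ x, c x ≤ a x ⊔ b x) :
    eNorm p μ c ^ q ≤ eNorm p μ a ^ q + eNorm p μ b ^ q := by
  have hpp : 0 < p.toReal := ENNReal.toReal_pos hp0 hp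
  have h1 : eNorm p μ c ^ p.toReal ≤ eNorm p μ a ^ p.toReal + eNorm p μ b ^ p.toReal := by
    rw [eNorm_pow hp0 hp, eNorm_pow hp0 hp, eNorm_pow hp0 hp, ← lintegral_add_left (by fun_prop)]
    refine lintegral_mono fun x => ?_
    refine (ENNReal.rpow_le_rpow (h x) hpp.le).trans ?_
    rcases le_total (a x) (b x) with hab | hab
    · rw [sup_eq_right.2 hab]; exact le_add_self
    · rw [sup_eq_left.2 hab]; exact le_self_add
  have e : ∀ z : ℝ≥0∞, z ^ q = (z ^ p.toReal) ^ (q / p.toReal) := fun z => by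
    rw [← ENNReal.rpow_mul, mul_div_cancel₀ _ hpp.ne']
  rw [e (eNorm p μ c), e (eNorm p μ a), e (eNorm p μ b)]
  refine (ENNReal.rpow_le_rpow h1 (by positivity)).trans ?_
  exact ENNReal.rpow_add_le_add_rpow _ _ (by positivity) ((div_le_one hpp).2 hqp)

end

set_option linter.unusedSectionVars false

section
variable {α : Type*} [MeasurableSpace α] {μ : Measure α}
lemma eNorm_zero {p : ℝ≥0∞} (hp : p ≠ 0) : eNorm p μ (fun _ => 0) = 0 := by
  by_cases hpt : p = ∞
  · subst hpt; rw [eNorm_top]; exact essSup_const_bot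
  · have := ENNReal.toReal_pos hp hpt
    rw [eNorm_fin hpt]; simp [this]

lemma eNorm_zero_ae {p : ℝ≥0∞} (hp : p ≠ 0) {h : α → ℝ≥0∞} (hm : Measurable h)
    (h0 : eNorm p μ h = 0) : ∀ᵐ x ∂μ, h x = 0 := by
  by_cases hpt : p = ∞
  · subst hpt; rw [eNorm_top] at h0
    filter_upwards [ENNReal.ae_le_essSup (μ := μ) h] with x hx
    simpa [h0] using hx
  · have hpp := ENNReal.toReal_pos hp hpt
    have := eNorm_pow (μ := μ) hp hpt h
    rw [h0, ENNReal.zero_rpow_of_pos hpp, eq_comm, lintegral_eq_zero_iff (by fun_prop)] at this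
    filter_upwards [this] with x hx
    simpa [hpp, hpp.le, hpp.not_gt] using hx
end

def Good (s K B A : ℝ≥0∞) : Prop :=
  (s = ∞ → B ≤ A) ∧ (s ≠ ∞ →
    ENNReal.ofReal (2 * s.toReal / (s.toReal-1)) * 2 ^ (s.toReal-1) * (K * B) ^ (s.toReal - 1) * B
      ≤ A ^ s.toReal)

lemma exists_good {s K B : ℝ≥0∞} (hs : 1 < s) (hK : K ≠ ∞) (hB : B ≠ ∞) :
    ∃ A : ℝ≥0∞, A ≠ 0 ∧ A ≠ ∞ ∧ Good s K B A := by
  by_cases hst : s = ∞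
  · exact ⟨B + 1, by simp, by simp [hB], fun _ => le_self_add, fun h => absurd hst h⟩
  · have hs1 : 1 < s.toReal := by
      rw [← ENNReal.toReal_one]; exact (ENNReal.toReal_lt_toReal (by simp) hst).2 hs
    set Z := ENNReal.ofReal (2 * s.toReal / (s.toReal-1)) * 2 ^ (s.toReal-1) *
      (K * B) ^ (s.toReal - 1) * B with hZ
    have hZt : Z ≠ ∞ := by
      refine ENNReal.mul_ne_top (ENNReal.mul_ne_top (ENNReal.mul_ne_top (by simp) ?_) ?_) hB
      · exact ENNReal.rpow_ne_top_of_nonneg (by linarith) (by simp)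
      · exact ENNReal.rpow_ne_top_of_nonneg (by linarith) (ENNReal.mul_ne_top hK hB)
    refine ⟨Z ^ (1/s.toReal) + 1, by simp, ?_, fun h => absurd h hst, fun _ => ?_⟩
    · simp only [ne_eq, ENNReal.add_eq_top, ENNReal.one_ne_top, or_false]
      exact ENNReal.rpow_ne_top_of_nonneg (by positivity) hZt
    · calc Z = (Z ^ (1/s.toReal)) ^ s.toReal := by
            rw [← ENNReal.rpow_mul, one_div, inv_mul_cancel₀ (by linarith), ENNReal.rpow_one]
        _ ≤ _ := by gcongr; exact le_self_add

namespace DSys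
variable {X : Type*} [MeasurableSpace X] {ν : Measure X} {ι : Type*} {K : ℝ≥0∞}
  (S : DSys ν ι K) [Countable ι]

lemma E_eq (l : ℕ) (h : X → ℝ≥0∞) (x : X) :
    S.E l h x = ∫⁻ y, h y ∂((ν (S.cell l x))⁻¹ • ν.restrict (S.cell l x)) := by
  rw [lintegral_smul_measure, E, div_eq_mul_inv, mul_comm, smul_eq_mul]

lemma lintegral_cell (l : ℕ) (h : X → ℝ≥0∞) (x : X) :
    ∫⁻ y in S.cell l x, h y ∂ν = S.E l h x * ν (S.cell l x) := by
  rw [E, ENNReal.div_mul_cancel (S.cell_ne_zero l x) (S.cell_ne_top l x)]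

lemma E_doub (l : ℕ) (h : X → ℝ≥0∞) (x : X) : S.E l h x ≤ K * S.E (l+1) h x := by
  unfold E
  rw [ENNReal.div_le_iff (S.cell_ne_zero l x) (S.cell_ne_top l x)]
  have hsub : S.cell l x ⊆ S.cell (l+1) x :=
    S.cell_subset (InvS.mono S (Nat.le_succ l) (S.invS_cell (l+1) x)) (S.mem_cell _ _)
  calc ∫⁻ y in S.cell l x, h y ∂ν ≤ ∫⁻ y in S.cell (l+1) x, h y ∂ν := lintegral_mono_set hsub
    _ = (∫⁻ y in S.cell (l+1) x, h y ∂ν) / ν (S.cell (l+1) x) * ν (S.cell (l+1) x) :=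
        (ENNReal.div_mul_cancel (S.cell_ne_zero _ x) (S.cell_ne_top _ x)).symm
    _ ≤ (∫⁻ y in S.cell (l+1) x, h y ∂ν) / ν (S.cell (l+1) x) * (K * ν (S.cell l x)) := by
        gcongr; exact S.doub l x
    _ = _ := by ring

/-- the Calderon-Zygmund truncation -/
def bF (lam : ℝ≥0∞) (F f : X → ℝ≥0∞) : ℕ → X → ℝ≥0∞
  | 0 => S.E 0 f
  | k+1 => fun x => if lam < S.E (k+1) F x then S.E (k+1) f x else bF lam F f k x

lemma lintegral_bF (lam : ℝ≥0∞) (F f : X → ℝ≥0∞) (k : ℕ) : ∀ A, S.InvS k A →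
    ∫⁻ x in A, S.bF lam F f k x ∂ν = ∫⁻ x in A, f x ∂ν := by
  induction k with
  | zero => intro A hA; exact S.lintegral_E hA f
  | succ k ih =>
    intro A hA
    have hI : S.InvS (k+1) {x | lam < S.E (k+1) F x} := Inv.setOf S (S.inv_E (k+1) F) (lam < ·)
    have hI' : S.InvS (k+1) {x | ¬ lam < S.E (k+1) F x} :=
      Inv.setOf S (S.inv_E (k+1) F) (¬ lam < ·)
    have hm := InvS.measurableSet S hI
    have hAm := InvS.measurableSet S hA
    rw [← lintegral_inter_add_sdiff _ A hm, ← lintegral_inter_add_sdiff f A hm]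
    congr 1
    · rw [← S.lintegral_E (InvS.inter S hA hI) f]
      refine setLIntegral_congr_fun (hAm.inter hm) fun x hx => ?_
      have : lam < S.E (k+1) F x := hx.2
      simp [bF, this]
    · rw [← ih (A \ {x | lam < S.E (k+1) F x}) (InvS.mono S (Nat.le_succ k) (InvS.inter S hA hI'))]
      refine setLIntegral_congr_fun (hAm.diff hm) fun x hx => ?_
      have : ¬ lam < S.E (k+1) F x := hx.2
      simp [bF, this]

lemma bF_le (hK : 1 ≤ K) (lam : ℝ≥0∞) (F : X → ℝ≥0∞) (k : ℕ) (x : X) :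
    S.bF lam F F k x ≤ (K * lam) ⊔ S.E k F x := by
  induction k with
  | zero => exact le_sup_right
  | succ k ih =>
    unfold bF
    split_ifs with h
    · exact le_sup_right
    · refine ih.trans (sup_le le_sup_left ((S.E_doub k F x).trans ?_))
      exact (mul_le_mul_right (not_lt.1 h) K).trans le_sup_left

lemma E_bF (lam : ℝ≥0∞) (F f : X → ℝ≥0∞) (N : ℕ) (x : X) (hx : ∀ l ≤ N, S.E l F x ≤ lam)
    (l : ℕ) (hl : l ≤ N) : S.E l (S.bF lam F f N) x = S.E l f x := by
  have h1 : ∀ k, l ≤ k → k ≤ N → ∀ y ∈ S.cell l x, S.bF lam F f k y = S.bF lam F f l y := by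
    intro k hlk
    induction k, hlk using Nat.le_induction with
    | base => intros; rfl
    | succ k hk ih =>
      intro hkN y hy
      have hxy := S.nest_le (hk.trans (Nat.le_succ k)) ((S.mem_cell_iff _ _ _).1 hy)
      have : ¬ lam < S.E (k+1) F y := by
        rw [S.inv_E (k+1) F y x hxy]; exact not_lt.2 (hx _ hkN)
      rw [← ih (by omega) y hy]
      simp [bF, this]
  unfold E
  congr 1
  rw [← S.lintegral_bF lam F f l _ (S.invS_cell l x)]
  exact setLIntegral_congr_fun (S.meas_cell l x) fun y hy => h1 N hl le_rfl y hy

variable {Ω : Type*} [MeasurableSpace Ω] {μ : Measure Ω} [SFinite ν] [SFinite μ]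

lemma measurable_E_joint (l : ℕ) {f : X → Ω → ℝ≥0∞} (hf : Measurable (Function.uncurry f)) :
    Measurable (fun z : X × Ω => S.E l (fun y => f y z.2) z.1) := by
  letI : MeasurableSpace ι := ⊤
  have h1 : Measurable (fun z : ι × Ω => (∫⁻ y in S.c l ⁻¹' {z.1}, f y z.2 ∂ν) /
      ν (S.c l ⁻¹' {z.1})) := by
    refine measurable_from_prod_countable_right fun n => ?_
    have h2 : Measurable (fun ω => ∫⁻ y in S.c l ⁻¹' {n}, f y ω ∂ν) :=
      Measurable.lintegral_prod_left' (f := fun z : X × Ω => f z.1 z.2) hf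
    exact h2.div_const (ν (S.c l ⁻¹' {n}))
  exact h1.comp (((S.measurable_c l).comp measurable_fst).prodMk measurable_snd)

lemma measurable_Mx_joint (N : ℕ) {f : X → Ω → ℝ≥0∞} (hf : Measurable (Function.uncurry f)) :
    Measurable (fun z : X × Ω => S.Mx N (fun y => f y z.2) z.1) := by
  induction N with
  | zero => simpa [Mx] using S.measurable_E_joint 0 hf
  | succ N ih =>
    simp_rw [Mx_succ]
    exact (S.measurable_E_joint (N+1) hf).sup ih

lemma measurable_bF_joint (lam : ℝ≥0∞) (F : X → ℝ≥0∞) (N : ℕ) {f : X → Ω → ℝ≥0∞}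
    (hf : Measurable (Function.uncurry f)) :
    Measurable (fun z : X × Ω => S.bF lam F (fun y => f y z.2) N z.1) := by
  induction N with
  | zero => exact S.measurable_E_joint 0 hf
  | succ N ih =>
    unfold bF
    refine Measurable.ite ?_ (S.measurable_E_joint (N+1) hf) ih
    exact (InvS.measurableSet S (Inv.setOf S (S.inv_E (N+1) F) (lam < ·))).preimage measurable_fst

lemma eNorm_E_le {s : ℝ≥0∞} (hs : 1 < s) (l : ℕ) {f : X → Ω → ℝ≥0∞}
    (hf : Measurable (Function.uncurry f)) (x : X) :
    eNorm s μ (fun ω => S.E l (fun y => f y ω) x) ≤ S.E l (fun y => eNorm s μ (f y)) x := by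
  simp_rw [E_eq]
  haveI : IsFiniteMeasure ((ν (S.cell l x))⁻¹ • ν.restrict (S.cell l x)) := by
    refine ⟨?_⟩
    simp only [Measure.smul_apply, Measure.restrict_apply_univ, smul_eq_mul]
    exact ENNReal.mul_lt_top (ENNReal.inv_lt_top.2 (pos_iff_ne_zero.2 (S.cell_ne_zero l x)))
      (S.cell_ne_top l x).lt_top
  exact minkowski hs hf

lemma eNorm_bF_le {s : ℝ≥0∞} (hs : 1 < s) (lam : ℝ≥0∞) (N : ℕ) {f : X → Ω → ℝ≥0∞}
    (hf : Measurable (Function.uncurry f)) (x : X) :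
    eNorm s μ (fun ω => S.bF lam (fun y => eNorm s μ (f y)) (fun y => f y ω) N x) ≤
      S.bF lam (fun y => eNorm s μ (f y)) (fun y => eNorm s μ (f y)) N x := by
  induction N with
  | zero => exact S.eNorm_E_le hs 0 hf x
  | succ N ih =>
    unfold bF
    split_ifs with h
    · exact S.eNorm_E_le hs (N+1) hf x
    · exact ih

lemma weak_cell (F : X → ℝ≥0∞) (N : ℕ) (x0 : X) {B : ℝ≥0∞} (hB0 : B ≠ 0) (hB : B ≠ ∞)
    (h0 : S.E N F x0 ≠ 0) (ht : S.E N F x0 ≠ ∞) :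
    ν (S.cell N x0 ∩ {x | B * S.E N F x0 < S.Mx N F x}) ≤ ν (S.cell N x0) / B := by
  have := S.weak F (B * S.E N F x0) N _ (S.invS_cell N x0)
  rw [S.lintegral_cell] at this
  set T := ν (S.cell N x0 ∩ {x | B * S.E N F x0 < S.Mx N F x})
  rw [mul_comm B, mul_assoc, ENNReal.mul_le_mul_iff_right h0 ht] at this
  rw [ENNReal.le_div_iff_mul_le (Or.inl hB0) (Or.inl hB), mul_comm]
  exact this

/-- Fefferman-Stein type vector-valued weak estimate on a cell. -/
lemma vweak {s B A : ℝ≥0∞} (hs : 1 < s) (hK : 1 ≤ K) (hKt : K ≠ ∞) (hB1 : 1 ≤ B) (hB : B ≠ ∞)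
    (hA0 : A ≠ 0) (hAt : A ≠ ∞) (hA : Good s K B A) {f : X → Ω → ℝ≥0∞}
    (hf : Measurable (Function.uncurry f)) (N : ℕ) (x0 : X) :
    ν (S.cell N x0 ∩ {x | A * S.E N (fun y => eNorm s μ (f y)) x0 <
      eNorm s μ (fun ω => S.Mx N (fun y => f y ω) x)}) ≤ 2 * ν (S.cell N x0) / B := by
  have hs0 : s ≠ 0 := (zero_lt_one.trans hs).ne'
  have hB0 : B ≠ 0 := (zero_lt_one.trans_le hB1).ne'
  set F : X → ℝ≥0∞ := fun y => eNorm s μ (f y) with hF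
  have hFm : Measurable F := measurable_eNorm s hf
  set Φ := S.E N F x0 with hΦ
  by_cases hΦt : Φ = ∞
  · rw [hΦt, ENNReal.mul_top hA0]; simp
  by_cases hΦ0 : Φ = 0
  · have h1 : ∀ x ∈ S.cell N x0, eNorm s μ (fun ω => S.Mx N (fun y => f y ω) x) = 0 := by
      intro x hx
      have h2 : ∀ l ≤ N, ∀ᵐ ω ∂μ, S.E l (fun y => f y ω) x = 0 := by
        intro l hl
        have hm : Measurable (fun ω => S.E l (fun y => f y ω) x) :=
          (S.measurable_E_joint l hf).comp (measurable_const.prodMk measurable_id)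
        refine eNorm_zero_ae hs0 hm ?_
        refine nonpos_iff_eq_zero.1 ((S.eNorm_E_le hs l hf x).trans ?_)
        have hsub : S.cell l x ⊆ S.cell N x0 :=
          S.cell_subset (InvS.mono S hl (S.invS_cell N x0)) hx
        have : ∫⁻ y in S.cell l x, F y ∂ν = 0 := by
          refine nonpos_iff_eq_zero.1 ((lintegral_mono_set hsub).trans ?_)
          rw [S.lintegral_cell, ← hΦ, hΦ0, zero_mul]
        change (∫⁻ y in S.cell l x, F y ∂ν) / _ ≤ 0
        rw [this]; simp
      have h3 : ∀ᵐ ω ∂μ, S.Mx N (fun y => f y ω) x ≤ 0 := by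
        have : ∀ᵐ ω ∂μ, ∀ l, l ≤ N → S.E l (fun y => f y ω) x = 0 :=
          ae_all_iff.2 fun l => by
            by_cases hl : l ≤ N
            · filter_upwards [h2 l hl] with ω hω _ using hω
            · exact Filter.Eventually.of_forall fun ω h => absurd h hl
        filter_upwards [this] with ω hω
        refine Finset.sup_le fun l hl => ?_
        exact (hω l (by simpa [Nat.lt_succ_iff] using hl)).le
      exact nonpos_iff_eq_zero.1 ((eNorm_mono_ae s h3).trans_eq (eNorm_zero hs0))
    have h2 : S.cell N x0 ∩ {x | A * Φ < eNorm s μ (fun ω => S.Mx N (fun y => f y ω) x)} = ∅ := by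
      ext x
      simp only [Set.mem_inter_iff, Set.mem_ofPred_eq, Set.mem_empty_iff_false, iff_false, not_and]
      intro hx; rw [h1 x hx]; simp
    rw [h2]; simp
  have hT := S.weak_cell F N x0 hB0 hB hΦ0 hΦt
  rw [← hΦ] at hT
  by_cases hst : s = ∞
  · have h1 : ∀ x, eNorm s μ (fun ω => S.Mx N (fun y => f y ω) x) ≤ S.Mx N F x := by
      intro x
      rw [hst, eNorm_top]
      refine essSup_le_of_ae_le _ ?_
      have : ∀ᵐ ω ∂μ, ∀ l, S.E l (fun y => f y ω) x ≤ S.E l F x := ae_all_iff.2 fun l => by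
        have h2 := S.eNorm_E_le hs l hf x (μ := μ)
        conv at h2 => lhs; rw [hst, eNorm_top]
        filter_upwards [ENNReal.ae_le_essSup (μ := μ) (fun ω => S.E l (fun y => f y ω) x)] with ω hω
        exact hω.trans h2
      filter_upwards [this] with ω hω
      exact Finset.sup_mono_fun fun l _ => hω l
    refine (measure_mono (t := S.cell N x0 ∩ {x | B * Φ < S.Mx N F x}) ?_).trans (hT.trans ?_)
    · rintro x ⟨hx, hx'⟩
      exact ⟨hx, ((mul_le_mul_left (hA.1 hst) Φ).trans_lt hx').trans_le (h1 x)⟩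
    · gcongr
      exact le_mul_of_one_le_left (by simp) one_le_two
  -- finite exponent
  have hs1 : 1 < s.toReal := by
    rw [← ENNReal.toReal_one]; exact (ENNReal.toReal_lt_toReal (by simp) hst).2 hs
  set b : X → Ω → ℝ≥0∞ := fun x ω => S.bF (B * Φ) F (fun y => f y ω) N x with hb
  have hbm : Measurable (Function.uncurry b) := S.measurable_bF_joint (B * Φ) F N hf
  set H : X → ℝ≥0∞ := fun x => eNorm s μ (fun ω => S.Mx N (fun y => b y ω) x) with hH
  have hMbm := S.measurable_Mx_joint N hbm
  have hHm : Measurable H := measurable_eNorm s hMbm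
  have hsub : S.cell N x0 ∩ {x | A * Φ < eNorm s μ (fun ω => S.Mx N (fun y => f y ω) x)} ⊆
      (S.cell N x0 ∩ {x | B * Φ < S.Mx N F x}) ∪ (S.cell N x0 ∩ {x | A * Φ ≤ H x}) := by
    rintro x ⟨hx, hx'⟩
    by_cases hc : B * Φ < S.Mx N F x
    · left; exact ⟨hx, hc⟩
    · right
      refine ⟨hx, ?_⟩
      have h1 : ∀ l ≤ N, S.E l F x ≤ B * Φ := by
        intro l hl
        refine le_trans ?_ (not_lt.1 hc)
        exact Finset.le_sup (f := fun l => S.E l F x) (by simpa [Nat.lt_succ_iff] using hl)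
      have h2 : ∀ ω, S.Mx N (fun y => f y ω) x = S.Mx N (fun y => b y ω) x := by
        intro ω
        refine Finset.sup_congr rfl fun l hl => ?_
        exact (S.E_bF (B * Φ) F (fun y => f y ω) N x h1 l
          (by simpa [Nat.lt_succ_iff] using hl)).symm
      have hx'' : A * Φ < eNorm s μ (fun ω => S.Mx N (fun y => f y ω) x) := hx'
      simp_rw [h2] at hx''
      exact hx''.le
  have hbx : ∀ x, Measurable (b x) := fun x => hbm.comp (measurable_const.prodMk measurable_id)
  have hQm := S.meas_cell N x0
  set Cs := ENNReal.ofReal (2 * s.toReal / (s.toReal-1)) * 2 ^ (s.toReal-1) with hCs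
  have hI : ∫⁻ x in S.cell N x0, H x ^ s.toReal ∂ν ≤
      Cs * ((K * B) ^ (s.toReal-1) * Φ ^ s.toReal * ν (S.cell N x0)) := by
    calc ∫⁻ x in S.cell N x0, H x ^ s.toReal ∂ν
        = ∫⁻ x in S.cell N x0, (∫⁻ ω, S.Mx N (fun y => b y ω) x ^ s.toReal ∂μ) ∂ν := by
          refine lintegral_congr fun x => ?_
          exact eNorm_pow hs0 hst _
      _ = ∫⁻ ω, (∫⁻ x in S.cell N x0, S.Mx N (fun y => b y ω) x ^ s.toReal ∂ν) ∂μ := by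
          refine lintegral_lintegral_swap (Measurable.aemeasurable ?_)
          exact hMbm.pow_const _
      _ ≤ ∫⁻ ω, Cs * (∫⁻ x in S.cell N x0, b x ω ^ s.toReal ∂ν) ∂μ := by
          refine lintegral_mono fun ω => ?_
          exact S.doob hs1 (fun y => b y ω) (hbm.comp (measurable_id.prodMk measurable_const)) N _
            (S.invS_cell N x0)
      _ = Cs * ∫⁻ ω, (∫⁻ x in S.cell N x0, b x ω ^ s.toReal ∂ν) ∂μ := by
          rw [lintegral_const_mul']
          exact ENNReal.mul_ne_top (by simp)
            (ENNReal.rpow_ne_top_of_nonneg (by linarith) (by simp))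
      _ = Cs * ∫⁻ x in S.cell N x0, (∫⁻ ω, b x ω ^ s.toReal ∂μ) ∂ν := by
          congr 1
          refine (lintegral_lintegral_swap (Measurable.aemeasurable ?_)).symm
          exact hbm.pow_const _
      _ ≤ Cs * ∫⁻ x in S.cell N x0, (K * B * Φ) ^ (s.toReal - 1) * S.bF (B * Φ) F F N x ∂ν := by
          refine mul_le_mul_right (setLIntegral_mono' hQm fun x hx => ?_) _
          rw [← eNorm_pow hs0 hst]
          set β := S.bF (B * Φ) F F N x with hβ
          have h1 : eNorm s μ (b x) ≤ β := S.eNorm_bF_le hs (B * Φ) N hf x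
          have h2 : β ≤ K * B * Φ := by
            refine (S.bF_le hK (B * Φ) F N x).trans (sup_le (by rw [mul_assoc]) ?_)
            rw [S.inv_E N F x x0 ((S.mem_cell_iff _ _ _).1 hx), ← hΦ]
            exact le_mul_of_one_le_left (by simp) (one_le_mul hK hB1)
          calc eNorm s μ (b x) ^ s.toReal ≤ β ^ s.toReal := by gcongr
            _ = β ^ (s.toReal - 1) * β := by
              conv_rhs => enter [2]; rw [← ENNReal.rpow_one β]
              rw [← ENNReal.rpow_add_of_nonneg _ _ (by linarith) zero_le_one]; congr 1; ring
            _ ≤ _ := by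
              gcongr
      _ = Cs * ((K * B * Φ) ^ (s.toReal - 1) * (Φ * ν (S.cell N x0))) := by
          rw [lintegral_const_mul', S.lintegral_bF _ _ _ _ _ (S.invS_cell N x0), S.lintegral_cell]
          exact ENNReal.rpow_ne_top_of_nonneg (by linarith)
            (ENNReal.mul_ne_top (ENNReal.mul_ne_top hKt hB) hΦt)
      _ = _ := by
          congr 1
          rw [ENNReal.mul_rpow_of_nonneg _ _ (by linarith : 0 ≤ s.toReal - 1)]
          have : Φ ^ s.toReal = Φ ^ (s.toReal - 1) * Φ := by
            conv_rhs => enter [2]; rw [← ENNReal.rpow_one Φ]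
            rw [← ENNReal.rpow_add_of_nonneg _ _ (by linarith) zero_le_one]; congr 1; ring
          rw [this]; ring
  have hcheb : (A * Φ) ^ s.toReal * ν (S.cell N x0 ∩ {x | A * Φ ≤ H x}) ≤
      ∫⁻ x in S.cell N x0, H x ^ s.toReal ∂ν := by
    have := mul_meas_ge_le_lintegral (μ := ν.restrict (S.cell N x0)) (hHm.pow_const s.toReal)
      ((A * Φ) ^ s.toReal)
    refine le_trans ?_ this
    refine mul_le_mul_right ?_ _
    rw [Measure.restrict_apply (measurableSet_le measurable_const (hHm.pow_const _)),
      Set.inter_comm]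
    refine measure_mono (Set.inter_subset_inter_left _ fun x hx => ?_)
    have hx : A * Φ ≤ H x := hx
    exact ENNReal.rpow_le_rpow hx (by positivity)
  have hgood := hA.2 hst
  have h2 : ν (S.cell N x0 ∩ {x | A * Φ ≤ H x}) ≤ ν (S.cell N x0) / B := by
    rw [ENNReal.le_div_iff_mul_le (Or.inl hB0) (Or.inl hB)]
    have hne : (A * Φ) ^ s.toReal ≠ 0 := by
      simp [hA0, hΦ0, hs1.le, (by linarith : 0 < s.toReal), (by linarith : ¬ s.toReal < 0)]
    have hnt : (A * Φ) ^ s.toReal ≠ ∞ :=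
      ENNReal.rpow_ne_top_of_nonneg (by linarith) (ENNReal.mul_ne_top hAt hΦt)
    rw [← ENNReal.mul_le_mul_iff_right hne hnt, ← mul_assoc]
    calc (A * Φ) ^ s.toReal * ν (S.cell N x0 ∩ {x | A * Φ ≤ H x}) * B
        ≤ Cs * ((K * B) ^ (s.toReal-1) * Φ ^ s.toReal * ν (S.cell N x0)) * B := by
          exact mul_le_mul_left (hcheb.trans hI) _
      _ = (Cs * (K * B) ^ (s.toReal-1) * B) * (Φ ^ s.toReal * ν (S.cell N x0)) := by ring
      _ ≤ A ^ s.toReal * (Φ ^ s.toReal * ν (S.cell N x0)) := by gcongr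
      _ = _ := by rw [ENNReal.mul_rpow_of_nonneg _ _ (by linarith), mul_assoc]
  calc _ ≤ ν (S.cell N x0 ∩ {x | B * Φ < S.Mx N F x}) + ν (S.cell N x0 ∩ {x | A * Φ ≤ H x}) :=
        (measure_mono hsub).trans (measure_union_le _ _)
    _ ≤ ν (S.cell N x0) / B + ν (S.cell N x0) / B := add_le_add hT h2
    _ = _ := by rw [← two_mul, mul_div_assoc]

end DSys

set_option linter.unusedSectionVars false
namespace DSys
variable {X : Type*} [MeasurableSpace X] {ν : Measure X} {ι : Type*} {K : ℝ≥0∞}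
  (S : DSys ν ι K) [Countable ι]

/-- Main abstract stopping-time lemma. -/
lemma main_abs {q : ℝ} (hq : 0 ≤ q) (V : ℕ → ℕ → X → ℝ≥0∞) (p : ℕ → X → ℝ≥0∞) (A : ℝ≥0∞)
    (G W : X → ℝ≥0∞) (hG : Measurable G)
    (hV : ∀ i N, S.Inv i (V i N)) (hp : ∀ l, S.Inv l (p l))
    (hV0 : ∀ k N x, V k N x ≤ V 0 N x)
    (hVs : ∀ k N x, k < N → V 0 N x ^ q ≤ V 0 k x ^ q + V (k+1) N x ^ q)
    (hw : ∀ N x0, ν (S.cell N x0 ∩ {x | A * p N x0 < V 0 N x}) ≤ ν (S.cell N x0) / 2)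
    (hW : ∀ l x, p l x ^ q * S.E l G x ≤ W x) (N : ℕ) :
    ∀ E, S.InvS N E → ∫⁻ x in E, V 0 N x ^ q * G x ∂ν ≤ ∫⁻ x in E, 2 * A ^ q * W x ∂ν := by
  induction N using Nat.strong_induction_on with
  | _ N IH =>
  intro E hE
  refine S.cells_le hE fun x0 _ => ?_
  set lam := A * p N x0 with hlam
  set Q := S.cell N x0 with hQ
  set S0 := {x | lam < V 0 N x} with hS0
  have hVm : ∀ i N, Measurable (V i N) := fun i N => Inv.measurable S (hV i N)
  have hS0m : MeasurableSet S0 := measurableSet_lt measurable_const (hVm 0 N)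
  have hQm : MeasurableSet Q := S.meas_cell N x0
  have hQ0 : ν Q ≠ 0 := S.cell_ne_zero N x0
  have hQt : ν Q ≠ ∞ := S.cell_ne_top N x0
  have hwk : ν (Q ∩ S0) ≤ ν Q / 2 := hw N x0
  have hNN : ∀ x ∈ Q, V N N x ≤ lam := by
    intro x hx
    by_contra hc
    rw [not_le] at hc
    have : Q ⊆ Q ∩ S0 := by
      intro y hy
      refine ⟨hy, ?_⟩
      have hxy : S.c N y = S.c N x :=
        ((S.mem_cell_iff _ _ _).1 hy).trans ((S.mem_cell_iff _ _ _).1 hx).symm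
      have : V N N y = V N N x := hV N N y x hxy
      exact (this ▸ hc).trans_le (hV0 N N y)
    have h1 := (measure_mono this).trans hwk
    exact absurd h1 (not_le.2 (ENNReal.half_lt_self hQ0 hQt))
  have claim : ∀ k, k ≤ N → ∀ E, S.InvS k E → (∀ x ∈ E, V k N x ≤ lam) →
      ∫⁻ x in E, V 0 N x ^ q * G x ∂ν ≤
        ∫⁻ x in E, lam ^ q * G x ∂ν + ∫⁻ x in E ∩ S0, 2 * A ^ q * W x ∂ν := by
    intro k
    induction k with
    | zero =>
      intro _ E hE hEl
      refine le_trans ?_ le_self_add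
      refine setLIntegral_mono' (InvS.measurableSet S hE) fun x hx => ?_
      gcongr
      exact hEl x hx
    | succ k ih =>
      intro hk E hE hEl
      have hI : S.InvS k {x | lam < V k N x} := Inv.setOf S (hV k N) (lam < ·)
      have hI' : S.InvS k {x | ¬ lam < V k N x} := Inv.setOf S (hV k N) (¬ lam < ·)
      have hEk := InvS.mono S (Nat.le_succ k) hE
      have hm := InvS.measurableSet S hI
      have hEm := InvS.measurableSet S hE
      set T := {x | lam < V k N x} with hT
      have h1 : ∫⁻ x in E ∩ T, V 0 N x ^ q * G x ∂ν ≤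
          ∫⁻ x in E ∩ T, lam ^ q * G x ∂ν + ∫⁻ x in (E ∩ T) ∩ S0, 2 * A ^ q * W x ∂ν := by
        have hsub : (E ∩ T) ∩ S0 = E ∩ T := by
          refine Set.inter_eq_left.2 fun x hx => ?_
          exact (show lam < V k N x from hx.2).trans_le (hV0 k N x)
        rw [hsub]
        calc ∫⁻ x in E ∩ T, V 0 N x ^ q * G x ∂ν
            ≤ ∫⁻ x in E ∩ T, (lam ^ q * G x + V 0 k x ^ q * G x) ∂ν := by
              refine setLIntegral_mono' (hEm.inter hm) fun x hx => ?_
              rw [← add_mul]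
              refine mul_le_mul_left ?_ _
              refine (hVs k N x (by omega)).trans ?_
              rw [add_comm]
              gcongr
              exact hEl x hx.1
          _ = ∫⁻ x in E ∩ T, lam ^ q * G x ∂ν + ∫⁻ x in E ∩ T, V 0 k x ^ q * G x ∂ν :=
              lintegral_add_left (hG.const_mul _) _
          _ ≤ _ := by
              refine add_le_add_right ?_ _
              exact IH k (by omega) _ (InvS.inter S hEk hI)
      have h2 : ∫⁻ x in E \ T, V 0 N x ^ q * G x ∂ν ≤
          ∫⁻ x in E \ T, lam ^ q * G x ∂ν + ∫⁻ x in (E \ T) ∩ S0, 2 * A ^ q * W x ∂ν := by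
        refine ih (by omega) (E \ T) (InvS.inter S hEk hI') fun x hx => ?_
        exact not_lt.1 hx.2
      rw [← lintegral_inter_add_sdiff (fun x => V 0 N x ^ q * G x) E hm,
        ← lintegral_inter_add_sdiff (fun x => lam ^ q * G x) E hm,
        ← lintegral_inter_add_sdiff (fun x => 2 * A ^ q * W x) (E ∩ S0) hm]
      have e1 : E ∩ S0 ∩ T = (E ∩ T) ∩ S0 := by ext; simp; tauto
      have e2 : (E ∩ S0) \ T = (E \ T) ∩ S0 := by ext; simp; tauto
      rw [e1, e2]
      refine (add_le_add h1 h2).trans_eq ?_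
      ring
  refine (claim N le_rfl Q (S.invS_cell N x0) hNN).trans ?_
  rw [← lintegral_inter_add_sdiff (fun x => 2 * A ^ q * W x) Q hS0m, add_comm]
  refine add_le_add_right ?_ _
  rw [lintegral_const_mul _ hG, S.lintegral_cell, hlam, ENNReal.mul_rpow_of_nonneg _ _ hq]
  have hν : ν Q ≤ 2 * ν (Q \ S0) := by
    have h1 : ν Q ≤ ν Q / 2 + ν (Q \ S0) := by
      conv_lhs => rw [← measure_inter_add_sdiff Q hS0m]
      gcongr
    have h2 : ν Q / 2 + ν Q / 2 ≤ ν Q / 2 + ν (Q \ S0) := by rwa [ENNReal.add_halves]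
    have h3 : ν Q / 2 ≤ ν (Q \ S0) :=
      (ENNReal.add_le_add_iff_left (ENNReal.div_lt_top hQt (by simp)).ne).1 h2
    rw [ENNReal.div_le_iff (by simp) (by simp)] at h3
    rwa [mul_comm]
  calc A ^ q * p N x0 ^ q * (S.E N G x0 * ν Q)
      ≤ A ^ q * p N x0 ^ q * (S.E N G x0 * (2 * ν (Q \ S0))) := by
        refine mul_le_mul_right (mul_le_mul_right hν _) _
    _ = 2 * A ^ q * (p N x0 ^ q * S.E N G x0) * ν (Q \ S0) := by ring
    _ = ∫⁻ x in Q \ S0, 2 * A ^ q * (p N x0 ^ q * S.E N G x0) ∂ν := by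
        rw [setLIntegral_const]
    _ ≤ _ := by
        refine setLIntegral_mono' (hQm.diff hS0m) fun x hx => ?_
        have hx0 : S.c N x0 = S.c N x := ((S.mem_cell_iff _ _ _).1 hx.1).symm
        rw [hp N x0 x hx0, S.inv_E N G x0 x hx0]
        exact mul_le_mul_right (hW N x) _

variable {Ω : Type*} [MeasurableSpace Ω] (μ : Measure Ω) [SFinite ν] [SFinite μ]

/-- product of averages at level l -/
def aP {m : ℕ} (ρ : Fin m → ℝ) (φ : Fin m → X → Ω → ℝ≥0∞) (l : ℕ) (x : X) (ω : Ω) : ℝ≥0∞ :=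
  ∏ j, S.E l (fun y => φ j y ω) x ^ ρ j

def aV {m : ℕ} (T : ℝ≥0∞) (ρ : Fin m → ℝ) (φ : Fin m → X → Ω → ℝ≥0∞) (i N : ℕ) (x : X) : ℝ≥0∞ :=
  eNorm T μ (fun ω => (Finset.Icc i N).sup fun l => S.aP ρ φ l x ω)

lemma measurable_aP {m : ℕ} (ρ : Fin m → ℝ) {φ : Fin m → X → Ω → ℝ≥0∞}
    (hφ : ∀ j, Measurable (Function.uncurry (φ j))) (l : ℕ) :
    Measurable (fun z : X × Ω => S.aP ρ φ l z.1 z.2) := by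
  unfold aP
  exact Finset.measurable_prod _ fun j _ => (S.measurable_E_joint l (hφ j)).pow_const _

lemma measurable_sup_aP {m : ℕ} (ρ : Fin m → ℝ) {φ : Fin m → X → Ω → ℝ≥0∞}
    (hφ : ∀ j, Measurable (Function.uncurry (φ j))) (s : Finset ℕ) :
    Measurable (fun z : X × Ω => s.sup fun l => S.aP ρ φ l z.1 z.2) := by
  induction s using Finset.induction_on with
  | empty => simp
  | insert a s ha ih =>
    simp only [Finset.sup_insert]
    exact (S.measurable_aP ρ hφ a).sup ih

lemma measurable_sup_aP' {m : ℕ} (ρ : Fin m → ℝ) {φ : Fin m → X → Ω → ℝ≥0∞}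
    (hφ : ∀ j, Measurable (Function.uncurry (φ j))) (s : Finset ℕ) (x : X) :
    Measurable (fun ω : Ω => s.sup fun l => S.aP ρ φ l x ω) :=
  Measurable.of_uncurry_left (f := fun x ω => s.sup fun l => S.aP ρ φ l x ω)
    (S.measurable_sup_aP ρ hφ s)

lemma aV_weak {m : ℕ} (hm : 1 ≤ m) {t : Fin m → ℝ≥0∞} (ht0 : ∀ j, t j ≠ 0)
    (htf : (∑ j, (t j)⁻¹)⁻¹ ≠ ∞)
    {ρ : Fin m → ℝ} (hρ : ∀ j, 0 < ρ j) (hs : ∀ j, 1 < t j * ENNReal.ofReal (ρ j))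
    (hK : 1 ≤ K) (hKt : K ≠ ∞) {A : Fin m → ℝ≥0∞} (hA0 : ∀ j, A j ≠ 0) (hAt : ∀ j, A j ≠ ∞)
    (hA : ∀ j, Good (t j * ENNReal.ofReal (ρ j)) K (4 * m) (A j)) {φ : Fin m → X → Ω → ℝ≥0∞}
    (hφ : ∀ j, Measurable (Function.uncurry (φ j))) (N : ℕ) (x0 : X) :
    ν (S.cell N x0 ∩ {x | (∏ j, A j ^ ρ j) *
        (∏ j, S.E N (fun y => eNorm (t j * ENNReal.ofReal (ρ j)) μ (φ j y)) x0 ^ ρ j) <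
        S.aV μ (∑ j, (t j)⁻¹)⁻¹ ρ φ 0 N x}) ≤ ν (S.cell N x0) / 2 := by
  have hm0 : (m : ℝ≥0∞) ≠ 0 := by simp; omega
  have h1m : (1 : ℝ≥0∞) ≤ m := by exact_mod_cast hm
  have hsub : S.cell N x0 ∩ {x | (∏ j, A j ^ ρ j) *
        (∏ j, S.E N (fun y => eNorm (t j * ENNReal.ofReal (ρ j)) μ (φ j y)) x0 ^ ρ j) <
        S.aV μ (∑ j, (t j)⁻¹)⁻¹ ρ φ 0 N x} ⊆
      ⋃ j, S.cell N x0 ∩ {x | A j * S.E N (fun y => eNorm (t j * ENNReal.ofReal (ρ j)) μ (φ j y)) x0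
        < eNorm (t j * ENNReal.ofReal (ρ j)) μ (fun ω => S.Mx N (fun y => φ j y ω) x)} := by
    rintro x ⟨hx, hx'⟩
    by_contra hc
    simp only [Set.mem_iUnion, Set.mem_inter_iff, hx, true_and, Set.mem_ofPred_eq, not_exists,
      not_lt] at hc
    rw [Set.mem_ofPred_eq] at hx'
    refine absurd hx' (not_lt.2 ?_)
    calc S.aV μ (∑ j, (t j)⁻¹)⁻¹ ρ φ 0 N x
        ≤ eNorm (∑ j, (t j)⁻¹)⁻¹ μ (fun ω => ∏ j, S.Mx N (fun y => φ j y ω) x ^ ρ j) := by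
          refine eNorm_mono _ fun ω => Finset.sup_le fun l hl => ?_
          refine Finset.prod_le_prod' fun j _ => ?_
          refine ENNReal.rpow_le_rpow ?_ (hρ j).le
          exact Finset.le_sup (f := fun l => S.E l (fun y => φ j y ω) x)
            (by simp at hl ⊢; omega)
      _ ≤ ∏ j, eNorm (t j) μ (fun ω => S.Mx N (fun y => φ j y ω) x ^ ρ j) := by
          refine holder ht0 htf (h := fun j ω => S.Mx N (fun y => φ j y ω) x ^ ρ j) fun j => ?_
          exact ((S.measurable_Mx_joint N (hφ j)).comp
            (measurable_const.prodMk measurable_id)).pow_const _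
      _ ≤ ∏ j, (A j ^ ρ j *
            S.E N (fun y => eNorm (t j * ENNReal.ofReal (ρ j)) μ (φ j y)) x0 ^ ρ j) := by
          refine Finset.prod_le_prod' fun j _ => ?_
          rw [eNorm_rpow (ht0 j) (hρ j), ← ENNReal.mul_rpow_of_nonneg _ _ (hρ j).le]
          exact ENNReal.rpow_le_rpow (hc j) (hρ j).le
      _ = _ := Finset.prod_mul_distrib
  refine (measure_mono hsub).trans ((measure_iUnion_le _).trans ?_)
  rw [tsum_fintype]
  calc _ ≤ ∑ j : Fin m, 2 * ν (S.cell N x0) / (4 * m) := by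
        refine Finset.sum_le_sum fun j _ => ?_
        refine S.vweak (hs j) hK hKt ?_ ?_ (hA0 j) (hAt j) (hA j) (hφ j) N x0
        · exact one_le_mul (by norm_num) h1m
        · exact ENNReal.mul_ne_top (by simp) (by simp)
    _ = m * (2 * ν (S.cell N x0) / (4 * m)) := by simp
    _ = ν (S.cell N x0) / 2 := by
        rw [show (2 : ℝ≥0∞) * ν (S.cell N x0) = 2 * ν (S.cell N x0) from rfl,
          show (4 : ℝ≥0∞) * m = (2 * m) * 2 by ring, ← mul_div_assoc, ← mul_assoc, mul_comm (m : ℝ≥0∞) 2,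
          ENNReal.mul_div_mul_left]
        · simp [hm0]
        · exact ENNReal.mul_ne_top (by simp) (by simp)

/-- The bound for one dyadic system. -/
lemma dyadic_bound {m : ℕ} (hm : 1 ≤ m) {t : Fin m → ℝ≥0∞} (ht0 : ∀ j, t j ≠ 0)
    (htf : (∑ j, (t j)⁻¹)⁻¹ ≠ ∞)
    {ρ : Fin m → ℝ} (hρ : ∀ j, 0 < ρ j) (hs : ∀ j, 1 < t j * ENNReal.ofReal (ρ j))
    (hK : 1 ≤ K) (hKt : K ≠ ∞) {A : Fin m → ℝ≥0∞} (hA0 : ∀ j, A j ≠ 0) (hAt : ∀ j, A j ≠ ∞)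
    (hA : ∀ j, Good (t j * ENNReal.ofReal (ρ j)) K (4 * m) (A j)) {φ : Fin m → X → Ω → ℝ≥0∞}
    (hφ : ∀ j, Measurable (Function.uncurry (φ j)))
    {q : ℝ} (hq : 0 ≤ q) (hqt : q ≤ ((∑ j, (t j)⁻¹)⁻¹).toReal)
    {G W : X → ℝ≥0∞} (hG : Measurable G)
    (hW : ∀ l x, (∏ j, S.E l (fun y => eNorm (t j * ENNReal.ofReal (ρ j)) μ (φ j y)) x ^ ρ j) ^ q *
      S.E l G x ≤ W x) (N : ℕ) :
    ∫⁻ x, S.aV μ (∑ j, (t j)⁻¹)⁻¹ ρ φ 0 N x ^ q * G x ∂ν ≤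
      2 * (∏ j, A j ^ ρ j) ^ q * ∫⁻ x, W x ∂ν := by
  have hT0 : (∑ j, (t j)⁻¹)⁻¹ ≠ 0 := by simp [ENNReal.sum_eq_top, ht0]
  have h := S.main_abs hq (S.aV μ (∑ j, (t j)⁻¹)⁻¹ ρ φ)
    (fun l x => ∏ j, S.E l (fun y => eNorm (t j * ENNReal.ofReal (ρ j)) μ (φ j y)) x ^ ρ j)
    (∏ j, A j ^ ρ j) G W hG ?_ ?_ ?_ ?_ ?_ hW N Set.univ (fun _ _ _ _ => trivial)
  · rw [Measure.restrict_univ, lintegral_const_mul'] at h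
    · exact h
    · refine ENNReal.mul_ne_top (by simp) (ENNReal.rpow_ne_top_of_nonneg hq ?_)
      exact ENNReal.prod_ne_top fun j _ => ENNReal.rpow_ne_top_of_nonneg (hρ j).le (hAt j)
  · intro i N x y hxy
    unfold aV
    congr 1
    funext ω
    refine Finset.sup_congr rfl fun l hl => ?_
    unfold aP
    refine Finset.prod_congr rfl fun j _ => ?_
    rw [S.inv_E l _ x y (S.nest_le (Finset.mem_Icc.1 hl).1 hxy)]
  · intro l x y hxy
    refine Finset.prod_congr rfl fun j _ => ?_
    rw [S.inv_E l _ x y hxy]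
  · intro k N x
    refine eNorm_mono _ fun ω => Finset.sup_mono ?_
    exact Finset.Icc_subset_Icc_left (Nat.zero_le k)
  · intro k N x hkN
    have hma : Measurable (fun ω => (Finset.Icc 0 k).sup fun l => S.aP ρ φ l x ω) :=
      S.measurable_sup_aP' ρ hφ (Finset.Icc 0 k) x
    unfold aV
    refine eNorm_sup_le hT0 htf hq hqt hma ?_
    · intro ω
      rw [← Finset.sup_union]
      refine Finset.sup_mono fun l hl => ?_
      simp at hl ⊢; omega
  · intro N x0
    exact S.aV_weak μ hm ht0 htf hρ hs hK hKt hA0 hAt hA hφ N x0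
end DSys

set_option linter.unusedSectionVars false

lemma Cube.set_eq {d : ℕ} (Q : Cube d) :
    Q.set = Set.pi Set.univ fun i => Set.Ico (Q.corner i) (Q.corner i + Q.side) := by
  ext x; simp [Cube.set]

lemma Cube.meas {d : ℕ} (Q : Cube d) : MeasurableSet Q.set := by
  rw [Cube.set_eq]; exact MeasurableSet.univ_pi fun _ => measurableSet_Ico

lemma Cube.vol_eq {d : ℕ} (Q : Cube d) : Q.vol = ENNReal.ofReal Q.side ^ d := by
  rw [Cube.vol, Cube.set_eq, Real.volume_pi_Ico]; simp

lemma Cube.vol_ne_zero {d : ℕ} (Q : Cube d) : Q.vol ≠ 0 := by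
  rw [Cube.vol_eq]; exact pow_ne_zero _ (by simpa using Q.side_pos)

lemma Cube.vol_ne_top {d : ℕ} (Q : Cube d) : Q.vol ≠ ∞ := by
  rw [Cube.vol_eq]; exact ENNReal.pow_ne_top (by simp)

/-- grid cell as a cube -/
def gcube {d : ℕ} (a : Fin d → ℝ) {δ : ℝ} (hδ : 0 < δ) (l : ℕ) (n : Fin d → ℤ) : Cube d :=
  ⟨fun i => a i + δ * 2 ^ l * n i, δ * 2 ^ l, by positivity⟩

def gidx {d : ℕ} (a : Fin d → ℝ) (δ : ℝ) (l : ℕ) (x : Fin d → ℝ) : Fin d → ℤ :=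
  fun i => ⌊(x i - a i) / (δ * 2 ^ l)⌋

lemma gidx_preimage {d : ℕ} (a : Fin d → ℝ) {δ : ℝ} (hδ : 0 < δ) (l : ℕ) (n : Fin d → ℤ) :
    gidx a δ l ⁻¹' {n} = (gcube a hδ l n).set := by
  ext x
  have hL : 0 < δ * 2 ^ l := by positivity
  simp only [Set.mem_preimage, Set.mem_singleton_iff, funext_iff, gidx, Cube.set, gcube,
    Set.mem_ofPred_eq, Int.floor_eq_iff]
  refine forall_congr' fun i => ?_
  rw [le_div_iff₀ hL, div_lt_iff₀ hL]
  constructor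
  · rintro ⟨h1, h2⟩; constructor <;> nlinarith
  · rintro ⟨h1, h2⟩; constructor <;> nlinarith

def grid {d : ℕ} (a : Fin d → ℝ) {δ : ℝ} (hδ : 0 < δ) :
    DSys (volume : Measure (Fin d → ℝ)) (Fin d → ℤ) (2 ^ d) where
  c := gidx a δ
  meas l n := by rw [gidx_preimage a hδ]; exact Cube.meas _
  nest l x y h := by
    funext i
    have hi := congrFun h i
    simp only [gidx] at hi ⊢
    have e : ∀ z : ℝ, z / (δ * 2 ^ (l+1)) = z / (δ * 2 ^ l) / (2 : ℕ) := by
      intro z; rw [pow_succ]; push_cast; field_simp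
    rw [e, e, Int.floor_div_natCast, Int.floor_div_natCast, hi]
  pos l x := by rw [gidx_preimage a hδ]; exact Cube.vol_ne_zero _
  fin l x := by rw [gidx_preimage a hδ]; exact Cube.vol_ne_top _
  doub l x := by
    rw [gidx_preimage a hδ, gidx_preimage a hδ]
    change Cube.vol _ ≤ _ * Cube.vol _
    rw [Cube.vol_eq, Cube.vol_eq, ← mul_pow]
    refine le_of_eq ?_
    congr 1
    simp only [gcube]
    rw [pow_succ, ← mul_assoc, ENNReal.ofReal_mul (by positivity), mul_comm]; simp

lemma grid_cell {d : ℕ} (a : Fin d → ℝ) {δ : ℝ} (hδ : 0 < δ) (l : ℕ) (x : Fin d → ℝ) :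
    (grid a hδ).cell l x = (gcube a hδ l (gidx a δ l x)).set := gidx_preimage a hδ l _

lemma grid_E {d : ℕ} (a : Fin d → ℝ) {δ : ℝ} (hδ : 0 < δ) (l : ℕ) (h : (Fin d → ℝ) → ℝ≥0∞)
    (x : Fin d → ℝ) : (grid a hδ).E l h x =
      (∫⁻ y in (gcube a hδ l (gidx a δ l x)).set, h y) / (gcube a hδ l (gidx a δ l x)).vol := by
  rw [DSys.E, grid_cell]; rfl

lemma third {L s c : ℝ} (hL : 0 < L) (h3 : 3 * s ≤ L) (k : ℕ) :
    (∀ y, c ≤ y → y < c + s → ⌊(y - 0) / L⌋ = ⌊(c - 0) / L⌋) ∨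
    (∀ y, c ≤ y → y < c + s → ⌊(y - L * 2 ^ k / 3) / L⌋ = ⌊(c - L * 2 ^ k / 3) / L⌋) := by
  have key : ∀ y, c ≤ y → y < c + s → c / L ≤ y / L ∧ y / L < c / L + 1/3 := by
    intro y h1 h2
    refine ⟨by gcongr, ?_⟩
    rw [div_add' _ _ _ hL.ne', div_lt_div_iff_of_pos_right hL]
    linarith
  have f1 := Int.floor_le (c / L)
  have f2 := Int.lt_floor_add_one (c / L)
  by_cases hf : c / L ≤ ⌊c / L⌋ + 2/3
  · left
    intro y h1 h2
    obtain ⟨h3, h4⟩ := key y h1 h2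
    rw [sub_zero, sub_zero, Int.floor_eq_iff]
    constructor <;> linarith
  · right
    rw [not_le] at hf
    obtain ⟨n, e, he, hk⟩ : ∃ (n : ℤ) (e : ℤ), (e = 1 ∨ e = 2) ∧ (2:ℝ)^k = 3 * n + e := by
      have : ∃ (n : ℤ) (e : ℤ), (e = 1 ∨ e = 2) ∧ (2:ℤ)^k = 3 * n + e := by
        induction k with
        | zero => exact ⟨0, 1, by simp, by simp⟩
        | succ k ih =>
          obtain ⟨n, e, he, h⟩ := ih
          rcases he with rfl | rfl
          · exact ⟨2 * n, 2, by simp, by rw [pow_succ, h]; ring⟩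
          · exact ⟨2 * n + 1, 1, by simp, by rw [pow_succ, h]; ring⟩
      obtain ⟨n, e, he, h⟩ := this
      exact ⟨n, e, he, by exact_mod_cast h⟩
    have he' : (1:ℝ) ≤ e ∧ (e:ℝ) ≤ 2 := by rcases he with rfl | rfl <;> norm_num
    have ex : ∀ z, (z - L * 2 ^ k / 3) / L = z / L - n - e/3 := by
      intro z; rw [hk]; field_simp; ring
    have fl : ∀ y, c ≤ y → y < c + s ∨ y = c → ⌊(y - L * 2 ^ k / 3) / L⌋ = ⌊c / L⌋ - n := by
      intro y h1 h2
      have : c / L ≤ y / L ∧ y / L < c / L + 1/3 := by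
        rcases h2 with h2 | h2
        · exact key y h1 h2
        · subst h2; constructor <;> linarith
      rw [ex, Int.floor_eq_iff]
      push_cast
      constructor <;> linarith
    intro y h1 h2
    rw [fl y h1 (Or.inl h2), fl c le_rfl (Or.inr rfl)]

/-- shift vector -/
def shf {d : ℕ} (b : ℝ) (α : Fin d → Bool) : Fin d → ℝ := fun i => if α i then b else 0

lemma cover {d : ℕ} (D : Finset (Cube d)) : ∃ (δ : ℝ) (hδ : 0 < δ) (N : ℕ) (b : ℝ), ∀ Q ∈ D,
    ∃ (α : Fin d → Bool) (l : ℕ), l ≤ N ∧ ∀ x ∈ Q.set,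
      Q.set ⊆ (grid (shf b α) hδ).cell l x ∧
      volume ((grid (shf b α) hδ).cell l x) ≤ 6 ^ d * Q.vol := by
  obtain ⟨δ, hδ, hδD⟩ : ∃ δ : ℝ, 0 < δ ∧ ∀ Q ∈ D, δ ≤ Q.side := by
    classical
    induction D using Finset.induction_on with
    | empty => exact ⟨1, one_pos, by simp⟩
    | insert Q D _ ih =>
      obtain ⟨δ, h0, h⟩ := ih
      refine ⟨min δ Q.side, lt_min h0 Q.side_pos, ?_⟩
      intro R hR
      rcases Finset.mem_insert.1 hR with rfl | hR
      · exact min_le_right _ _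
      · exact (min_le_left _ _).trans (h R hR)
  have hl : ∀ Q : Cube d, ∃ l : ℕ, Q ∈ D → 3 * Q.side ≤ δ * 2 ^ l ∧ δ * 2 ^ l ≤ 6 * Q.side := by
    intro Q
    by_cases hQ : Q ∈ D
    swap
    · exact ⟨0, fun h => absurd h hQ⟩
    have hex : ∃ l : ℕ, 3 * Q.side ≤ δ * 2 ^ l := by
      obtain ⟨l, hl⟩ := pow_unbounded_of_one_lt (3 * Q.side / δ) (one_lt_two (α := ℝ))
      refine ⟨l, ?_⟩
      rw [div_lt_iff₀ hδ] at hl; linarith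
    classical
    refine ⟨Nat.find hex, fun _ => ⟨Nat.find_spec hex, ?_⟩⟩
    rcases Nat.eq_zero_or_pos (Nat.find hex) with h0 | h0
    · rw [h0]; have := hδD Q hQ; have := Q.side_pos; norm_num; linarith
    · obtain ⟨k, hk⟩ := Nat.exists_eq_succ_of_ne_zero h0.ne'
      have := Nat.find_min hex (m := k) (by omega)
      rw [hk, Nat.succ_eq_add_one, pow_succ]; linarith
  choose lv hlv using hl
  refine ⟨δ, hδ, D.sup lv, δ * 2 ^ (D.sup lv) / 3, fun Q hQ => ?_⟩
  obtain ⟨h3, h6⟩ := hlv Q hQ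
  have hlN : lv Q ≤ D.sup lv := Finset.le_sup hQ
  obtain ⟨k, hk⟩ := Nat.exists_eq_add_of_le hlN
  set l := lv Q with hl
  have hL : 0 < δ * 2 ^ l := by positivity
  have hb : δ * 2 ^ (D.sup lv) / 3 = δ * 2 ^ l * 2 ^ k / 3 := by rw [hk, pow_add]; ring
  rw [hb]
  have h1 : ∀ i, ∃ β : Bool, ∀ y, Q.corner i ≤ y → y < Q.corner i + Q.side →
      ⌊(y - if β then δ * 2 ^ l * 2 ^ k / 3 else 0) / (δ * 2 ^ l)⌋ =
      ⌊(Q.corner i - if β then δ * 2 ^ l * 2 ^ k / 3 else 0) / (δ * 2 ^ l)⌋ := by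
    intro i
    rcases third (c := Q.corner i) hL h3 k with h | h
    · exact ⟨false, by simpa using h⟩
    · exact ⟨true, by simpa using h⟩
  choose α hα using h1
  refine ⟨α, l, hlN, fun x hx => ⟨fun y hy => ?_, ?_⟩⟩
  · rw [DSys.mem_cell_iff]
    funext i
    exact (hα i (y i) (hy i).1 (hy i).2).trans (hα i (x i) (hx i).1 (hx i).2).symm
  · rw [grid_cell]
    change Cube.vol _ ≤ _
    rw [Cube.vol_eq, Cube.vol_eq, ← mul_pow]
    gcongr
    simp only [gcube]
    rw [show (6 : ℝ≥0∞) = ENNReal.ofReal 6 by simp, ← ENNReal.ofReal_mul (by norm_num)]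
    exact ENNReal.ofReal_le_ofReal h6

section
variable {α : Type*} [MeasurableSpace α] {μ : Measure α}
lemma eNorm_const_mul {p : ℝ≥0∞} (hp0 : p ≠ 0) (hp : p ≠ ∞) {c : ℝ≥0∞} (hc : c ≠ ∞)
    (F : α → ℝ≥0∞) : eNorm p μ (fun x => c * F x) = c * eNorm p μ F := by
  have hpp : 0 < p.toReal := ENNReal.toReal_pos hp0 hp
  rw [eNorm_fin hp, eNorm_fin hp]
  simp_rw [ENNReal.mul_rpow_of_nonneg _ _ hpp.le]
  rw [lintegral_const_mul' _ _ (ENNReal.rpow_ne_top_of_nonneg hpp.le hc),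
    ENNReal.mul_rpow_of_nonneg _ _ (by positivity), ← ENNReal.rpow_mul, mul_one_div_cancel hpp.ne',
    ENNReal.rpow_one]

lemma eNorm_fsup_le {β : Type*} (s : Finset β) {p : ℝ≥0∞} (hp0 : p ≠ 0) (hp : p ≠ ∞) {q : ℝ}
    (hq : 0 < q) (hqp : q ≤ p.toReal) {b : β → α → ℝ≥0∞} (hb : ∀ i, Measurable (b i)) :
    eNorm p μ (fun x => s.sup fun i => b i x) ^ q ≤ ∑ i ∈ s, eNorm p μ (b i) ^ q := by
  classical
  induction s using Finset.induction_on with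
  | empty =>
    have : eNorm p μ (fun x => (∅ : Finset β).sup fun i => b i x) = 0 := eNorm_zero hp0
    rw [this]; simp [hq]
  | insert i s hi ih =>
    rw [Finset.sum_insert hi]
    refine (eNorm_sup_le hp0 hp hq.le hqp (hb i) (b := fun x => s.sup fun i => b i x) ?_).trans
      (add_le_add_right ih _)
    intro x; rw [Finset.sup_insert]
end

/-- sparse-form domination (via the multisublinear maximal operator) of
the lattice multisublinear maximal operator with values in `L^t(Ω)`. -/
theorem statement8 (d m : ℕ) (hd : 1 ≤ d) (hm : 1 ≤ m)
    (r : Fin m → ℝ≥0∞) (hr : ∀ j, 0 < r j ∧ r j ≠ ∞)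
    (t : Fin m → ℝ≥0∞) (hrt : ∀ j, r j < t j) (htfin : (∑ j, (t j)⁻¹)⁻¹ ≠ ∞)
    (q : ℝ≥0∞) (hq1 : (∑ j, (r j)⁻¹)⁻¹ ≤ q) (hq2 : q ≤ (∑ j, (t j)⁻¹)⁻¹) :
    ∃ C : ℝ≥0∞, 0 < C ∧ C ≠ ∞ ∧
      ∀ (Ω : Type) [MeasurableSpace Ω] (μ : Measure Ω) [SigmaFinite μ],
      ∀ (D : Finset (Cube d)) (f : Fin m → (Fin d → ℝ) → Ω → ℂ) (g : (Fin d → ℝ) → ℂ),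
        (∀ j, Measurable (Function.uncurry (f j))) →
        (∀ j ω (Q : Cube d), ∫⁻ x in Q.set, (‖f j x ω‖₊ : ℝ≥0∞) ^ (r j).toReal < ∞) →
        (∀ j (Q : Cube d),
          ∫⁻ x in Q.set, (eNorm (t j) μ (nn (f j x))) ^ (r j).toReal < ∞) →
        Measurable g →
        (∀ Q : Cube d, ∫⁻ x in Q.set, nn g x ^ q.toReal < ∞) →
        eNorm q volume
            (fun x => eNorm (∑ j, (t j)⁻¹)⁻¹ μ (latMax r D f x) * nn g x) ≤
          C * eNorm q volume
            (maximalX r q (fun j x => eNorm (t j) μ (nn (f j x))) (nn g)) := by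
  classical
  have hr0 : ∀ j, 0 < (r j).toReal := fun j => ENNReal.toReal_pos (hr j).1.ne' (hr j).2
  have ht0 : ∀ j, t j ≠ 0 := fun j => ((hr j).1.trans (hrt j)).ne'
  set T := (∑ j, (t j)⁻¹)⁻¹ with hT
  have hT0 : T ≠ 0 := by simp [hT, ENNReal.sum_eq_top, ht0]
  have hqt : q ≠ ∞ := ne_top_of_le_ne_top htfin hq2
  have hq0 : q ≠ 0 := by
    have : (∑ j, (r j)⁻¹)⁻¹ ≠ 0 := by simp [ENNReal.sum_eq_top, (fun j => (hr j).1.ne')]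
    exact ((pos_iff_ne_zero.2 this).trans_le hq1).ne'
  have hqp : 0 < q.toReal := ENNReal.toReal_pos hq0 hqt
  have hqT : q.toReal ≤ T.toReal := ENNReal.toReal_mono htfin hq2
  set ρ : Fin m → ℝ := fun j => 1 / (r j).toReal with hρd
  have hρ : ∀ j, 0 < ρ j := fun j => one_div_pos.2 (hr0 j)
  have hρr : ∀ j, ENNReal.ofReal (ρ j) = (r j)⁻¹ := by
    intro j
    rw [hρd]; simp only [one_div]
    rw [ENNReal.ofReal_inv_of_pos (hr0 j), ENNReal.ofReal_toReal (hr j).2]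
  have hs : ∀ j, 1 < t j * ENNReal.ofReal (ρ j) := by
    intro j
    rw [hρr, ← div_eq_mul_inv, ENNReal.lt_div_iff_mul_lt (Or.inl (hr j).1.ne') (Or.inl (hr j).2),
      one_mul]
    exact hrt j
  have hst : ∀ j, t j * ENNReal.ofReal (ρ j) * ENNReal.ofReal (r j).toReal = t j := by
    intro j
    rw [hρr, ENNReal.ofReal_toReal (hr j).2, mul_assoc, ENNReal.inv_mul_cancel (hr j).1.ne' (hr j).2,
      mul_one]
  have hK : (1 : ℝ≥0∞) ≤ 2 ^ d := one_le_pow₀ one_le_two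
  have hKt : (2 : ℝ≥0∞) ^ d ≠ ∞ := ENNReal.pow_ne_top (by simp)
  choose A hA0 hAt hA using fun j => exists_good (K := 2 ^ d) (B := 4 * m) (hs j) hKt
    (ENNReal.mul_ne_top (by simp) (by simp))
  set Cg : ℝ≥0∞ := ∏ j, ((6 : ℝ≥0∞) ^ d) ^ ρ j with hCg
  have hCgt : Cg ≠ ∞ := ENNReal.prod_ne_top fun j _ =>
    ENNReal.rpow_ne_top_of_nonneg (hρ j).le (ENNReal.pow_ne_top (by simp))
  set A' : ℝ≥0∞ := ∏ j, A j ^ ρ j with hA'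
  have hA't : A' ≠ ∞ := ENNReal.prod_ne_top fun j _ =>
    ENNReal.rpow_ne_top_of_nonneg (hρ j).le (hAt j)
  set Z : ℝ≥0∞ := Cg ^ q.toReal * ((Finset.univ : Finset (Fin d → Bool)).card *
    (2 * A' ^ q.toReal)) with hZ
  have hZt : Z ≠ ∞ := by
    refine ENNReal.mul_ne_top (ENNReal.rpow_ne_top_of_nonneg hqp.le hCgt) (ENNReal.mul_ne_top
      (ENNReal.natCast_ne_top _) (ENNReal.mul_ne_top (by simp)
        (ENNReal.rpow_ne_top_of_nonneg hqp.le hA't)))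
  refine ⟨Z ^ (1 / q.toReal) + 1, by simp, ?_, ?_⟩
  · exact ENNReal.add_ne_top.2 ⟨ENNReal.rpow_ne_top_of_nonneg (by positivity) hZt, by simp⟩
  intro Ω _ μ _ D f g hf _ _ hg _
  set Mq := maximalX r q (fun j x => eNorm (t j) μ (nn (f j x))) (nn g) with hMq
  set φ : Fin m → (Fin d → ℝ) → Ω → ℝ≥0∞ := fun j y ω => (‖f j y ω‖₊ : ℝ≥0∞) ^ (r j).toReal with hφd
  have hφ : ∀ j, Measurable (Function.uncurry (φ j)) := fun j =>
    ((hf j).nnnorm.coe_nnreal_ennreal).pow_const _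
  have hφn : ∀ j y, eNorm (t j * ENNReal.ofReal (ρ j)) μ (φ j y) =
      eNorm (t j) μ (nn (f j y)) ^ (r j).toReal := by
    intro j y
    have := eNorm_rpow (μ := μ) (p := t j * ENNReal.ofReal (ρ j))
      (zero_lt_one.trans (hs j)).ne' (hr0 j) (nn (f j y))
    rw [hst] at this
    exact this
  set G : (Fin d → ℝ) → ℝ≥0∞ := fun x => nn g x ^ q.toReal with hGd
  have hG : Measurable G := (hg.nnnorm.coe_nnreal_ennreal).pow_const _
  obtain ⟨δ, hδ, N, b, hcov⟩ := cover D
  have hgrid : ∀ α : Fin d → Bool,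
      ∫⁻ x, (grid (shf b α) hδ).aV μ T ρ φ 0 N x ^ q.toReal * G x ≤
        2 * A' ^ q.toReal * ∫⁻ x, Mq x ^ q.toReal := by
    intro α
    refine (grid (shf b α) hδ).dyadic_bound μ hm ht0 htfin hρ hs hK hKt hA0 hAt hA hφ hqp.le hqT hG
      ?_ N
    intro l x
    set Q := gcube (shf b α) hδ l (gidx (shf b α) δ l x) with hQ
    have hxQ : x ∈ Q.set := by rw [hQ, ← grid_cell]; exact DSys.mem_cell _ _ _
    have hle : (∏ j, avg (r j) (fun x => eNorm (t j) μ (nn (f j x))) Q) * avg q (nn g) Q ≤ Mq x := by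
      rw [hMq]; unfold maximalX
      exact le_iSup₂_of_le Q hxQ le_rfl
    refine le_trans (le_of_eq ?_) (ENNReal.rpow_le_rpow hle hqp.le)
    rw [ENNReal.mul_rpow_of_nonneg _ _ hqp.le]
    congr 1
    · congr 1
      refine Finset.prod_congr rfl fun j _ => ?_
      rw [grid_E, ← hQ, avg, if_neg (hr j).2]
      simp_rw [hφn]
      rfl
    · rw [grid_E, ← hQ, avg, if_neg hqt, ← ENNReal.rpow_mul, one_div, inv_mul_cancel₀ hqp.ne',
        ENNReal.rpow_one]
  have hpt : ∀ x ω, latMax r D f x ω ≤ Cg * (Finset.univ : Finset (Fin d → Bool)).sup fun α =>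
      (Finset.Icc 0 N).sup fun l => (grid (shf b α) hδ).aP ρ φ l x ω := by
    intro x ω
    unfold latMax
    refine iSup₂_le fun Q hQ => iSup_le fun hx => ?_
    obtain ⟨α, l, hl, hc⟩ := hcov Q hQ
    obtain ⟨hsub, hvol⟩ := hc x hx
    have h1 : (grid (shf b α) hδ).aP ρ φ l x ω ≤
        (Finset.univ : Finset (Fin d → Bool)).sup fun α =>
          (Finset.Icc 0 N).sup fun l => (grid (shf b α) hδ).aP ρ φ l x ω := by
      refine le_trans ?_ (Finset.le_sup (f := fun α => (Finset.Icc 0 N).sup fun l =>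
        (grid (shf b α) hδ).aP ρ φ l x ω) (Finset.mem_univ α))
      exact Finset.le_sup (f := fun l => (grid (shf b α) hδ).aP ρ φ l x ω)
        (Finset.mem_Icc.2 ⟨Nat.zero_le _, hl⟩)
    refine le_trans ?_ (mul_le_mul_right h1 Cg)
    rw [hCg, DSys.aP, ← Finset.prod_mul_distrib]
    refine Finset.prod_le_prod' fun j _ => ?_
    rw [← ENNReal.mul_rpow_of_nonneg _ _ (hρ j).le, latAvg]
    refine ENNReal.rpow_le_rpow ?_ (hρ j).le
    rw [ENNReal.div_le_iff Q.vol_ne_zero Q.vol_ne_top]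
    calc ∫⁻ y in Q.set, (‖f j y ω‖₊ : ℝ≥0∞) ^ (r j).toReal
        ≤ ∫⁻ y in (grid (shf b α) hδ).cell l x, φ j y ω := lintegral_mono_set hsub
      _ = (grid (shf b α) hδ).E l (fun y => φ j y ω) x *
          volume ((grid (shf b α) hδ).cell l x) := DSys.lintegral_cell _ _ _ _
      _ ≤ (grid (shf b α) hδ).E l (fun y => φ j y ω) x * (6 ^ d * Q.vol) :=
          mul_le_mul_right hvol _
      _ = _ := by ring
  have hVx : ∀ x, eNorm T μ (latMax r D f x) ^ q.toReal ≤
      Cg ^ q.toReal * ∑ α : Fin d → Bool, (grid (shf b α) hδ).aV μ T ρ φ 0 N x ^ q.toReal := by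
    intro x
    have h1 := eNorm_mono (μ := μ) T (hpt x)
    rw [eNorm_const_mul hT0 htfin hCgt] at h1
    refine (ENNReal.rpow_le_rpow h1 hqp.le).trans ?_
    rw [ENNReal.mul_rpow_of_nonneg _ _ hqp.le]
    refine mul_le_mul_right ?_ _
    refine eNorm_fsup_le (Finset.univ : Finset (Fin d → Bool)) hT0 htfin hqp hqT
      (b := fun α ω => (Finset.Icc 0 N).sup fun l => (grid (shf b α) hδ).aP ρ φ l x ω) fun α => ?_
    exact (grid (shf b α) hδ).measurable_sup_aP' ρ hφ (Finset.Icc 0 N) x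
  have hVm : ∀ α : Fin d → Bool,
      Measurable (fun x => (grid (shf b α) hδ).aV μ T ρ φ 0 N x ^ q.toReal * G x) := by
    intro α
    refine Measurable.mul (Measurable.pow_const ?_ _) hG
    exact measurable_eNorm T ((grid (shf b α) hδ).measurable_sup_aP ρ hφ (Finset.Icc 0 N))
  have hbnd : ∫⁻ x, (eNorm T μ (latMax r D f x) * nn g x) ^ q.toReal ≤
      Z * ∫⁻ x, Mq x ^ q.toReal := by
    calc ∫⁻ x, (eNorm T μ (latMax r D f x) * nn g x) ^ q.toReal
        ≤ ∫⁻ x, Cg ^ q.toReal *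
            ∑ α : Fin d → Bool, (grid (shf b α) hδ).aV μ T ρ φ 0 N x ^ q.toReal * G x := by
          refine lintegral_mono fun x => ?_
          rw [ENNReal.mul_rpow_of_nonneg _ _ hqp.le, ← Finset.sum_mul, ← mul_assoc]
          exact mul_le_mul_left (hVx x) _
      _ = Cg ^ q.toReal * ∑ α : Fin d → Bool,
            ∫⁻ x, (grid (shf b α) hδ).aV μ T ρ φ 0 N x ^ q.toReal * G x := by
          rw [lintegral_const_mul' _ _ (ENNReal.rpow_ne_top_of_nonneg hqp.le hCgt),
            lintegral_finsetSum _ fun α _ => hVm α]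
      _ ≤ Cg ^ q.toReal * ∑ α : Fin d → Bool, 2 * A' ^ q.toReal * ∫⁻ x, Mq x ^ q.toReal :=
          mul_le_mul_right (Finset.sum_le_sum fun α _ => hgrid α) _
      _ = _ := by
          rw [Finset.sum_const, nsmul_eq_mul, hZ]; ring
  rw [eNorm_fin hqt, eNorm_fin hqt]
  refine (ENNReal.rpow_le_rpow hbnd (by positivity)).trans ?_
  rw [ENNReal.mul_rpow_of_nonneg _ _ (by positivity)]
  exact mul_le_mul_left le_self_add _

end
end

section
/- Let d, m ≥ 1, let (Ω,μ) be a σ-finite measure space, let r⃗ ∈ (0,∞)^m and t⃗ ∈ (0,∞]^m with r_j < t_j for all j, set 1/r := ∑_{j=1}^m 1/r_j and 1/t := ∑_{j=1}^m 1/t_j, assume t < ∞, and let q ∈ [r, t]. Then there is a constant C depending only on d, m, q, r⃗, t⃗ with the following property: for every finite collection 𝒟 of dyadic cubes from the standard dyadic grid 𝔇 and all jointly measurable f_j : ℝ^d × Ω → ℂ with f_j(·,ω) locally r_j-integrable and ‖f_j(x,·)‖_{L^{t_j}(Ω)} locally r_j-integrable in x, there exists a sparse collection 𝒮 ⊆ 𝒟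 such that for almost every x ∈ ℝ^d: ‖M̃^𝒟_{r⃗}(f_1,…,f_m)(x,·)‖_{L^t(Ω)} ≤ C ( ∑_{Q∈𝒮} ∏_{j=1}^m ⟨‖f_j(·,·)‖_{L^{t_j}(Ω)}⟩_{r_j,Q}^q · 1_Q(x) )^{1/q}. -/
open MeasureTheory ENNReal

noncomputable section

namespace SD

def Lam {d : ℕ} (D : Finset (Cube d)) : Prop :=
  ∀ Q ∈ D, ∀ Q' ∈ D, Q.side ≤ Q'.side → Q.set ⊆ Q'.set ∨ Disjoint Q.set Q'.set

lemma Lam.mono {d : ℕ} {D D' : Finset (Cube d)} (h : Lam D) (hs : D' ⊆ D) : Lam D' :=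
  fun Q hQ Q' hQ' => h Q (hs hQ) Q' (hs hQ')

lemma lam_of_dyadic {d : ℕ} (D : Finset (Cube d)) (hD : ∀ Q ∈ D, Q.IsDyadic) : Lam D := by
  intro Q hQ Q' hQ' hs
  obtain ⟨k, n, hk, hn⟩ := hD Q hQ
  obtain ⟨k', n', hk', hn'⟩ := hD Q' hQ'
  by_cases hdis : Disjoint Q.set Q'.set
  · exact Or.inr hdis
  left
  rw [Set.not_disjoint_iff] at hdis
  obtain ⟨z, hz, hz'⟩ := hdis
  have hkk : k' ≤ k := by
    rw [hk, hk'] at hs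
    have := (zpow_le_zpow_iff_right₀ (by norm_num : (1:ℝ) < 2)).1 hs
    omega
  obtain ⟨e, rfl⟩ := Int.le.dest hkk
  have hpos : (0:ℝ) < (2:ℝ) ^ (-(k' + (e:ℤ))) := by positivity
  have hrel : (2:ℝ) ^ (-k') = (2:ℝ) ^ (-(k' + (e:ℤ))) * ((2 ^ e : ℤ) : ℝ) := by
    push_cast
    rw [← zpow_natCast (2:ℝ) e, ← zpow_add₀ (by norm_num)]
    congr 1; ring
  intro y hy i
  have h1 := hz i
  have h2 := hz' i
  have h3 := hy i
  rw [hn, hk] at h1 h3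
  rw [hn', hk', hrel] at h2 ⊢
  set c := (2:ℝ) ^ (-(k' + (e:ℤ)))
  have a1 : n' i * 2 ^ e < n i + 1 := by
    have : c * ((n' i * 2 ^ e : ℤ) : ℝ) < c * ((n i + 1 : ℤ) : ℝ) := by
      push_cast at *
      nlinarith [h1.2, h2.1]
    exact_mod_cast lt_of_mul_lt_mul_left this hpos.le
  have a2 : n i < (n' i + 1) * 2 ^ e := by
    have : c * ((n i : ℤ) : ℝ) < c * (((n' i + 1) * 2 ^ e : ℤ) : ℝ) := by
      push_cast at *
      nlinarith [h1.1, h2.2]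
    exact_mod_cast lt_of_mul_lt_mul_left this hpos.le
  have b1 : ((n' i * 2 ^ e : ℤ) : ℝ) ≤ ((n i : ℤ) : ℝ) := by exact_mod_cast Int.lt_add_one_iff.1 a1
  have b2 : ((n i + 1 : ℤ) : ℝ) ≤ (((n' i + 1) * 2 ^ e : ℤ) : ℝ) := by exact_mod_cast a2
  have c1 := mul_le_mul_of_nonneg_left b1 hpos.le
  have c2 := mul_le_mul_of_nonneg_left b2 hpos.le
  push_cast at *
  constructor
  · nlinarith [h3.1]
  · nlinarith [h3.2]

lemma set_eq {d : ℕ} (Q : Cube d) :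
    Q.set = Set.univ.pi (fun i => Set.Ico (Q.corner i) (Q.corner i + Q.side)) := by
  ext x; simp [Cube.set, Set.mem_pi]

lemma measurableSet_set {d : ℕ} (Q : Cube d) : MeasurableSet Q.set := by
  rw [set_eq]; exact MeasurableSet.univ_pi fun i => measurableSet_Ico

lemma vol_eq {d : ℕ} (Q : Cube d) : Q.vol = ENNReal.ofReal Q.side ^ d := by
  rw [Cube.vol, set_eq, volume_pi_pi]; simp

lemma vol_ne_zero {d : ℕ} (Q : Cube d) : Q.vol ≠ 0 := by
  rw [vol_eq]; exact pow_ne_zero _ (by simpa using Q.side_pos)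

lemma vol_ne_top {d : ℕ} (Q : Cube d) : Q.vol ≠ ∞ := by
  rw [vol_eq]; exact ENNReal.pow_ne_top ENNReal.ofReal_ne_top

/-- union of the cubes -/
def U {d : ℕ} (D : Finset (Cube d)) : Set (Fin d → ℝ) := ⋃ Q ∈ D, Q.set

lemma measurableSet_U {d : ℕ} (D : Finset (Cube d)) : MeasurableSet (U D) :=
  Finset.measurableSet_biUnion D fun Q _ => measurableSet_set Q

lemma weak_union {d : ℕ} (ν : Measure (Fin d → ℝ)) (h : (Fin d → ℝ) → ℝ≥0∞) (l : ℝ≥0∞) :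
    ∀ D : Finset (Cube d), Lam D → (∀ Q ∈ D, l * ν Q.set ≤ ∫⁻ x in Q.set, h x ∂ν) →
    l * ν (U D) ≤ ∫⁻ x in U D, h x ∂ν := by
  classical
  intro D
  induction D using Finset.strongInduction with
  | H D ih =>
  intro hL hD
  rcases D.eq_empty_or_nonempty with rfl | hne
  · simp [U]
  obtain ⟨Q0, hQ0, hmax⟩ := D.exists_max_image (fun Q => Q.side) hne
  set R := D.filter (fun Q => ¬ Q.set ⊆ Q0.set) with hR
  have hRD : R ⊆ D := Finset.filter_subset _ _
  have hss : R ⊂ D := by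
    refine (Finset.ssubset_iff_of_subset hRD).2 ⟨Q0, hQ0, by simp [hR]⟩
  have hdis : Disjoint Q0.set (U R) := by
    rw [U, Set.disjoint_iUnion₂_right]
    intro Q hQ
    rw [hR, Finset.mem_filter] at hQ
    exact ((hL Q hQ.1 Q0 hQ0 (hmax Q hQ.1)).resolve_left hQ.2).symm
  have hU : U D = Q0.set ∪ U R := by
    apply Set.Subset.antisymm
    · intro x hx
      simp only [U, Set.mem_iUnion] at hx
      obtain ⟨Q, hQ, hx⟩ := hx
      by_cases hq : Q.set ⊆ Q0.set
      · exact Or.inl (hq hx)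
      · right
        simp only [U, Set.mem_iUnion]
        exact ⟨Q, by simp [hR, hQ, hq], hx⟩
    · rintro x (hx | hx)
      · simp only [U, Set.mem_iUnion]; exact ⟨Q0, hQ0, hx⟩
      · simp only [U, Set.mem_iUnion] at hx ⊢
        obtain ⟨Q, hQ, hx⟩ := hx
        exact ⟨Q, hRD hQ, hx⟩
  rw [hU, measure_union hdis (measurableSet_U R), lintegral_union (measurableSet_U R) hdis, mul_add]
  exact add_le_add (hD Q0 hQ0) (ih R hss (hL.mono hRD) fun Q hQ => hD Q (hRD hQ))

lemma layer (p : ℝ) (hp : 0 < p) (a : ℝ≥0∞) :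
    ∫⁻ s in Set.Ioi (0:ℝ), ENNReal.ofReal (p * s ^ (p - 1)) *
      (if ENNReal.ofReal s < a then 1 else 0) = a ^ p := by
  have fin : ∀ b : ℝ, 0 ≤ b → ∫⁻ s in Set.Ioc (0:ℝ) b, ENNReal.ofReal (p * s ^ (p - 1))
      = ENNReal.ofReal (b ^ p) := by
    intro b hb
    rw [← ofReal_integral_eq_lintegral_ofReal]
    · rw [← intervalIntegral.integral_of_le hb, intervalIntegral.integral_const_mul,
        integral_rpow (Or.inl (by linarith))]
      congr 1
      rw [sub_add_cancel, Real.zero_rpow hp.ne']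
      field_simp; simp
    · have := (intervalIntegral.intervalIntegrable_rpow' (a := 0) (b := b) (r := p - 1) (by linarith)).const_mul p
      rwa [intervalIntegrable_iff_integrableOn_Ioc_of_le hb] at this
    · refine (ae_restrict_mem measurableSet_Ioc).mono fun s hs => ?_
      have := hs.1
      simp only [Pi.zero_apply]
      positivity
  induction a with
  | top =>
    simp only [ENNReal.ofReal_lt_top, if_true, mul_one, ENNReal.top_rpow_of_pos hp]
    rw [eq_top_iff]
    refine ENNReal.le_of_forall_nnreal_lt fun c _ => ?_
    calc (c : ℝ≥0∞) = ENNReal.ofReal (((c:ℝ) ^ (1/p)) ^ p) := by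
          rw [← Real.rpow_mul c.coe_nonneg, one_div, inv_mul_cancel₀ hp.ne', Real.rpow_one]
          simp
      _ = _ := (fin _ (by positivity)).symm
      _ ≤ _ := lintegral_mono_set Set.Ioc_subset_Ioi_self
  | coe a =>
    have : ∀ s : ℝ, ENNReal.ofReal (p * s ^ (p - 1)) * (if ENNReal.ofReal s < (a:ℝ≥0∞) then 1 else 0)
        = (Set.Iio (a:ℝ)).indicator (fun s => ENNReal.ofReal (p * s ^ (p - 1))) s ∨ s ≤ 0 := by
      intro s
      by_cases hs : s ≤ 0
      · exact Or.inr hs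
      left
      push Not at hs
      have : ENNReal.ofReal s < (a:ℝ≥0∞) ↔ s < a := by
        rw [← ENNReal.ofReal_coe_nnreal, ENNReal.ofReal_lt_ofReal_iff_of_nonneg hs.le]
      simp [Set.indicator, this]
    rw [setLIntegral_congr_fun measurableSet_Ioi (fun s hs => (this s).resolve_right (not_le.2 hs)),
      setLIntegral_indicator measurableSet_Iio, Set.inter_comm, Set.Ioi_inter_Iio,
      setLIntegral_congr Ioo_ae_eq_Ioc, fin a a.2, ← ENNReal.ofReal_coe_nnreal,
      ENNReal.ofReal_rpow_of_nonneg a.coe_nonneg hp.le]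

end SD

namespace SD

/-- dyadic maximal function of a family of numbers -/
def mx {d : ℕ} (D : Finset (Cube d)) (a : Cube d → ℝ≥0∞) (x : Fin d → ℝ) : ℝ≥0∞ :=
  ⨆ Q ∈ D, ⨆ (_ : x ∈ Q.set), a Q

lemma lt_mx {d : ℕ} {D : Finset (Cube d)} {a : Cube d → ℝ≥0∞} {x : Fin d → ℝ} {l : ℝ≥0∞} :
    l < mx D a x ↔ ∃ Q ∈ D, x ∈ Q.set ∧ l < a Q := by
  simp only [mx, lt_iSup_iff, exists_prop]

lemma mx_le {d : ℕ} {D : Finset (Cube d)} {a : Cube d → ℝ≥0∞} {x : Fin d → ℝ} {l : ℝ≥0∞} :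
    mx D a x ≤ l ↔ ∀ Q ∈ D, x ∈ Q.set → a Q ≤ l := by
  simp [mx]

lemma le_mx {d : ℕ} {D : Finset (Cube d)} {a : Cube d → ℝ≥0∞} {x : Fin d → ℝ} {Q : Cube d}
    (hQ : Q ∈ D) (hx : x ∈ Q.set) : a Q ≤ mx D a x := mx_le.1 le_rfl Q hQ hx

lemma measurable_mx_joint {d : ℕ} {Ω : Type*} [MeasurableSpace Ω] (D : Finset (Cube d))
    (a : Cube d → Ω → ℝ≥0∞) (ha : ∀ Q ∈ D, Measurable (a Q)) :
    Measurable (fun z : (Fin d → ℝ) × Ω => mx D (fun Q => a Q z.2) z.1) := by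
  unfold mx
  refine Measurable.biSup _ D.countable_toSet fun Q hQ => ?_
  have : (fun z : (Fin d → ℝ) × Ω => ⨆ (_ : z.1 ∈ Q.set), a Q z.2)
      = (Prod.fst ⁻¹' Q.set).indicator (fun z => a Q z.2) := by
    ext z
    by_cases h : z.1 ∈ Q.set <;> simp [h]
  rw [this]
  exact ((ha Q hQ).comp measurable_snd).indicator (measurable_fst (measurableSet_set Q))

lemma measurable_mx {d : ℕ} (D : Finset (Cube d)) (a : Cube d → ℝ≥0∞) : Measurable (mx D a) := by
  have := measurable_mx_joint D (fun Q (_ : Unit) => a Q) (fun Q _ => measurable_const)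
  exact Measurable.comp (f := fun x : Fin d → ℝ => (x, ())) this (by fun_prop)

lemma weak_half {d : ℕ} (ν : Measure (Fin d → ℝ)) (u : (Fin d → ℝ) → ℝ≥0∞)
    (D : Finset (Cube d)) (hL : Lam D)
    (h0 : ∀ Q ∈ D, ν Q.set ≠ 0) (h1 : ∀ Q ∈ D, ν Q.set ≠ ∞) (l : ℝ≥0∞) (hl : l ≠ ∞) :
    l * ν {x | 2 * l < mx D (fun Q => (∫⁻ x in Q.set, u x ∂ν) / ν Q.set) x}
      ≤ ∫⁻ x, (if l < u x then u x else 0) ∂ν := by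
  classical
  set D' := D.filter (fun Q => 2 * l * ν Q.set < ∫⁻ x in Q.set, u x ∂ν) with hD'
  have hsub : {x | 2 * l < mx D (fun Q => (∫⁻ x in Q.set, u x ∂ν) / ν Q.set) x} ⊆ U D' := by
    intro x hx
    obtain ⟨Q, hQ, hxQ, hlt⟩ := lt_mx.1 hx
    simp only [U, Set.mem_iUnion]
    refine ⟨Q, ?_, hxQ⟩
    rw [hD', Finset.mem_filter]
    exact ⟨hQ, (ENNReal.lt_div_iff_mul_lt (Or.inl (h0 Q hQ)) (Or.inl (h1 Q hQ))).1 hlt⟩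
  calc _ ≤ l * ν (U D') := by gcongr
    _ ≤ ∫⁻ x in U D', (if l < u x then u x else 0) ∂ν := by
      refine weak_union ν _ l D' (hL.mono (Finset.filter_subset _ _)) fun Q hQ => ?_
      rw [hD', Finset.mem_filter] at hQ
      obtain ⟨hQ, hlt⟩ := hQ
      have hle : ∫⁻ x in Q.set, u x ∂ν
          ≤ l * ν Q.set + ∫⁻ x in Q.set, (if l < u x then u x else 0) ∂ν := by
        rw [← setLIntegral_const, ← lintegral_add_left measurable_const]
        refine lintegral_mono fun x => ?_
        by_cases h : l < u x
        · simp [h]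
        · simpa only [h, if_false, add_zero] using not_lt.1 h
      have hfin : l * ν Q.set ≠ ∞ := ENNReal.mul_ne_top hl (h1 Q hQ)
      have := hlt.le.trans hle
      rw [mul_assoc, two_mul] at this
      exact (ENNReal.add_le_add_iff_left hfin).1 this
    _ ≤ _ := setLIntegral_le_lintegral _ _

def Cp (p : ℝ) : ℝ≥0∞ := ENNReal.ofReal (2 * p / (p - 1)) * 2 ^ (p - 1)

lemma strong {d : ℕ} (p : ℝ) (hp : 1 < p) (ν : Measure (Fin d → ℝ)) [SFinite ν]
    (u : (Fin d → ℝ) → ℝ≥0∞) (hu : Measurable u)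
    (D : Finset (Cube d)) (hL : Lam D)
    (h0 : ∀ Q ∈ D, ν Q.set ≠ 0) (h1 : ∀ Q ∈ D, ν Q.set ≠ ∞) :
    ∫⁻ x, mx D (fun Q => (∫⁻ x in Q.set, u x ∂ν) / ν Q.set) x ^ p ∂ν
      ≤ Cp p * ∫⁻ x, u x ^ p ∂ν := by
  set M := mx D (fun Q => (∫⁻ x in Q.set, u x ∂ν) / ν Q.set) with hM
  have hMm : Measurable M := measurable_mx _ _
  have hp0 : 0 < p := by linarith
  have hp1 : 0 < p - 1 := by linarith
  calc ∫⁻ x, M x ^ p ∂ν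
      = ∫⁻ x, (∫⁻ s in Set.Ioi (0:ℝ), ENNReal.ofReal (p * s ^ (p - 1)) *
          (if ENNReal.ofReal s < M x then 1 else 0)) ∂ν := by
        simp_rw [layer p hp0]
    _ = ∫⁻ s in Set.Ioi (0:ℝ), ∫⁻ x, ENNReal.ofReal (p * s ^ (p - 1)) *
          (if ENNReal.ofReal s < M x then 1 else 0) ∂ν := by
        rw [lintegral_lintegral_swap]
        refine Measurable.aemeasurable ?_
        refine Measurable.mul (by fun_prop) ?_
        refine Measurable.ite ?_ measurable_const measurable_const
        exact measurableSet_lt (by fun_prop) (hMm.comp measurable_fst)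
    _ ≤ ∫⁻ s in Set.Ioi (0:ℝ), ∫⁻ x, ENNReal.ofReal (2 * p / (p - 1)) * (u x *
          (ENNReal.ofReal ((p - 1) * s ^ (p - 1 - 1)) *
            (if ENNReal.ofReal s < 2 * u x then 1 else 0))) ∂ν := by
        refine setLIntegral_mono' measurableSet_Ioi fun s hs => ?_
        have hs : 0 < s := hs
        have hw := weak_half ν u D hL h0 h1 (ENNReal.ofReal (s / 2)) ENNReal.ofReal_ne_top
        have e2 : 2 * ENNReal.ofReal (s / 2) = ENNReal.ofReal s := by
          rw [← ENNReal.ofReal_ofNat 2, ← ENNReal.ofReal_mul (by norm_num)]; congr 1; ring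
        have e3 : ∀ x, ENNReal.ofReal (s / 2) < u x ↔ ENNReal.ofReal s < 2 * u x := by
          intro x
          rw [← e2, ENNReal.mul_lt_mul_iff_right (by norm_num) (by norm_num)]
        rw [e2] at hw
        have hconst : ∀ x, ENNReal.ofReal (2 * p / (p - 1)) * (u x *
            (ENNReal.ofReal ((p - 1) * s ^ (p - 1 - 1)) *
            (if ENNReal.ofReal s < 2 * u x then 1 else 0)))
            = ENNReal.ofReal (2 * p * s ^ (p - 2)) *
              (if ENNReal.ofReal (s / 2) < u x then u x else 0) := by
          intro x
          by_cases h : ENNReal.ofReal (s / 2) < u x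
          · have h' := (e3 x).1 h
            simp only [h, h', if_true, mul_one]
            rw [mul_comm (u x), ← mul_assoc, ← ENNReal.ofReal_mul (by positivity)]
            congr 2
            rw [show p - 1 - 1 = p - 2 by ring]
            field_simp
          · have h' : ¬ ENNReal.ofReal s < 2 * u x := fun h'' => h ((e3 x).2 h'')
            simp only [h, h', if_false, mul_zero]
        simp_rw [hconst]
        rw [lintegral_const_mul' _ _ ENNReal.ofReal_ne_top,
          lintegral_const_mul' _ _ ENNReal.ofReal_ne_top]
        calc _ = ENNReal.ofReal (2 * p * s ^ (p - 2)) *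
              (ENNReal.ofReal (s / 2) * ν {x | ENNReal.ofReal s < M x}) := by
              rw [← mul_assoc, ← ENNReal.ofReal_mul (by positivity)]
              congr 1
              · congr 1
                rw [show p - 1 = (p - 2) + 1 by ring, Real.rpow_add hs, Real.rpow_one]; ring
              · rw [← lintegral_indicator_one (measurableSet_lt measurable_const hMm)]
                refine lintegral_congr fun x => ?_
                simp [Set.indicator]
          _ ≤ _ := by gcongr
    _ = ∫⁻ x, (∫⁻ s in Set.Ioi (0:ℝ), ENNReal.ofReal (2 * p / (p - 1)) * (u x *
          (ENNReal.ofReal ((p - 1) * s ^ (p - 1 - 1)) *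
            (if ENNReal.ofReal s < 2 * u x then 1 else 0)))) ∂ν := by
        rw [lintegral_lintegral_swap]
        refine Measurable.aemeasurable ?_
        refine Measurable.mul (by fun_prop) (Measurable.mul (by fun_prop)
          (Measurable.mul (by fun_prop) ?_))
        refine Measurable.ite ?_ measurable_const measurable_const
        exact measurableSet_lt (by fun_prop) (by fun_prop)
    _ = ∫⁻ x, Cp p * u x ^ p ∂ν := by
        refine lintegral_congr fun x => ?_
        have hmeas : Measurable fun s : ℝ => ENNReal.ofReal ((p - 1) * s ^ (p - 1 - 1)) *
            (if ENNReal.ofReal s < 2 * u x then (1:ℝ≥0∞) else 0) :=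
          Measurable.mul (by fun_prop) (Measurable.ite
            (measurableSet_lt (by fun_prop) (by fun_prop)) measurable_const measurable_const)
        rw [lintegral_const_mul _ (hmeas.const_mul _), lintegral_const_mul _ hmeas,
          layer (p - 1) hp1, ENNReal.mul_rpow_of_nonneg _ _ hp1.le, Cp, mul_assoc]
        congr 1
        rw [mul_left_comm]
        congr 1
        conv_rhs => rw [show p = 1 + (p - 1) by ring,
          ENNReal.rpow_add_of_nonneg _ _ zero_le_one hp1.le, ENNReal.rpow_one]
    _ = _ := lintegral_const_mul _ (by fun_prop)

end SD

namespace SD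

lemma canc {c L η v V : ℝ≥0∞} (hc0 : c ≠ 0) (hc : c ≠ ∞) (hL0 : L ≠ 0) (hL : L ≠ ∞)
    (hη0 : η ≠ 0) (hη : η ≠ ∞) (h : c * η⁻¹ * L * v ≤ c * L * V) : v ≤ η * V := by
  have e : c * L * V = (c * η⁻¹ * L) * (η * V) := by
    calc c * L * V = c * L * V * (η⁻¹ * η) := by rw [ENNReal.inv_mul_cancel hη0 hη, mul_one]
      _ = _ := by ring
  rw [e] at h
  refine (ENNReal.mul_le_mul_iff_right ?_ ?_).1 h
  · exact mul_ne_zero (mul_ne_zero hc0 (ENNReal.inv_ne_zero.2 hη)) hL0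
  · exact ENNReal.mul_ne_top (ENNReal.mul_ne_top hc (ENNReal.inv_ne_top.2 hη0)) hL

lemma weakvol {d : ℕ} (G : (Fin d → ℝ) → ℝ≥0∞) (D : Finset (Cube d)) (hL : Lam D)
    (Q0 : Cube d) (hsub : ∀ Q ∈ D, Q.set ⊆ Q0.set) (l : ℝ≥0∞) :
    l * volume {x | l < mx D (fun Q => (∫⁻ x in Q.set, G x) / Q.vol) x}
      ≤ ∫⁻ x in Q0.set, G x := by
  classical
  set D' := D.filter (fun Q => l * Q.vol < ∫⁻ x in Q.set, G x) with hD'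
  have hs : {x | l < mx D (fun Q => (∫⁻ x in Q.set, G x) / Q.vol) x} ⊆ U D' := by
    intro x hx
    obtain ⟨Q, hQ, hxQ, hlt⟩ := lt_mx.1 hx
    simp only [U, Set.mem_iUnion]
    refine ⟨Q, ?_, hxQ⟩
    rw [hD', Finset.mem_filter]
    exact ⟨hQ, (ENNReal.lt_div_iff_mul_lt (Or.inl (vol_ne_zero Q)) (Or.inl (vol_ne_top Q))).1 hlt⟩
  calc _ ≤ l * volume (U D') := by gcongr
    _ ≤ ∫⁻ x in U D', G x := by
      refine weak_union volume _ l D' (hL.mono (Finset.filter_subset _ _)) fun Q hQ => ?_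
      rw [hD', Finset.mem_filter] at hQ
      exact hQ.2.le
    _ ≤ _ := by
      refine lintegral_mono_set ?_
      intro x hx
      simp only [U, Set.mem_iUnion] at hx
      obtain ⟨Q, hQ, hx⟩ := hx
      exact hsub Q (Finset.mem_filter.1 hQ).1 hx

lemma weakLinf {d : ℕ} (η : ℝ≥0∞) (hη0 : η ≠ 0) (hη : η ≠ ∞)
    {Ω : Type} [MeasurableSpace Ω] (μ : Measure Ω) [SigmaFinite μ]
    (D : Finset (Cube d)) (hL : Lam D) (Q0 : Cube d) (hsub : ∀ Q ∈ D, Q.set ⊆ Q0.set)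
    (g : (Fin d → ℝ) → Ω → ℝ≥0∞) (hg : Measurable (Function.uncurry g))
    (G : (Fin d → ℝ) → ℝ≥0∞) (hG : Measurable G) (hgG : ∀ x, ∀ᵐ ω ∂μ, g x ω ≤ G x)
    (hfin : ∫⁻ x in Q0.set, G x ≠ ∞) :
    volume {x | x ∈ Q0.set ∧ η⁻¹ * ((∫⁻ x in Q0.set, G x) / Q0.vol) <
      essSup (fun ω => mx D (fun Q => (∫⁻ y in Q.set, g y ω) / Q.vol) x) μ} ≤ η * Q0.vol := by
  set L := (∫⁻ x in Q0.set, G x) / Q0.vol with hLdef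
  have hLV : ∫⁻ x in Q0.set, G x = L * Q0.vol :=
    (ENNReal.div_mul_cancel (vol_ne_zero Q0) (vol_ne_top Q0)).symm
  have hLfin : L ≠ ∞ := ENNReal.div_ne_top hfin (vol_ne_zero Q0)
  have hae : ∀ᵐ ω ∂μ, ∀ᵐ y, g y ω ≤ G y := by
    have := (Measure.ae_ae_comm (μ := (volume : Measure (Fin d → ℝ))) (ν := μ)
      (p := fun y ω => g y ω ≤ G y)
      (measurableSet_le hg (hG.comp measurable_fst))).1 (Filter.Eventually.of_forall hgG)
    exact this
  have hes : ∀ x, essSup (fun ω => mx D (fun Q => (∫⁻ y in Q.set, g y ω) / Q.vol) x) μ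
      ≤ mx D (fun Q => (∫⁻ x in Q.set, G x) / Q.vol) x := by
    intro x
    refine essSup_le_of_ae_le _ (hae.mono fun ω hω => ?_)
    refine mx_le.2 fun Q hQ hx => le_trans ?_ (le_mx hQ hx)
    gcongr ?_ / _
    exact lintegral_mono_ae (ae_restrict_of_ae hω)
  by_cases hL0 : L = 0
  · have : {x | x ∈ Q0.set ∧ η⁻¹ * L <
      essSup (fun ω => mx D (fun Q => (∫⁻ y in Q.set, g y ω) / Q.vol) x) μ} = ∅ := by
      rw [Set.eq_empty_iff_forall_notMem]
      rintro x ⟨_, hx⟩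
      have := hx.trans_le (hes x)
      rw [lt_mx] at this
      obtain ⟨Q, hQ, _, hlt⟩ := this
      have h0 : ∫⁻ x in Q.set, G x = 0 := by
        refine le_antisymm ?_ (zero_le)
        calc _ ≤ ∫⁻ x in Q0.set, G x := lintegral_mono_set (hsub Q hQ)
          _ = 0 := by rw [hLV, hL0, zero_mul]
      simp [h0] at hlt
    rw [this]; simp
  · refine canc (c := 1) one_ne_zero ENNReal.one_ne_top hL0 hLfin hη0 hη ?_
    rw [one_mul, one_mul, ← hLV]
    refine le_trans ?_ (weakvol G D hL Q0 hsub (η⁻¹ * L))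
    refine mul_le_mul' le_rfl (measure_mono ?_)
    rintro x ⟨_, hx⟩
    exact hx.trans_le (hes x)

lemma Cp_ne_zero {p : ℝ} (hp : 1 < p) : Cp p ≠ 0 := by
  have : 0 < 2 * p / (p - 1) := div_pos (by linarith) (by linarith)
  refine mul_ne_zero (by simpa using this) ?_
  simp [ENNReal.rpow_eq_zero_iff]

lemma Cp_ne_top {p : ℝ} (hp : 1 < p) : Cp p ≠ ∞ := by
  refine ENNReal.mul_ne_top ENNReal.ofReal_ne_top ?_
  exact ENNReal.rpow_ne_top_of_nonneg (by linarith) (by norm_num)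

def Bc (p : ℝ) (η : ℝ≥0∞) : ℝ≥0∞ := (2 * (η / 2)⁻¹) * (2 * Cp p * (η / 2)⁻¹) ^ (1 / p)

set_option maxHeartbeats 2000000 in
lemma weakLp {d : ℕ} (p : ℝ) (hp : 1 < p) (η : ℝ≥0∞) (hη0 : η ≠ 0) (hη : η ≠ ∞)
    {Ω : Type} [MeasurableSpace Ω] (μ : Measure Ω) [SigmaFinite μ]
    (D : Finset (Cube d)) (hL : Lam D) (Q0 : Cube d) (hsub : ∀ Q ∈ D, Q.set ⊆ Q0.set)
    (g : (Fin d → ℝ) → Ω → ℝ≥0∞) (hg : Measurable (Function.uncurry g))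
    (hfin : ∫⁻ x in Q0.set, (∫⁻ ω, g x ω ^ p ∂μ) ^ (1 / p) ≠ ∞) :
    volume {x | x ∈ Q0.set ∧
      Bc p η * ((∫⁻ x in Q0.set, (∫⁻ ω, g x ω ^ p ∂μ) ^ (1 / p)) / Q0.vol) <
      (∫⁻ ω, mx D (fun Q => (∫⁻ y in Q.set, g y ω) / Q.vol) x ^ p ∂μ) ^ (1 / p)}
      ≤ η * Q0.vol := by
  have hp0 : 0 < p := by linarith
  set G : (Fin d → ℝ) → ℝ≥0∞ := fun x => (∫⁻ ω, g x ω ^ p ∂μ) ^ (1 / p) with hGdef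
  have hGp : ∀ x, G x ^ p = ∫⁻ ω, g x ω ^ p ∂μ := by
    intro x
    rw [hGdef, ← ENNReal.rpow_mul, one_div, inv_mul_cancel₀ hp0.ne', ENNReal.rpow_one]
  have hgp : Measurable (fun z : (Fin d → ℝ) × Ω => g z.1 z.2 ^ p) := by
    exact Measurable.pow_const hg p
  have hgpx : ∀ x, Measurable (fun ω => g x ω ^ p) := fun x =>
    Measurable.comp (f := fun ω : Ω => (x, ω)) (g := fun z : (Fin d → ℝ) × Ω => g z.1 z.2 ^ p) hgp measurable_prodMk_left
  have hG : Measurable G := Measurable.pow_const hgp.lintegral_prod_right' _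
  set L := (∫⁻ x in Q0.set, G x) / Q0.vol with hLdef
  have hLV : ∫⁻ x in Q0.set, G x = L * Q0.vol :=
    (ENNReal.div_mul_cancel (vol_ne_zero Q0) (vol_ne_top Q0)).symm
  have hLfin : L ≠ ∞ := ENNReal.div_ne_top hfin (vol_ne_zero Q0)
  by_cases hL0 : L = 0
  · have hG0 : ∀ᵐ x ∂(volume.restrict Q0.set), ∀ᵐ ω ∂μ, g x ω = 0 := by
      rw [hL0, zero_mul, lintegral_eq_zero_iff hG] at hLV
      refine hLV.mono fun x hx => ?_
      have h1 : ∫⁻ ω, g x ω ^ p ∂μ = 0 := by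
        rw [← hGp, hx]; simp [hp0]
      rw [lintegral_eq_zero_iff (hgpx x)] at h1
      refine h1.mono fun ω hω => ?_
      have : g x ω ^ p = 0 := hω
      simpa [hp0, hp0.le, not_lt] using (ENNReal.rpow_eq_zero_iff_of_pos hp0).1 this
    have hcomm := (Measure.ae_ae_comm (μ := volume.restrict Q0.set) (ν := μ)
      (p := fun y ω => g y ω = 0) (hg (measurableSet_singleton 0))).1 hG0
    have : {x | x ∈ Q0.set ∧ Bc p η * L <
      (∫⁻ ω, mx D (fun Q => (∫⁻ y in Q.set, g y ω) / Q.vol) x ^ p ∂μ) ^ (1 / p)} = ∅ := by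
      rw [Set.eq_empty_iff_forall_notMem]
      rintro x ⟨_, hx⟩
      have : ∫⁻ ω, mx D (fun Q => (∫⁻ y in Q.set, g y ω) / Q.vol) x ^ p ∂μ = 0 := by
        rw [← lintegral_zero (μ := μ)]
        refine lintegral_congr_ae (hcomm.mono fun ω hω => ?_)
        have h0 : mx D (fun Q => (∫⁻ y in Q.set, g y ω) / Q.vol) x ≤ 0 := by
          refine mx_le.2 fun Q hQ _ => ?_
          have : ∫⁻ y in Q.set, g y ω = 0 := by
            rw [← lintegral_zero (μ := volume.restrict Q.set)]
            exact lintegral_congr_ae (ae_restrict_of_ae_restrict_of_subset (hsub Q hQ) hω)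
          simp [this]
        simp [le_antisymm h0 (zero_le), hp0]
      rw [this] at hx
      simp [hp0] at hx
    rw [this]; simp
  -- main case
  set G' : (Fin d → ℝ) → ℝ≥0∞ := fun x => G x + L with hG'def
  have hG' : Measurable G' := hG.add_const _
  have hG'0 : ∀ x, G' x ≠ 0 := fun x h => hL0 (by simp [hG'def] at h; exact h.2)
  set ν := (volume.restrict Q0.set).withDensity G' with hν
  have hG'int : ∫⁻ x in Q0.set, G' x = 2 * L * Q0.vol := by
    rw [lintegral_add_right _ measurable_const, setLIntegral_const, hLV]
    change L * Q0.vol + L * Q0.vol = _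
    ring
  have hG'intfin : ∫⁻ x in Q0.set, G' x ≠ ∞ := by
    rw [hG'int]
    exact ENNReal.mul_ne_top (ENNReal.mul_ne_top (by norm_num) hLfin) (vol_ne_top _)
  have hνuniv : ν Set.univ = 2 * L * Q0.vol := by
    rw [hν, withDensity_apply _ MeasurableSet.univ, Measure.restrict_univ, hG'int]
  have : IsFiniteMeasure ν := isFiniteMeasure_withDensity hG'intfin
  have hνQ : ∀ Q ∈ D, ν Q.set = ∫⁻ x in Q.set, G' x := by
    intro Q hQ
    rw [hν, withDensity_apply _ (measurableSet_set Q), Measure.restrict_restrict (measurableSet_set Q),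
      Set.inter_eq_left.2 (hsub Q hQ)]
  have hνres : ∀ Q ∈ D, ν.restrict Q.set = (volume.restrict Q.set).withDensity G' := by
    intro Q hQ
    rw [hν, restrict_withDensity (measurableSet_set Q), Measure.restrict_restrict (measurableSet_set Q),
      Set.inter_eq_left.2 (hsub Q hQ)]
  have hν0 : ∀ Q ∈ D, ν Q.set ≠ 0 := by
    intro Q hQ h
    rw [hνQ Q hQ] at h
    have h2 : L * Q.vol ≤ ∫⁻ x in Q.set, G' x := by
      rw [Cube.vol, ← setLIntegral_const]
      exact lintegral_mono fun x => le_add_self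
    rw [h] at h2
    exact mul_ne_zero hL0 (vol_ne_zero Q) (le_antisymm h2 (zero_le))
  have hν1 : ∀ Q ∈ D, ν Q.set ≠ ∞ := fun Q _ => measure_ne_top _ _
  set u : (Fin d → ℝ) → Ω → ℝ≥0∞ := fun x ω => g x ω / G' x with hu
  have hum : Measurable (fun z : (Fin d → ℝ) × Ω => u z.1 z.2) :=
    Measurable.div hg (hG'.comp measurable_fst)
  have humω : ∀ ω, Measurable (fun x => u x ω) := fun ω =>
    Measurable.comp (f := fun x : Fin d → ℝ => (x, ω)) (g := fun z : (Fin d → ℝ) × Ω => u z.1 z.2) hum measurable_prodMk_right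
  have hgu : ∀ Q ∈ D, ∀ ω, ∫⁻ y in Q.set, g y ω ≤ ∫⁻ y in Q.set, u y ω ∂ν := by
    intro Q hQ ω
    rw [hνres Q hQ, lintegral_withDensity_eq_lintegral_mul _ hG'
      (humω ω)]
    refine lintegral_mono_ae ?_
    have hlt : ∀ᵐ x ∂(volume.restrict Q.set), G' x < ∞ :=
      ae_restrict_of_ae_restrict_of_subset (hsub Q hQ) (ae_lt_top hG' hG'intfin)
    refine hlt.mono fun x hx => ?_
    exact (ENNReal.mul_div_cancel (hG'0 x) hx.ne).ge
  set Mu : (Fin d → ℝ) → Ω → ℝ≥0∞ :=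
    fun x ω => mx D (fun Q => (∫⁻ y in Q.set, u y ω ∂ν) / ν Q.set) x with hMu
  set MG : (Fin d → ℝ) → ℝ≥0∞ := mx D (fun Q => (∫⁻ x in Q.set, G' x) / Q.vol) with hMG
  have hMum : Measurable (fun z : (Fin d → ℝ) × Ω => Mu z.1 z.2) := by
    refine measurable_mx_joint D (fun Q ω => (∫⁻ y in Q.set, u y ω ∂ν) / ν Q.set) fun Q hQ => ?_
    exact Measurable.div_const hum.lintegral_prod_left' _
  have hMump : Measurable (fun z : (Fin d → ℝ) × Ω => Mu z.1 z.2 ^ p) := hMum.pow_const p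
  have hMumx : ∀ x, Measurable (fun ω => Mu x ω ^ p) := fun x =>
    Measurable.comp (f := fun ω : Ω => (x, ω)) (g := fun z : (Fin d → ℝ) × Ω => Mu z.1 z.2 ^ p) hMump measurable_prodMk_left
  have hpt : ∀ x ω, mx D (fun Q => (∫⁻ y in Q.set, g y ω) / Q.vol) x ≤ MG x * Mu x ω := by
    intro x ω
    refine mx_le.2 fun Q hQ hx => ?_
    calc (∫⁻ y in Q.set, g y ω) / Q.vol ≤ (∫⁻ y in Q.set, u y ω ∂ν) / Q.vol := by
          gcongr ?_ / _
          exact hgu Q hQ ω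
      _ = (∫⁻ x in Q.set, G' x) / Q.vol * ((∫⁻ y in Q.set, u y ω ∂ν) / ν Q.set) := by
          rw [← hνQ Q hQ, div_eq_mul_inv, div_eq_mul_inv, div_eq_mul_inv]
          calc _ = (∫⁻ y in Q.set, u y ω ∂ν) * (Q.vol)⁻¹ * (ν Q.set * (ν Q.set)⁻¹) := by
                rw [ENNReal.mul_inv_cancel (hν0 Q hQ) (hν1 Q hQ), mul_one]
            _ = _ := by ring
      _ ≤ _ := mul_le_mul' (le_mx (a := fun Q => (∫⁻ x in Q.set, G' x) / Q.vol) hQ hx)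
          (le_mx (a := fun Q => (∫⁻ y in Q.set, u y ω ∂ν) / ν Q.set) hQ hx)
  have hη2 : η / 2 ≠ 0 := by simpa using hη0
  have hη2' : η / 2 ≠ ∞ := ENNReal.div_ne_top hη (by norm_num)
  set K : ℝ≥0∞ := 2 * (η / 2)⁻¹ with hK
  set b : ℝ≥0∞ := 2 * Cp p * (η / 2)⁻¹ with hb
  have hup : ∫⁻ x, (∫⁻ ω, u x ω ^ p ∂μ) ∂ν ≤ ν Set.univ := by
    rw [← lintegral_one]
    refine lintegral_mono fun x => ?_
    have : ∀ ω, u x ω ^ p = g x ω ^ p * ((G' x)⁻¹) ^ p := fun ω => by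
      simp only [hu]
      rw [div_eq_mul_inv, ENNReal.mul_rpow_of_nonneg _ _ hp0.le]
    simp_rw [this]
    rw [lintegral_mul_const _ (hgpx x), ← hGp, ENNReal.inv_rpow,
      ← div_eq_mul_inv]
    refine ENNReal.div_le_of_le_mul ?_
    rw [one_mul]
    exact ENNReal.rpow_le_rpow le_self_add hp0.le
  have hMup : ∫⁻ x, (∫⁻ ω, Mu x ω ^ p ∂μ) ∂ν ≤ Cp p * (2 * L * Q0.vol) := by
    rw [lintegral_lintegral_swap hMump.aemeasurable]
    calc _ ≤ ∫⁻ ω, Cp p * ∫⁻ x, u x ω ^ p ∂ν ∂μ :=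
          lintegral_mono fun ω => strong p hp ν (fun x => u x ω)
            (humω ω) D hL hν0 hν1
      _ = Cp p * ∫⁻ ω, ∫⁻ x, u x ω ^ p ∂ν ∂μ := lintegral_const_mul' _ _ (Cp_ne_top hp)
      _ = Cp p * ∫⁻ x, (∫⁻ ω, u x ω ^ p ∂μ) ∂ν := by
          rw [lintegral_lintegral_swap]
          have hsw : Measurable (fun z : Ω × (Fin d → ℝ) => u z.2 z.1 ^ p) :=
            Measurable.pow_const (Measurable.comp (f := fun z : Ω × (Fin d → ℝ) => (z.2, z.1))
              (g := fun z : (Fin d → ℝ) × Ω => u z.1 z.2) hum (measurable_snd.prodMk measurable_fst)) p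
          exact hsw.aemeasurable
      _ ≤ _ := by rw [← hνuniv]; gcongr
  have hset1 : volume {x | K * L < MG x} ≤ η / 2 * Q0.vol := by
    refine canc (c := 2) (by norm_num) (by norm_num) hL0 hLfin hη2 hη2' ?_
    rw [← hG'int]
    exact weakvol G' D hL Q0 hsub (K * L)
  have hset2 : volume ({x | b ≤ ∫⁻ ω, Mu x ω ^ p ∂μ} ∩ Q0.set) ≤ η / 2 * Q0.vol := by
    refine canc (c := 2 * Cp p) (mul_ne_zero (by norm_num) (Cp_ne_zero hp))
      (ENNReal.mul_ne_top (by norm_num) (Cp_ne_top hp)) hL0 hLfin hη2 hη2' ?_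
    have hmI : Measurable (fun x => ∫⁻ ω, Mu x ω ^ p ∂μ) := hMump.lintegral_prod_right'
    have hms : MeasurableSet {x | b ≤ ∫⁻ ω, Mu x ω ^ p ∂μ} :=
      measurableSet_le measurable_const hmI
    have h1 : L * volume ({x | b ≤ ∫⁻ ω, Mu x ω ^ p ∂μ} ∩ Q0.set)
        ≤ ν {x | b ≤ ∫⁻ ω, Mu x ω ^ p ∂μ} := by
      rw [hν, withDensity_apply _ hms, ← Measure.restrict_apply hms, ← setLIntegral_const]
      exact lintegral_mono fun x => le_add_self
    have h2 := mul_meas_ge_le_lintegral (μ := ν) hmI b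
    calc _ = b * (L * volume ({x | b ≤ ∫⁻ ω, Mu x ω ^ p ∂μ} ∩ Q0.set)) := by rw [hb]; ring
      _ ≤ b * ν {x | b ≤ ∫⁻ ω, Mu x ω ^ p ∂μ} := by gcongr
      _ ≤ Cp p * (2 * L * Q0.vol) := h2.trans hMup
      _ = _ := by ring
  calc _ ≤ volume ({x | K * L < MG x} ∪ ({x | b ≤ ∫⁻ ω, Mu x ω ^ p ∂μ} ∩ Q0.set)) := by
        refine measure_mono ?_
        rintro x ⟨hx0, hx⟩
        by_contra hcon
        simp only [Set.mem_union, Set.mem_inter_iff, Set.mem_ofPred_eq, not_or, not_and, not_lt] at hcon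
        obtain ⟨c1, c2⟩ := hcon
        have c3 : ∫⁻ ω, Mu x ω ^ p ∂μ ≤ b := by
          by_contra h; exact c2 (not_le.1 h).le hx0
        refine absurd hx (not_lt.2 ?_)
        calc _ ≤ (∫⁻ ω, (K * L) ^ p * Mu x ω ^ p ∂μ) ^ (1 / p) := by
              refine ENNReal.rpow_le_rpow (lintegral_mono fun ω => ?_) (by positivity)
              rw [← ENNReal.mul_rpow_of_nonneg _ _ hp0.le]
              refine ENNReal.rpow_le_rpow ((hpt x ω).trans ?_) hp0.le
              gcongr
          _ = K * L * (∫⁻ ω, Mu x ω ^ p ∂μ) ^ (1 / p) := by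
              rw [lintegral_const_mul _ (hMumx x),
                ENNReal.mul_rpow_of_nonneg _ _ (by positivity), ← ENNReal.rpow_mul, one_div,
                mul_inv_cancel₀ hp0.ne', ENNReal.rpow_one]
          _ ≤ K * L * b ^ (1 / p) := by
              gcongr
          _ = _ := by rw [Bc]; ring
    _ ≤ _ := measure_union_le _ _
    _ ≤ η / 2 * Q0.vol + η / 2 * Q0.vol := add_le_add hset1 hset2
    _ = _ := by rw [← add_mul, ENNReal.add_halves]

end SD

namespace SD

lemma measurable_essSup {X Ω : Type*} [MeasurableSpace X] [MeasurableSpace Ω] (μ : Measure Ω)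
    [SFinite μ] (g : X → Ω → ℝ≥0∞) (hg : Measurable (Function.uncurry g)) :
    Measurable (fun x => essSup (g x) μ) := by
  refine measurable_of_Iic fun a => ?_
  have : (fun x => essSup (g x) μ) ⁻¹' Set.Iic a = {x | μ (Prod.mk x ⁻¹' {z | a < g z.1 z.2}) = 0} := by
    ext x
    simp only [Set.mem_preimage, Set.mem_Iic]
    constructor
    · intro h
      have h1 : ∀ᵐ ω ∂μ, g x ω ≤ a := (ENNReal.ae_le_essSup (g x)).mono fun ω hω => hω.trans h
      have h2 := ae_iff.1 h1
      simpa using h2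
    · intro h
      refine essSup_le_of_ae_le a ?_
      have : ∀ᵐ ω ∂μ, g x ω ≤ a := by
        rw [ae_iff]; simpa using h
      exact this
  rw [this]
  exact measurable_measure_prodMk_left (measurableSet_lt measurable_const hg)
    (measurableSet_singleton 0)

lemma mx_rpow_le {d : ℕ} (D : Finset (Cube d)) (a : Cube d → ℝ≥0∞) (x : Fin d → ℝ) {s : ℝ}
    (hs : 0 ≤ s) : mx D (fun Q => a Q ^ s) x ≤ mx D a x ^ s :=
  mx_le.2 fun _ hQ hx => ENNReal.rpow_le_rpow (le_mx hQ hx) hs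

lemma weakJ {d : ℕ} (r t : ℝ≥0∞) (hr0 : 0 < r) (hr : r ≠ ∞) (hrt : r < t)
    (η : ℝ≥0∞) (hη0 : η ≠ 0) (hη : η ≠ ∞) :
    ∃ B : ℝ≥0∞, B ≠ ∞ ∧ ∀ (Ω : Type) [MeasurableSpace Ω] (μ : Measure Ω) [SigmaFinite μ]
    (D : Finset (Cube d)) (_ : Lam D) (Q0 : Cube d) (_ : ∀ Q ∈ D, Q.set ⊆ Q0.set)
    (f : (Fin d → ℝ) → Ω → ℂ) (_ : Measurable (Function.uncurry f))
    (_ : ∫⁻ x in Q0.set, (eNorm t μ (nn (f x))) ^ r.toReal < ∞),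
    volume {x | x ∈ Q0.set ∧ B * avg r (fun y => eNorm t μ (nn (f y))) Q0 <
      eNorm t μ (fun ω => mx D (fun Q => latAvg r f Q ω) x)} ≤ η * Q0.vol := by
  have hρ : 0 < r.toReal := ENNReal.toReal_pos hr0.ne' hr
  set ρ := r.toReal with hρdef
  have hρ' : 0 < 1 / ρ := by positivity
  by_cases ht : t = ∞
  · subst ht
    refine ⟨η⁻¹ ^ (1 / ρ), ENNReal.rpow_ne_top_of_nonneg hρ'.le (ENNReal.inv_ne_top.2 hη0), ?_⟩
    intro Ω _ μ _ D hL Q0 hsub f hf hfin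
    have hnn : Measurable (Function.uncurry (fun x => nn (f x))) := by
      exact (measurable_coe_nnreal_ennreal.comp hf.nnnorm)
    simp only [eNorm, if_true] at hfin ⊢
    refine le_trans (measure_mono ?_) (weakLinf η hη0 hη μ D hL Q0 hsub
      (fun x ω => nn (f x) ω ^ ρ) (Measurable.pow_const hnn ρ)
      (fun x => essSup (nn (f x)) μ ^ ρ) ((measurable_essSup μ _ hnn).pow_const ρ)
      (fun x => (ENNReal.ae_le_essSup (nn (f x))).mono fun ω hω => ENNReal.rpow_le_rpow hω hρ.le)
      hfin.ne)
    rintro x ⟨hx0, hx⟩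
    refine ⟨hx0, ?_⟩
    simp only [avg, hr, if_false] at hx
    rw [← ENNReal.mul_rpow_of_nonneg _ _ hρ'.le] at hx
    refine (ENNReal.rpow_lt_rpow_iff hρ').1 (hx.trans_le ?_)
    refine essSup_le_of_ae_le _ ((ENNReal.ae_le_essSup (fun ω => mx D (fun Q => (∫⁻ y in Q.set, nn (f y) ω ^ ρ) / Q.vol) x)).mono fun ω hω => ?_)
    refine (mx_rpow_le D (fun Q => (∫⁻ y in Q.set, nn (f y) ω ^ ρ) / Q.vol) x hρ'.le).trans ?_
    exact ENNReal.rpow_le_rpow hω hρ'.le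
  · have hτ : ρ < t.toReal := ENNReal.toReal_strict_mono ht hrt
    set τ := t.toReal with hτdef
    have hτ0 : 0 < τ := hρ.trans hτ
    have hp : 1 < τ / ρ := by rwa [lt_div_iff₀ hρ, one_mul]
    set p := τ / ρ with hpdef
    have hp0 : 0 < p := by linarith
    have hρp : ρ * p = τ := by rw [hpdef]; field_simp
    have hexp : 1 / τ = 1 / p * (1 / ρ) := by rw [hpdef]; field_simp
    have hexp2 : 1 / τ * ρ = 1 / p := by rw [hpdef]; field_simp
    refine ⟨Bc p η ^ (1 / ρ), ENNReal.rpow_ne_top_of_nonneg hρ'.le ?_, ?_⟩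
    · have h2 : (η / 2)⁻¹ ≠ ∞ := ENNReal.inv_ne_top.2 (by simpa using hη0)
      exact ENNReal.mul_ne_top (ENNReal.mul_ne_top (by norm_num) h2)
        (ENNReal.rpow_ne_top_of_nonneg (by positivity)
          (ENNReal.mul_ne_top (ENNReal.mul_ne_top (by norm_num) (Cp_ne_top hp)) h2))
    intro Ω _ μ _ D hL Q0 hsub f hf hfin
    have hnn : Measurable (Function.uncurry (fun x => nn (f x))) := by
      exact (measurable_coe_nnreal_ennreal.comp hf.nnnorm)
    simp only [eNorm, ht, if_false] at hfin ⊢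
    have key : ∀ x, (∫⁻ ω, (nn (f x) ω ^ ρ) ^ p ∂μ) ^ (1 / p)
        = ((∫⁻ ω, nn (f x) ω ^ τ ∂μ) ^ (1 / τ)) ^ ρ := by
      intro x
      simp_rw [← ENNReal.rpow_mul, hρp, hexp2]
    have hfin' : ∫⁻ x in Q0.set, (∫⁻ ω, (nn (f x) ω ^ ρ) ^ p ∂μ) ^ (1 / p) ≠ ∞ := by
      simp_rw [key]; exact hfin.ne
    refine le_trans (measure_mono ?_) (weakLp p hp η hη0 hη μ D hL Q0 hsub
      (fun x ω => nn (f x) ω ^ ρ) (Measurable.pow_const hnn ρ) hfin')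
    rintro x ⟨hx0, hx⟩
    refine ⟨hx0, ?_⟩
    simp only [avg, hr, if_false] at hx
    rw [← ENNReal.mul_rpow_of_nonneg _ _ hρ'.le] at hx
    simp_rw [key]
    refine (ENNReal.rpow_lt_rpow_iff hρ').1 (hx.trans_le ?_)
    rw [← ENNReal.rpow_mul, ← hexp]
    refine ENNReal.rpow_le_rpow (lintegral_mono fun ω => ?_) (by positivity)
    rw [show t.toReal = ρ * p from hρp.symm, ENNReal.rpow_mul]
    refine ENNReal.rpow_le_rpow ?_ hp0.le
    calc _ ≤ (mx D (fun Q => (∫⁻ y in Q.set, nn (f y) ω ^ ρ) / Q.vol) x ^ (1 / ρ)) ^ ρ :=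
          ENNReal.rpow_le_rpow (mx_rpow_le D _ x hρ'.le) hρ.le
      _ = _ := by rw [← ENNReal.rpow_mul, one_div, inv_mul_cancel₀ hρ.ne', ENNReal.rpow_one]

lemma holder {m : ℕ} {Ω : Type*} [MeasurableSpace Ω] (μ : Measure Ω) (t : Fin m → ℝ≥0∞)
    (ht : ∀ j, t j ≠ 0) (hT : (∑ j, (t j)⁻¹)⁻¹ ≠ ∞)
    (h : Fin m → Ω → ℝ≥0∞) (hh : ∀ j, Measurable (h j)) :
    eNorm (∑ j, (t j)⁻¹)⁻¹ μ (fun ω => ∏ j, h j ω) ≤ ∏ j, eNorm (t j) μ (h j) := by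
  set T := (∑ j, (t j)⁻¹)⁻¹ with hTdef
  have hT0 : T ≠ 0 := by
    rw [hTdef]
    exact ENNReal.inv_ne_zero.2 (ENNReal.sum_ne_top.2 fun j _ => ENNReal.inv_ne_top.2 (ht j))
  have hτ : 0 < T.toReal := ENNReal.toReal_pos hT0 hT
  have hsum : ∑ j, (t j).toReal⁻¹ = T.toReal⁻¹ := by
    rw [hTdef, ENNReal.toReal_inv, inv_inv,
      ENNReal.toReal_sum fun j _ => ENNReal.inv_ne_top.2 (ht j)]
    simp [ENNReal.toReal_inv]
  set τ := T.toReal with hτdef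
  set w : Fin m → ℝ := fun j => τ * (t j).toReal⁻¹ with hw
  have hwsum : ∑ j, w j = 1 := by
    rw [hw, ← Finset.mul_sum, hsum, mul_inv_cancel₀ hτ.ne']
  set c : Fin m → ℝ≥0∞ := fun j => if t j = ∞ then (essSup (h j) μ) ^ τ else 1 with hc
  have hN : ∀ j, eNorm (t j) μ (h j) ^ τ = (∫⁻ ω, h j ω ^ (t j).toReal ∂μ) ^ w j * c j := by
    intro j
    by_cases hj : t j = ∞
    · simp [eNorm, hj, hw, hc]
    · simp only [eNorm, hj, if_false, hw, hc, mul_one]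
      rw [← ENNReal.rpow_mul]; congr 1; rw [one_div, mul_comm]
  have hpt : ∀ᵐ ω ∂μ, (∏ j, h j ω) ^ τ ≤ (∏ j, c j) * ∏ j, (h j ω ^ (t j).toReal) ^ w j := by
    have : ∀ᵐ ω ∂μ, ∀ j, h j ω ≤ essSup (h j) μ :=
      ae_all_iff.2 fun j => ENNReal.ae_le_essSup (h j)
    refine this.mono fun ω hω => ?_
    rw [← Finset.prod_mul_distrib, ← ENNReal.prod_rpow_of_nonneg hτ.le]
    refine Finset.prod_le_prod' fun j _ => ?_
    by_cases hj : t j = ∞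
    · simp only [hc, hj, if_true, ENNReal.toReal_top, ENNReal.rpow_zero, ENNReal.one_rpow, mul_one]
      exact ENNReal.rpow_le_rpow (hω j) hτ.le
    · simp only [hc, hj, if_false, one_mul, hw]
      rw [← ENNReal.rpow_mul]
      have : (t j).toReal ≠ 0 := (ENNReal.toReal_pos (ht j) hj).ne'
      apply le_of_eq; congr 1; field_simp
  have hmain : ∫⁻ ω, (∏ j, h j ω) ^ τ ∂μ ≤ (∏ j, eNorm (t j) μ (h j)) ^ τ := by
    calc _ ≤ ∫⁻ ω, (∏ j, c j) * ∏ j, (h j ω ^ (t j).toReal) ^ w j ∂μ := lintegral_mono_ae hpt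
      _ = (∏ j, c j) * ∫⁻ ω, ∏ j, (h j ω ^ (t j).toReal) ^ w j ∂μ := by
          refine lintegral_const_mul _ ?_
          exact Finset.measurable_fun_prod _ fun j _ => ((hh j).pow_const _).pow_const _
      _ ≤ (∏ j, c j) * ∏ j, (∫⁻ ω, h j ω ^ (t j).toReal ∂μ) ^ w j := by
          gcongr
          refine ENNReal.lintegral_prod_norm_pow_le _ (fun j _ => ((hh j).pow_const _).aemeasurable)
            hwsum fun j _ => ?_
          exact mul_nonneg hτ.le (inv_nonneg.2 ENNReal.toReal_nonneg)
      _ = _ := by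
          rw [← Finset.prod_mul_distrib, ← ENNReal.prod_rpow_of_nonneg hτ.le]
          exact Finset.prod_congr rfl fun j _ => by rw [hN, mul_comm]
  simp only [eNorm, hT, if_false]
  calc _ ≤ ((∏ j, eNorm (t j) μ (h j)) ^ τ) ^ (1 / τ) := ENNReal.rpow_le_rpow hmain (by positivity)
    _ = _ := by rw [← ENNReal.rpow_mul, one_div, mul_inv_cancel₀ hτ.ne', ENNReal.rpow_one]; rfl

lemma sum_rpow_le {ι : Type*} (s : Finset ι) (b : ι → ℝ≥0∞) {e : ℝ} (he : 1 ≤ e) :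
    ∑ i ∈ s, b i ^ e ≤ (∑ i ∈ s, b i) ^ e := by
  classical
  induction s using Finset.induction_on with
  | empty => simp
  | insert a s ha ih =>
    rw [Finset.sum_insert ha, Finset.sum_insert ha]
    calc _ ≤ b a ^ e + (∑ i ∈ s, b i) ^ e := by gcongr
      _ ≤ _ := ENNReal.add_rpow_le_rpow_add _ _ he

end SD

namespace SD

lemma max_rpow_le {τ : ℝ} (hτ : 0 ≤ τ) (u v : ℝ≥0∞) : (max u v) ^ τ ≤ u ^ τ + v ^ τ := by
  rcases le_total u v with h | h
  · rw [max_eq_right h]; exact le_add_self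
  · rw [max_eq_left h]; exact le_self_add

lemma stop_lemma {d : ℕ} {Ω : Type} [MeasurableSpace Ω] (μ : Measure Ω)
    (a : Cube d → Ω → ℝ≥0∞) (ha : ∀ Q, Measurable (a Q)) (A : Cube d → ℝ≥0∞) (τ : ℝ) (hτ : 0 < τ)
    (hweak : ∀ D : Finset (Cube d), Lam D → ∀ Q0 : Cube d, (∀ Q ∈ D, Q.set ⊆ Q0.set) →
      2 * volume {x | x ∈ Q0.set ∧ A Q0 < (∫⁻ ω, mx D (fun Q => a Q ω) x ^ τ ∂μ) ^ (1 / τ)}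
        ≤ Q0.vol) :
    ∀ D : Finset (Cube d), Lam D → ∃ S : Finset (Cube d), S ⊆ D ∧
      IsSparse (S : Set (Cube d)) ∧
      ∀ x, ∫⁻ ω, mx D (fun Q => a Q ω) x ^ τ ∂μ ≤ ∑ Q ∈ S, Q.set.indicator (fun _ => A Q ^ τ) x := by
  classical
  intro D
  induction D using Finset.strongInduction with
  | H D ih =>
  intro hL
  rcases D.eq_empty_or_nonempty with rfl | hne
  · refine ⟨∅, le_rfl, ⟨fun _ => ∅, by simp, by simp⟩, fun x => ?_⟩
    simp [mx, hτ]
  obtain ⟨Q0, hQ0, hmax⟩ := D.exists_max_image (fun Q => Q.side) hne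
  set D0 := D.filter (fun Q => Q.set ⊆ Q0.set) with hD0
  set N : Cube d → ℝ≥0∞ := fun Q' =>
    (∫⁻ ω, (⨆ Q ∈ D0.filter (fun Q => Q'.set ⊆ Q.set), a Q ω) ^ τ ∂μ) ^ (1 / τ) with hN
  set Bad := D0.filter (fun Q' => A Q0 < N Q') with hBad
  have hBadsub : U Bad ⊆ {x | x ∈ Q0.set ∧
      A Q0 < (∫⁻ ω, mx D0 (fun Q => a Q ω) x ^ τ ∂μ) ^ (1 / τ)} := by
    intro x hx
    simp only [U, Set.mem_iUnion] at hx
    obtain ⟨Q', hQ', hx⟩ := hx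
    rw [hBad, Finset.mem_filter] at hQ'
    refine ⟨(Finset.mem_filter.1 hQ'.1).2 hx, hQ'.2.trans_le ?_⟩
    refine ENNReal.rpow_le_rpow (lintegral_mono fun ω => ENNReal.rpow_le_rpow ?_ hτ.le)
      (by positivity)
    refine iSup₂_le fun Q hQ => ?_
    rw [Finset.mem_filter] at hQ
    exact le_mx (a := fun Q => a Q ω) hQ.1 (hQ.2 hx)
  have hvol : 2 * volume (U Bad) ≤ Q0.vol := by
    refine le_trans ?_ (hweak D0 (hL.mono (Finset.filter_subset _ _)) Q0
      fun Q hQ => (Finset.mem_filter.1 hQ).2)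
    gcongr
  have hQ0Bad : Q0 ∉ Bad := by
    intro h
    have h1 : Q0.vol ≤ volume (U Bad) := measure_mono fun x hx => by
      simp only [U, Set.mem_iUnion]; exact ⟨Q0, h, hx⟩
    have h2 : 2 * Q0.vol ≤ 1 * Q0.vol := by
      rw [one_mul]; exact le_trans (by gcongr) hvol
    have h3 := (ENNReal.mul_le_mul_iff_left (vol_ne_zero Q0) (vol_ne_top Q0)).1 h2
    norm_num at h3
  set R := D.filter (fun Q => ¬ Q.set ⊆ Q0.set ∨ Q ∈ Bad) with hR
  have hRD : R ⊆ D := Finset.filter_subset _ _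
  have hss : R ⊂ D :=
    (Finset.ssubset_iff_of_subset hRD).2 ⟨Q0, hQ0, by simp [hR, hQ0Bad]⟩
  obtain ⟨S, hSR, ⟨E, hE, hEdis⟩, hS⟩ := ih R hss (hL.mono hRD)
  have hQ0S : Q0 ∉ S := fun h => by
    have := hSR h
    simp [hR, hQ0Bad] at this
  refine ⟨insert Q0 S, ?_, ?_, ?_⟩
  · exact Finset.insert_subset hQ0 (hSR.trans hRD)
  · have hdisQ0 : ∀ Q ∈ S, Disjoint (Q0.set \ U Bad) (E Q) := by
      intro Q hQ
      have hQR := hSR hQ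
      rw [hR, Finset.mem_filter] at hQR
      have hEQ := (hE Q (by simpa using hQ)).2.1
      by_cases hb : Q ∈ Bad
      · refine Set.disjoint_left.2 fun x hx hx' => hx.2 ?_
        simp only [U, Set.mem_iUnion]; exact ⟨Q, hb, hEQ hx'⟩
      · have := (hL Q hQR.1 Q0 hQ0 (hmax Q hQR.1)).resolve_left (hQR.2.resolve_right hb)
        exact this.symm.mono Set.diff_subset hEQ
    have hneq : ∀ Q ∈ S, Q ≠ Q0 := fun Q hQ h => hQ0S (h ▸ hQ)
    refine ⟨fun Q => if Q = Q0 then Q0.set \ U Bad else E Q, ?_, ?_⟩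
    · intro Q hQ
      rw [Finset.mem_coe, Finset.mem_insert] at hQ
      rcases hQ with rfl | hQ
      · simp only [if_true]
        refine ⟨(measurableSet_set _).diff (measurableSet_U _), Set.diff_subset, ?_⟩
        have h1 : Q.vol ≤ volume (U Bad) + volume (Q.set \ U Bad) := by
          refine le_trans (measure_mono ?_) (measure_union_le _ _)
          intro x hx
          by_cases h : x ∈ U Bad
          · exact Or.inl h
          · exact Or.inr ⟨hx, h⟩
        have h2 : 2 * Q.vol ≤ Q.vol + 2 * volume (Q.set \ U Bad) := by
          calc 2 * Q.vol ≤ 2 * (volume (U Bad) + volume (Q.set \ U Bad)) := by gcongr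
            _ = 2 * volume (U Bad) + 2 * volume (Q.set \ U Bad) := mul_add _ _ _
            _ ≤ _ := by gcongr
        rw [two_mul Q.vol] at h2
        exact (ENNReal.add_le_add_iff_left (vol_ne_top Q)).1 h2
      · simp only [hneq Q hQ, if_false]
        exact hE Q (by simpa using hQ)
    · intro Q hQ Q' hQ' hne
      rw [Finset.mem_coe, Finset.mem_insert] at hQ hQ'
      rcases hQ with rfl | hQ <;> rcases hQ' with rfl | hQ'
      · exact absurd rfl hne
      · simp only [Function.onFun, if_true, hneq Q' hQ', if_false]
        exact hdisQ0 Q' hQ'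
      · simp only [Function.onFun, if_true, hneq Q hQ, if_false]
        exact (hdisQ0 Q hQ).symm
      · simp only [Function.onFun, hneq Q hQ, hneq Q' hQ', if_false]
        exact hEdis (by simpa using hQ) (by simpa using hQ') hne
  · intro x
    rw [Finset.sum_insert hQ0S]
    set P := D.filter (fun Q => Q ∉ R ∧ x ∈ Q.set) with hP
    rcases P.eq_empty_or_nonempty with hPe | hPne
    · refine le_trans ?_ ((hS x).trans le_add_self)
      refine lintegral_mono fun ω => ENNReal.rpow_le_rpow ?_ hτ.le
      refine mx_le.2 fun Q hQ hx => ?_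
      have hQR : Q ∈ R := by
        by_contra h
        have : Q ∈ P := by rw [hP, Finset.mem_filter]; exact ⟨hQ, h, hx⟩
        simp [hPe] at this
      exact le_mx (a := fun Q => a Q ω) hQR hx
    · obtain ⟨Q', hQ', hmin⟩ := P.exists_min_image (fun Q => Q.side) hPne
      have hPD0 : ∀ Q ∈ P, Q ∈ D0 ∧ Q ∉ Bad ∧ x ∈ Q.set := by
        intro Q hQ
        rw [hP, Finset.mem_filter] at hQ
        obtain ⟨h1, h2, h3⟩ := hQ
        have h4 : Q.set ⊆ Q0.set ∧ Q ∉ Bad := by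
          simp only [hR, Finset.mem_filter, h1, true_and, not_or, not_not] at h2
          exact h2
        exact ⟨Finset.mem_filter.2 ⟨h1, h4.1⟩, h4.2, h3⟩
      obtain ⟨hQ'0, hQ'B, hxQ'⟩ := hPD0 Q' hQ'
      have hxQ0 : x ∈ Q0.set := (Finset.mem_filter.1 hQ'0).2 hxQ'
      have hNle : N Q' ≤ A Q0 := by
        by_contra h
        exact hQ'B (Finset.mem_filter.2 ⟨hQ'0, not_le.1 h⟩)
      have hNle' : ∫⁻ ω, (⨆ Q ∈ D0.filter (fun Q => Q'.set ⊆ Q.set), a Q ω) ^ τ ∂μ ≤ A Q0 ^ τ := by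
        have := ENNReal.rpow_le_rpow hNle hτ.le
        rwa [hN, ← ENNReal.rpow_mul, one_div, inv_mul_cancel₀ hτ.ne', ENNReal.rpow_one] at this
      have hmeas : Measurable (fun ω => mx R (fun Q => a Q ω) x ^ τ) := by
        refine Measurable.pow_const ?_ τ
        exact Measurable.comp (f := fun ω : Ω => (x, ω))
          (measurable_mx_joint R a fun Q _ => ha Q) measurable_prodMk_left
      calc ∫⁻ ω, mx D (fun Q => a Q ω) x ^ τ ∂μ
          ≤ ∫⁻ ω, mx R (fun Q => a Q ω) x ^ τ +
            (⨆ Q ∈ D0.filter (fun Q => Q'.set ⊆ Q.set), a Q ω) ^ τ ∂μ := by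
            refine lintegral_mono fun ω => ?_
            have hle : mx D (fun Q => a Q ω) x ≤ max (mx R (fun Q => a Q ω) x)
                (⨆ Q ∈ D0.filter (fun Q => Q'.set ⊆ Q.set), a Q ω) := by
              refine mx_le.2 fun Q hQ hx => ?_
              by_cases hQR : Q ∈ R
              · exact le_max_of_le_left (le_mx (a := fun Q => a Q ω) hQR hx)
              · have hQP : Q ∈ P := Finset.mem_filter.2 ⟨hQ, hQR, hx⟩
                have hsub : Q'.set ⊆ Q.set := by
                  refine (hL Q' (Finset.mem_filter.1 hQ').1 Q hQ (hmin Q hQP)).resolve_right ?_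
                  exact Set.not_disjoint_iff.2 ⟨x, hxQ', hx⟩
                refine le_max_of_le_right ?_
                exact le_iSup₂_of_le Q (Finset.mem_filter.2 ⟨(hPD0 Q hQP).1, hsub⟩) le_rfl
            refine (ENNReal.rpow_le_rpow hle hτ.le).trans ?_
            exact max_rpow_le hτ.le _ _
        _ = ∫⁻ ω, mx R (fun Q => a Q ω) x ^ τ ∂μ +
            ∫⁻ ω, (⨆ Q ∈ D0.filter (fun Q => Q'.set ⊆ Q.set), a Q ω) ^ τ ∂μ :=
            lintegral_add_left hmeas _
        _ ≤ _ := by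
            rw [add_comm, Set.indicator_of_mem hxQ0]
            exact add_le_add hNle' (hS x)

end SD

namespace SD

lemma measurable_latAvg {d : ℕ} {Ω : Type} [MeasurableSpace Ω] (r : ℝ≥0∞)
    (f : (Fin d → ℝ) → Ω → ℂ) (hf : Measurable (Function.uncurry f)) (Q : Cube d) :
    Measurable (latAvg r f Q) := by
  have h1 : Measurable (fun z : (Fin d → ℝ) × Ω => (‖f z.1 z.2‖₊ : ℝ≥0∞) ^ r.toReal) :=
    Measurable.pow_const (measurable_coe_nnreal_ennreal.comp hf.nnnorm) _
  have h2 : Measurable (fun ω => ∫⁻ y in Q.set, (‖f y ω‖₊ : ℝ≥0∞) ^ r.toReal) :=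
    h1.lintegral_prod_left'
  exact (h2.div_const _).pow_const _

lemma eNorm_mono {α : Type*} [MeasurableSpace α] {p : ℝ≥0∞} (hp : p ≠ ∞) (μ : Measure α)
    {F G : α → ℝ≥0∞} (h : ∀ x, F x ≤ G x) : eNorm p μ F ≤ eNorm p μ G := by
  simp only [eNorm, hp, if_false]
  exact ENNReal.rpow_le_rpow (lintegral_mono fun x => ENNReal.rpow_le_rpow (h x) ENNReal.toReal_nonneg)
    (by positivity)

lemma final_sum {d : ℕ} (S : Finset (Cube d)) (A : Cube d → ℝ≥0∞) (C I : ℝ≥0∞) {τ κ : ℝ}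
    (hκ : 0 < κ) (hκτ : κ ≤ τ) (x : Fin d → ℝ)
    (h : I ≤ ∑ Q ∈ S, Q.set.indicator (fun _ => (C * A Q) ^ τ) x) :
    I ^ (1 / τ) ≤ C * (∑ Q ∈ S, Q.set.indicator (fun _ => A Q ^ κ) x) ^ (1 / κ) := by
  have hτ : 0 < τ := hκ.trans_le hκτ
  set b : Cube d → ℝ≥0∞ := fun Q => Q.set.indicator (fun _ => A Q ^ κ) x with hb
  have hterm : ∀ Q, Q.set.indicator (fun _ => (C * A Q) ^ τ) x = C ^ τ * b Q ^ (τ / κ) := by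
    intro Q
    by_cases hx : x ∈ Q.set
    · simp only [hb, Set.indicator_of_mem hx]
      rw [← ENNReal.rpow_mul, mul_div_cancel₀ _ hκ.ne', ENNReal.mul_rpow_of_nonneg _ _ hτ.le]
    · simp only [hb, Set.indicator_of_notMem hx]
      rw [ENNReal.zero_rpow_of_pos (by positivity), mul_zero]
  have h1 : I ≤ C ^ τ * (∑ Q ∈ S, b Q) ^ (τ / κ) := by
    refine h.trans ?_
    simp_rw [hterm]
    rw [← Finset.mul_sum]
    refine mul_le_mul' le_rfl (sum_rpow_le S b ?_)
    rwa [le_div_iff₀ hκ, one_mul]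
  calc I ^ (1 / τ) ≤ (C ^ τ * (∑ Q ∈ S, b Q) ^ (τ / κ)) ^ (1 / τ) :=
        ENNReal.rpow_le_rpow h1 (by positivity)
    _ = _ := by
      rw [ENNReal.mul_rpow_of_nonneg _ _ (by positivity), ← ENNReal.rpow_mul, ← ENNReal.rpow_mul,
        mul_one_div_cancel hτ.ne', ENNReal.rpow_one]
      congr 2
      field_simp

lemma hweak_prod {d m : ℕ} (r t : Fin m → ℝ≥0∞) (ht : ∀ j, t j ≠ 0)
    (hT : (∑ j, (t j)⁻¹)⁻¹ ≠ ∞) (η : ℝ≥0∞) (hη : 2 * (m * η) ≤ 1) (B : Fin m → ℝ≥0∞)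
    {Ω : Type} [MeasurableSpace Ω] (μ : Measure Ω)
    (f : Fin m → (Fin d → ℝ) → Ω → ℂ) (hf : ∀ j, Measurable (Function.uncurry (f j)))
    (D : Finset (Cube d)) (Q0 : Cube d)
    (hB : ∀ j, volume {x | x ∈ Q0.set ∧ B j * avg (r j) (fun y => eNorm (t j) μ (nn (f j y))) Q0 <
      eNorm (t j) μ (fun ω => mx D (fun Q => latAvg (r j) (f j) Q ω) x)} ≤ η * Q0.vol)
    (C : ℝ≥0∞) (hC : ∏ j, B j ≤ C) :
    2 * volume {x | x ∈ Q0.set ∧ C * ∏ j, avg (r j) (fun y => eNorm (t j) μ (nn (f j y))) Q0 <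
      eNorm (∑ j, (t j)⁻¹)⁻¹ μ (fun ω => mx D (fun Q => ∏ j, latAvg (r j) (f j) Q ω) x)}
      ≤ Q0.vol := by
  have hsub : {x | x ∈ Q0.set ∧ C * ∏ j, avg (r j) (fun y => eNorm (t j) μ (nn (f j y))) Q0 <
      eNorm (∑ j, (t j)⁻¹)⁻¹ μ (fun ω => mx D (fun Q => ∏ j, latAvg (r j) (f j) Q ω) x)} ⊆
      ⋃ j, {x | x ∈ Q0.set ∧ B j * avg (r j) (fun y => eNorm (t j) μ (nn (f j y))) Q0 <
      eNorm (t j) μ (fun ω => mx D (fun Q => latAvg (r j) (f j) Q ω) x)} := by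
    rintro x ⟨hx0, hx⟩
    by_contra hcon
    rw [Set.mem_iUnion, not_exists] at hcon
    have hle : ∀ j, eNorm (t j) μ (fun ω => mx D (fun Q => latAvg (r j) (f j) Q ω) x) ≤
        B j * avg (r j) (fun y => eNorm (t j) μ (nn (f j y))) Q0 :=
      fun j => not_lt.1 fun h => hcon j ⟨hx0, h⟩
    refine absurd hx (not_lt.2 ?_)
    calc _ ≤ eNorm (∑ j, (t j)⁻¹)⁻¹ μ
            (fun ω => ∏ j, mx D (fun Q => latAvg (r j) (f j) Q ω) x) :=
          eNorm_mono hT μ fun ω => mx_le.2 fun Q hQ hxQ =>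
            Finset.prod_le_prod' fun j _ => le_mx (a := fun Q => latAvg (r j) (f j) Q ω) hQ hxQ
      _ ≤ ∏ j, eNorm (t j) μ (fun ω => mx D (fun Q => latAvg (r j) (f j) Q ω) x) := by
          refine holder μ t ht hT (fun j ω => mx D (fun Q => latAvg (r j) (f j) Q ω) x) fun j => ?_
          exact Measurable.comp (f := fun ω : Ω => (x, ω))
            (measurable_mx_joint D (fun Q => latAvg (r j) (f j) Q)
              fun Q _ => measurable_latAvg _ _ (hf j) Q) measurable_prodMk_left
      _ ≤ ∏ j, (B j * avg (r j) (fun y => eNorm (t j) μ (nn (f j y))) Q0) :=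
          Finset.prod_le_prod' fun j _ => hle j
      _ ≤ _ := by
          rw [Finset.prod_mul_distrib]
          gcongr
  calc _ ≤ 2 * ∑ j, volume {x | x ∈ Q0.set ∧
          B j * avg (r j) (fun y => eNorm (t j) μ (nn (f j y))) Q0 <
          eNorm (t j) μ (fun ω => mx D (fun Q => latAvg (r j) (f j) Q ω) x)} := by
        refine mul_le_mul' le_rfl ((measure_mono hsub).trans (measure_iUnion_fintype_le _ _))
    _ ≤ 2 * ∑ _j : Fin m, η * Q0.vol := by
        gcongr with j
        exact hB j
    _ = 2 * (m * η) * Q0.vol := by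
        rw [Finset.sum_const, Finset.card_univ, Fintype.card_fin, nsmul_eq_mul]; ring
    _ ≤ 1 * Q0.vol := by gcongr
    _ = _ := one_mul _

end SD

/-- pointwise sparse domination of the dyadic lattice multisublinear
maximal operator with values in `L^t(Ω)`. -/
theorem statement9 (d m : ℕ) (hd : 1 ≤ d) (hm : 1 ≤ m)
    (r : Fin m → ℝ≥0∞) (hr : ∀ j, 0 < r j ∧ r j ≠ ∞)
    (t : Fin m → ℝ≥0∞) (hrt : ∀ j, r j < t j) (htfin : (∑ j, (t j)⁻¹)⁻¹ ≠ ∞)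
    (q : ℝ≥0∞) (hq1 : (∑ j, (r j)⁻¹)⁻¹ ≤ q) (hq2 : q ≤ (∑ j, (t j)⁻¹)⁻¹) :
    ∃ C : ℝ≥0∞, 0 < C ∧ C ≠ ∞ ∧
      ∀ (Ω : Type) [MeasurableSpace Ω] (μ : Measure Ω) [SigmaFinite μ],
      ∀ (D : Finset (Cube d)), (∀ Q ∈ D, Q.IsDyadic) →
      ∀ (f : Fin m → (Fin d → ℝ) → Ω → ℂ),
        (∀ j, Measurable (Function.uncurry (f j))) →
        (∀ j ω (Q : Cube d), ∫⁻ x in Q.set, (‖f j x ω‖₊ : ℝ≥0∞) ^ (r j).toReal < ∞) →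
        (∀ j (Q : Cube d),
          ∫⁻ x in Q.set, (eNorm (t j) μ (nn (f j x))) ^ (r j).toReal < ∞) →
        ∃ S : Set (Cube d), S ⊆ ↑D ∧ IsSparse S ∧
          ∀ᵐ x, eNorm (∑ j, (t j)⁻¹)⁻¹ μ (latMax r D f x) ≤
            C * (∑' Q : S, (Q : Cube d).set.indicator
                (fun _ => (∏ j, avg (r j)
                    (fun y => eNorm (t j) μ (nn (f j y))) (Q : Cube d)) ^ q.toReal) x)
              ^ (1 / q.toReal) := by
  have ht0 : ∀ j, t j ≠ 0 := fun j => ((hr j).1.trans (hrt j)).ne'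
  have hT0 : (∑ j, (t j)⁻¹)⁻¹ ≠ 0 :=
    ENNReal.inv_ne_zero.2 (ENNReal.sum_ne_top.2 fun j _ => ENNReal.inv_ne_top.2 (ht0 j))
  have hR0 : (∑ j, (r j)⁻¹)⁻¹ ≠ 0 :=
    ENNReal.inv_ne_zero.2 (ENNReal.sum_ne_top.2 fun j _ => ENNReal.inv_ne_top.2 (hr j).1.ne')
  have hτ : 0 < ((∑ j, (t j)⁻¹)⁻¹).toReal := ENNReal.toReal_pos hT0 htfin
  have hq0 : q ≠ 0 := ((pos_iff_ne_zero.2 hR0).trans_le hq1).ne'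
  have hqt : q ≠ ∞ := ne_top_of_le_ne_top htfin hq2
  have hκ : 0 < q.toReal := ENNReal.toReal_pos hq0 hqt
  have hκτ : q.toReal ≤ ((∑ j, (t j)⁻¹)⁻¹).toReal := ENNReal.toReal_mono htfin hq2
  have hm0 : (m : ℝ≥0∞) ≠ 0 := by exact_mod_cast (by omega : m ≠ 0)
  have h2m0 : (2 * m : ℝ≥0∞) ≠ 0 := mul_ne_zero (by norm_num) hm0
  have h2mt : (2 * m : ℝ≥0∞) ≠ ∞ := ENNReal.mul_ne_top (by norm_num) (ENNReal.natCast_ne_top m)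
  have hη : 2 * ((m : ℝ≥0∞) * (2 * (m : ℝ≥0∞))⁻¹) ≤ 1 := by
    rw [← mul_assoc, ENNReal.mul_inv_cancel h2m0 h2mt]
  choose B hBtop hB using fun j => SD.weakJ (d := d) (r j) (t j) (hr j).1 (hr j).2 (hrt j)
    (2 * (m : ℝ≥0∞))⁻¹ (ENNReal.inv_ne_zero.2 h2mt) (ENNReal.inv_ne_top.2 h2m0)
  refine ⟨∏ j, B j + 1, by simp, ?_, ?_⟩
  · exact ENNReal.add_ne_top.2 ⟨ENNReal.prod_ne_top fun j _ => hBtop j, ENNReal.one_ne_top⟩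
  intro Ω _ μ _ D hD f hf _ hfin
  obtain ⟨S, hSD, hSs, hS⟩ := SD.stop_lemma μ (fun Q ω => ∏ j, latAvg (r j) (f j) Q ω)
    (fun Q => Finset.measurable_fun_prod _ fun j _ => SD.measurable_latAvg (r j) (f j) (hf j) Q)
    (fun Q => (∏ j, B j + 1) * ∏ j, avg (r j) (fun y => eNorm (t j) μ (nn (f j y))) Q)
    ((∑ j, (t j)⁻¹)⁻¹).toReal hτ
    (by
      intro D' hL' Q0 hsub
      have h := SD.hweak_prod r t ht0 htfin _ hη B μ f hf D' Q0
        (fun j => hB j Ω μ D' hL' Q0 hsub (f j) (hf j) (hfin j Q0)) (∏ j, B j + 1) le_self_add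
      simpa only [eNorm, htfin, if_false] using h)
    D (SD.lam_of_dyadic D hD)
  refine ⟨(S : Set (Cube d)), by exact_mod_cast hSD, hSs, Filter.Eventually.of_forall fun x => ?_⟩
  have h := SD.final_sum S (fun Q => ∏ j, avg (r j) (fun y => eNorm (t j) μ (nn (f j y))) Q)
    (∏ j, B j + 1) _ hκ hκτ x (hS x)
  have e := Finset.tsum_subtype S (fun Q : Cube d => Q.set.indicator
    (fun _ => (∏ j, avg (r j) (fun y => eNorm (t j) μ (nn (f j y))) Q) ^ q.toReal) x)
  rw [← e] at h
  have hL : eNorm (∑ j, (t j)⁻¹)⁻¹ μ (latMax r D f x) =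
      (∫⁻ ω, SD.mx D (fun Q => ∏ j, latAvg (r j) (f j) Q ω) x ^ ((∑ j, (t j)⁻¹)⁻¹).toReal ∂μ) ^
        (1 / ((∑ j, (t j)⁻¹)⁻¹).toReal) := if_neg htfin
  rw [hL]
  exact h

end
end
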